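/- arXiv:2301.13222 — 7 statements merged into one kernel-verified Lean document; each statement's English description precedes it below -/
import Mathlib

section
/- For every positive integer r there exist infinitely many squarefree integers D > 1 such that the real quadratic field K = ℚ(√D) admits no universal quadratic O_K-lattice of rank ≤ r. -/
open NumberField

/-- An odd modulus `p ^ 2` has at most two roots of `(2 * m + 1) ^ 2 + 1` per period. -/
theorem card_sq_dvd_odd_sq_add_one_le {p : ℕ} (hp : p.Prime) (hp2 : p ≠ 2) (N : ℕ) :
    ((Finset.range N).filter (fun m => p * p ∣ (2 * m + 1) ^ 2 + 1)).card
      ≤ 2 * (N / (p * p) + 1) := by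
  classical
  rcases Finset.eq_empty_or_nonempty
    ((Finset.range N).filter (fun m => p * p ∣ (2 * m + 1) ^ 2 + 1)) with h | ⟨a, ha⟩
  · simp [h]
  have hpp : 0 < p * p := Nat.mul_pos hp.pos hp.pos
  have hcount (v : ℕ) : ((Finset.range N).filter (fun m => m ≡ v [MOD p * p])).card
      ≤ N / (p * p) + 1 := by
    rw [← Nat.count_eq_card_filter_range, Nat.count_modEq_card _ hpp]
    split_ifs <;> omega
  obtain ⟨c, hc⟩ : ∃ c : ℕ, p * p ∣ a + c + 1 :=
    ⟨a * (p * p) + p * p - 1 + (a * (p * p) - a), by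
      have : a ≤ a * (p * p) := Nat.le_mul_of_pos_right _ hpp
      refine ⟨2 * a + 1, ?_⟩
      have h3 : p * p * (2 * a + 1) = a * (p * p) + a * (p * p) + p * p := by ring
      omega⟩
  have hsub : (Finset.range N).filter (fun m => p * p ∣ (2 * m + 1) ^ 2 + 1) ⊆
      (Finset.range N).filter (fun m => m ≡ a [MOD p * p]) ∪
      (Finset.range N).filter (fun m => m ≡ c [MOD p * p]) := by
    intro m hm
    simp only [Finset.mem_union, Finset.mem_filter] at hm ha ⊢
    suffices h : m ≡ a [MOD p * p] ∨ m ≡ c [MOD p * p] by tauto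
    have h2 : IsCoprime (p : ℤ) 2 := by
      have := (Nat.coprime_primes hp Nat.prime_two).2 hp2
      exact_mod_cast Nat.isCoprime_iff_coprime.2 this
    have hpZ : Prime (p : ℤ) := Nat.prime_iff_prime_int.1 hp
    have hm' : (p * p : ℤ) ∣ (2 * m + 1) ^ 2 + 1 := by exact_mod_cast hm.2
    have ha' : (p * p : ℤ) ∣ (2 * a + 1) ^ 2 + 1 := by exact_mod_cast ha.2
    have hc' : (p * p : ℤ) ∣ a + c + 1 := by exact_mod_cast hc
    have h4 : (p * p : ℤ) ∣ 2 * (2 * ((m - a : ℤ) * (m + a + 1))) := by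
      exact (dvd_sub hm' ha').trans (dvd_of_eq (by ring))
    have h22 : IsCoprime (p * p : ℤ) 2 := h2.mul_left h2
    have hprod : (p * p : ℤ) ∣ (m - a : ℤ) * (m + a + 1) :=
      h22.dvd_of_dvd_mul_left (h22.dvd_of_dvd_mul_left h4)
    by_cases hd : (p : ℤ) ∣ m - a
    · by_cases he : (p : ℤ) ∣ m + a + 1
      · exfalso
        have h5 : (p : ℤ) ∣ 2 * a + 1 := (dvd_sub he hd).trans (dvd_of_eq (by ring))
        have h6 : (p : ℤ) ∣ (2 * a + 1) ^ 2 + 1 := (Dvd.intro _ rfl).trans ha'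
        have h7 : (p : ℤ) ∣ 1 := (dvd_add_right (h5.pow two_ne_zero)).1 h6
        exact hpZ.not_dvd_one h7
      · left
        have h8 : IsCoprime (p : ℤ) (m + a + 1) := (hpZ.coprime_iff_not_dvd).2 he
        have h9 := (h8.mul_left h8).dvd_of_dvd_mul_right hprod
        exact ((Nat.modEq_iff_dvd).2 (by exact_mod_cast h9)).symm
    · right
      have h8 : IsCoprime (p : ℤ) (m - a) := (hpZ.coprime_iff_not_dvd).2 hd
      have h9 := (h8.mul_left h8).dvd_of_dvd_mul_left hprod
      refine ((Nat.modEq_iff_dvd).2 ?_).symm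
      push_cast
      exact (dvd_sub h9 hc').trans (dvd_of_eq (by ring))
  calc _ ≤ _ := Finset.card_le_card hsub
    _ ≤ _ := Finset.card_union_le _ _
    _ ≤ _ := by have := hcount a; have := hcount c; omega

/-- A prime whose square divides `(2 * m + 1) ^ 2 + 1` is `1` or `5` modulo `12`. -/
theorem prime_mod_twelve_of_dvd_odd_sq_add_one {p m : ℕ} (hp : p.Prime)
    (h : p * p ∣ (2 * m + 1) ^ 2 + 1) : ∃ k, p = 12 * k + 5 ∨ p = 12 * k + 13 := by
  have hp2 : p ≠ 2 := by
    rintro rfl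
    have : (2 * m + 1) ^ 2 + 1 = 4 * (m ^ 2 + m) + 2 := by ring
    omega
  have hd : p ∣ (2 * m + 1) ^ 2 + 1 := (Dvd.intro _ rfl).trans h
  have := Fact.mk hp
  have h4 : p % 4 ≠ 3 := by
    refine ZMod.mod_four_ne_three_of_sq_eq_neg_one (y := ((2 * m + 1 : ℕ) : ZMod p)) ?_
    rw [eq_neg_iff_add_eq_zero]
    exact_mod_cast (ZMod.natCast_eq_zero_iff _ _).2 hd
  have hodd := hp.eq_two_or_odd
  have h3 : p % 3 ≠ 0 := by
    intro h0
    have := (Nat.prime_dvd_prime_iff_eq Nat.prime_three hp).1 (Nat.dvd_of_mod_eq_zero h0)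
    omega
  have := hp.two_le
  rcases (show p % 12 = 1 ∨ p % 12 = 5 by omega) with h1 | h1
  · exact ⟨p / 12 - 1, by omega⟩
  · exact ⟨p / 12, by omega⟩

theorem sum_inv_sq_le (n : ℕ) :
    ∑ k ∈ Finset.range n, ((1 : ℚ) / (12 * k + 5) ^ 2 + 1 / (12 * k + 13) ^ 2) ≤ 5 / 72 := by
  suffices h : ∑ k ∈ Finset.range n, ((1 : ℚ) / (12 * k + 5) ^ 2 + 1 / (12 * k + 13) ^ 2)
      ≤ (5 / 72 - 5 / (72 * (5 * n + 1)) : ℚ) from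
    h.trans (sub_le_self _ (by positivity))
  induction n with
  | zero => norm_num
  | succ n ih =>
    rw [Finset.sum_range_succ]
    have hx : (0 : ℚ) ≤ n := n.cast_nonneg
    have : (1 : ℚ) / (12 * n + 5) ^ 2 + 1 / (12 * n + 13) ^ 2
        ≤ 5 / (72 * (5 * n + 1)) - 5 / (72 * (5 * (n + 1) + 1)) := by
      rw [div_add_div _ _ (by positivity) (by positivity),
        div_sub_div _ _ (by positivity) (by positivity),
        div_le_div_iff₀ (by positivity) (by positivity), ← sub_nonneg]
      ring_nf
      positivity
    push_cast
    linarith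

theorem card_not_squarefree_odd_sq_add_one_le (N : ℕ) :
    (((Finset.range N).filter (fun m => ¬ Squarefree ((2 * m + 1) ^ 2 + 1))).card : ℚ)
      ≤ 29 / 36 * N + 4 := by
  classical
  let S (p : ℕ) : Finset ℕ :=
    (Finset.range N).filter (fun m => p.Prime ∧ p * p ∣ (2 * m + 1) ^ 2 + 1)
  have hS (p : ℕ) (hp5 : 5 ≤ p) : ((S p).card : ℚ) ≤ 2 * (N * (1 / (p : ℚ) ^ 2) + 1) := by
    by_cases hp : p.Prime
    · have h := card_sq_dvd_odd_sq_add_one_le hp (by omega) N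
      have h' : ((S p).card : ℚ) ≤ 2 * ((N / (p * p) : ℕ) + 1) := by
        simp only [S, hp, true_and]
        exact_mod_cast h
      have h2 : ((N / (p * p) : ℕ) : ℚ) ≤ N / (p * p : ℕ) := Nat.cast_div_le
      push_cast at h2
      have h3 : (N : ℚ) / (p * p) = N * (1 / (p : ℚ) ^ 2) := by ring
      linarith
    · have h0 : S p = ∅ := by simp [S, hp]
      rw [h0]
      simp only [Finset.card_empty, Nat.cast_zero]
      positivity
  have hsub : (Finset.range N).filter (fun m => ¬ Squarefree ((2 * m + 1) ^ 2 + 1)) ⊆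
      (Finset.range (N / 6 + 1)).biUnion (fun k => S (12 * k + 5) ∪ S (12 * k + 13)) := by
    intro m hm
    simp only [Finset.mem_filter, Finset.mem_range, Nat.squarefree_iff_prime_squarefree,
      not_forall, not_not] at hm
    obtain ⟨hmN, p, hp, hdvd⟩ := hm
    obtain ⟨k, hk⟩ := prime_mod_twelve_of_dvd_odd_sq_add_one hp hdvd
    have hle : p * p ≤ (2 * m + 1) ^ 2 + 1 := Nat.le_of_dvd (Nat.succ_pos _) hdvd
    have hp2N : p ≤ 2 * N := by
      by_contra! hlt
      nlinarith
    simp only [Finset.mem_biUnion, Finset.mem_range, Finset.mem_union, S, Finset.mem_filter]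
    refine ⟨k, by omega, ?_⟩
    rcases hk with rfl | rfl
    · exact Or.inl ⟨hmN, hp, hdvd⟩
    · exact Or.inr ⟨hmN, hp, hdvd⟩
  have hN6 : ((N / 6 : ℕ) : ℚ) ≤ N / 6 := Nat.cast_div_le
  have hsum := sum_inv_sq_le (N / 6 + 1)
  calc (((Finset.range N).filter (fun m => ¬ Squarefree ((2 * m + 1) ^ 2 + 1))).card : ℚ)
      ≤ ∑ k ∈ Finset.range (N / 6 + 1), ((S (12 * k + 5) ∪ S (12 * k + 13)).card : ℚ) := by
        exact_mod_cast (Finset.card_le_card hsub).trans Finset.card_biUnion_le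
    _ ≤ ∑ k ∈ Finset.range (N / 6 + 1),
          (2 * N * ((1 : ℚ) / (12 * k + 5) ^ 2 + 1 / (12 * k + 13) ^ 2) + 4) := by
        refine Finset.sum_le_sum fun k _ => ?_
        have h1 := hS (12 * k + 5) (by omega)
        have h2 := hS (12 * k + 13) (by omega)
        have h3 : ((S (12 * k + 5) ∪ S (12 * k + 13)).card : ℚ)
            ≤ (S (12 * k + 5)).card + (S (12 * k + 13)).card := by
          exact_mod_cast Finset.card_union_le _ _
        push_cast at h1 h2
        linarith
    _ = 2 * N * ∑ k ∈ Finset.range (N / 6 + 1),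
          ((1 : ℚ) / (12 * k + 5) ^ 2 + 1 / (12 * k + 13) ^ 2) + 4 * ((N / 6 : ℕ) + 1) := by
        rw [Finset.sum_add_distrib, ← Finset.mul_sum]
        simp [mul_comm]
    _ ≤ 2 * N * (5 / 72) + 4 * (N / 6 + 1) := by gcongr
    _ = 29 / 36 * N + 4 := by ring

theorem infinite_squarefree_odd_sq_add_one :
    {m : ℕ | Squarefree ((2 * m + 1) ^ 2 + 1)}.Infinite := by
  classical
  refine Set.infinite_of_forall_exists_gt fun B => ?_
  by_contra! hB
  have hsub : Finset.Ico (B + 1) (6 * (B + 7)) ⊆ (Finset.range (6 * (B + 7))).filter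
      (fun m => ¬ Squarefree ((2 * m + 1) ^ 2 + 1)) := by
    intro m hm
    rw [Finset.mem_Ico] at hm
    rw [Finset.mem_filter, Finset.mem_range]
    exact ⟨hm.2, fun h => absurd (hB m h) (by omega)⟩
  have h1 := Finset.card_le_card hsub
  rw [Nat.card_Ico] at h1
  have h2 := card_not_squarefree_odd_sq_add_one_le (6 * (B + 7))
  have h3 : (6 * (B + 7) : ℚ) ≤ B + 1 + ((Finset.range (6 * (B + 7))).filter
      (fun m => ¬ Squarefree ((2 * m + 1) ^ 2 + 1))).card := by
    exact_mod_cast (by omega : 6 * (B + 7) ≤ B + 1 + _)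
  push_cast at h2
  have : (0 : ℚ) ≤ B := B.cast_nonneg
  linarith

open scoped QuadraticAlgebra in
/-- Elements of `ℚ(√d)` integral over `ℤ` lie in `ℤ[√d]` when `d ≡ 2 mod 4` is squarefree. -/
theorem QuadraticAlgebra.exists_int_of_isIntegral {d : ℤ} (hd : Squarefree d) (hd4 : d % 4 = 2)
    {z : QuadraticAlgebra ℚ (d : ℚ) 0} (hz : IsIntegral ℤ z) :
    ∃ x y : ℤ, z.re = x ∧ z.im = y := by
  have hinj := algebraMap_injective (R := ℚ) (a := (d : ℚ)) (b := 0)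
  have hstar : IsIntegral ℤ (star z) :=
    hz.map (starRingEnd (QuadraticAlgebra ℚ (d : ℚ) 0)).toIntAlgHom
  obtain ⟨t, ht⟩ : ∃ t : ℤ, (t : ℚ) = z.trace := by
    refine IsIntegrallyClosed.isIntegral_iff.1 ((isIntegral_algebraMap_iff hinj).1 ?_)
    rw [algebraMap_trace_eq_add_star]
    exact hz.add hstar
  obtain ⟨n, hn⟩ : ∃ n : ℤ, (n : ℚ) = z.norm := by
    refine IsIntegrallyClosed.isIntegral_iff.1 ((isIntegral_algebraMap_iff hinj).1 ?_)
    rw [algebraMap_norm_eq_mul_star]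
    exact hz.mul hstar
  have hω : IsIntegral ℤ (ω : QuadraticAlgebra ℚ (d : ℚ) 0) := by
    refine IsIntegral.of_pow (n := 2) two_pos ?_
    have : (ω : QuadraticAlgebra ℚ (d : ℚ) 0) ^ 2 = algebraMap ℤ _ d := by
      rw [sq, omega_mul_omega_eq_mk]
      ext <;> simp
    rw [this]
    exact isIntegral_algebraMap
  obtain ⟨w, hw⟩ : ∃ w : ℤ, (w : ℚ) = 2 * d * z.im := by
    refine IsIntegrallyClosed.isIntegral_iff.1 ((isIntegral_algebraMap_iff hinj).1 ?_)
    have : algebraMap ℚ (QuadraticAlgebra ℚ (d : ℚ) 0) (2 * d * z.im) = ω * (z - star z) := by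
      ext <;> simp [two_mul, algebraMap_re, algebraMap_im]
      ring
    rw [this]
    exact hω.mul (hz.sub hstar)
  rw [trace_def, zero_mul, add_zero] at ht
  rw [norm_def] at hn
  have hwd : w ^ 2 = d * (t ^ 2 - 4 * n) := by
    have : (w : ℚ) ^ 2 = d * (t ^ 2 - 4 * n) := by
      rw [hw, ht, hn]; ring
    exact_mod_cast this
  obtain ⟨y, rfl⟩ : d ∣ w := (hd.dvd_pow_iff_dvd two_ne_zero).1 ⟨_, hwd⟩
  have hd0 : d ≠ 0 := hd.ne_zero
  have hy : (y : ℚ) = 2 * z.im := by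
    have : (d : ℚ) ≠ 0 := by exact_mod_cast hd0
    push_cast at hw
    apply mul_left_cancel₀ this
    linarith
  have hyt : d * y ^ 2 = t ^ 2 - 4 * n := by
    apply mul_left_cancel₀ hd0
    linear_combination hwd
  obtain ⟨k, rfl⟩ : ∃ k, d = 4 * k + 2 := ⟨d / 4, by omega⟩
  obtain ⟨x, rfl | rfl⟩ := Int.even_or_odd' t
  · obtain ⟨y, rfl | rfl⟩ := Int.even_or_odd' y
    · refine ⟨x, y, ?_, ?_⟩
      · push_cast at ht; linarith
      · push_cast at hy; linarith
    · exfalso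
      ring_nf at hyt
      omega
  · exfalso
    ring_nf at hyt
    omega

/-- A field of degree two over `ℚ` generated by a square root of `d` is `ℚ(√d)`. -/
theorem exists_algEquiv_quadraticAlgebra {K : Type*} [Field K] [NumberField K] {d : ℤ}
    (hd : ∀ q : ℚ, q ^ 2 ≠ d) {s : K} (hs : s ^ 2 = d) (hK : Module.finrank ℚ K = 2) :
    ∃ e : QuadraticAlgebra ℚ (d : ℚ) 0 ≃ₐ[ℚ] K, e QuadraticAlgebra.omega = s := by
  have : Fact (∀ r : ℚ, r ^ 2 ≠ (d : ℚ) + 0 * r) := ⟨by simpa using hd⟩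
  let f : QuadraticAlgebra ℚ (d : ℚ) 0 →ₐ[ℚ] K :=
    QuadraticAlgebra.lift ⟨s, by simp [← sq, hs, Algebra.smul_def]⟩
  have hinj : Function.Injective f := f.toRingHom.injective
  have hbij : Function.Bijective f := by
    refine ⟨hinj, ?_⟩
    refine (LinearMap.injective_iff_surjective_of_finrank_eq_finrank
      (f := f.toLinearMap) ?_).1 hinj
    rw [hK, QuadraticAlgebra.finrank_eq_two]
  exact ⟨AlgEquiv.ofBijective f hbij, by simp [f, QuadraticAlgebra.lift]⟩

/-- A finitely generated lattice of rank at most `r` over a quadratic field has at most `4 ^ r`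
classes modulo `2`. -/
theorem exists_sub_eq_two_nsmul {K : Type*} [Field K] [NumberField K]
    (hK : Module.finrank ℚ K = 2) {V : Type*} [AddCommGroup V] [Module K V]
    [FiniteDimensional K V] [Module (𝓞 K) V] [IsScalarTower (𝓞 K) K V]
    {L : Submodule (𝓞 K) V} (hL : L.FG) {r : ℕ}
    (hr : Module.finrank K (Submodule.span K (L : Set V)) ≤ r)
    {ι : Type*} [Fintype ι] (hι : 4 ^ r < Fintype.card ι) (v : ι → V) (hv : ∀ i, v i ∈ L) :
    ∃ i j, i ≠ j ∧ ∃ u ∈ L, v i - v j = 2 • u := by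
  let _ : Module ℚ V := Module.compHom V (algebraMap ℚ K)
  have : IsScalarTower ℚ K V := IsScalarTower.of_algebraMap_smul fun _ _ => rfl
  have : Module.Finite (𝓞 K) L := Module.Finite.iff_fg.2 hL
  have : Module.Finite ℤ L := Module.Finite.trans (𝓞 K) L
  have : IsAddTorsionFree V := .of_module_rat V
  have : Module.Free ℤ L := inferInstance
  let b := Module.finBasis ℤ L
  have hrank : Module.finrank ℤ L ≤ 2 * r := by
    have hb : LinearIndependent ℤ (fun i => ((b i : L) : V)) :=
      b.linearIndependent.map' (L.subtype.restrictScalars ℤ)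
        (LinearMap.ker_eq_bot.2 Subtype.val_injective)
    have hbQ := (LinearIndependent.iff_fractionRing ℤ ℚ).1 hb
    let W := (Submodule.span K (L : Set V))
    have hbW : LinearIndependent ℚ
        (fun i => (⟨b i, Submodule.subset_span (b i).2⟩ : W.restrictScalars ℚ)) :=
      LinearIndependent.of_comp (W.restrictScalars ℚ).subtype hbQ
    have hfin : Module.Finite ℚ W := Module.Finite.trans K W
    have hle := LinearIndependent.fintype_card_le_finrank (R := ℚ) (M := W) hbW
    rw [← Module.finrank_mul_finrank ℚ K W, hK, Fintype.card_fin] at hle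
    exact hle.trans (Nat.mul_le_mul_left 2 hr)
  obtain ⟨i, j, hij, h⟩ := Fintype.exists_ne_map_eq_of_card_lt
    (fun i k => (b.repr ⟨v i, hv i⟩ k : ZMod 2)) (by
      rw [Fintype.card_fun, ZMod.card, Fintype.card_fin]
      refine lt_of_le_of_lt ?_ hι
      calc 2 ^ _ ≤ 2 ^ (2 * r) := Nat.pow_le_pow_right two_pos hrank
        _ = 4 ^ r := by rw [pow_mul]; norm_num)
  refine ⟨i, j, hij, ?_⟩
  have h2 (k) : ∃ c : ℤ, b.repr ⟨v i, hv i⟩ k - b.repr ⟨v j, hv j⟩ k = 2 * c := by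
    have := congrFun h k
    exact (ZMod.intCast_eq_intCast_iff_dvd_sub _ _ 2).1 this.symm
  choose c hc using h2
  refine ⟨(∑ k, c k • b k : L), SetLike.coe_mem _, ?_⟩
  have : (⟨v i, hv i⟩ - ⟨v j, hv j⟩ : L) = 2 • ∑ k, c k • b k := by
    apply b.repr.injective
    ext k
    simp [hc k, Finsupp.single_apply]
  simpa using congrArg (Subtype.val) this

/-- If an additive functional is positive and integer-valued on the nonzero values of a quadratic
form on a lattice, then two vectors of value one that are congruent modulo `2` have equal norms. -/
theorem QuadraticForm.eq_of_sub_eq_two_nsmul {K V : Type*} [Field K] [AddCommGroup V] [Module K V]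
    (Q : QuadraticForm K V) (T : K →+ ℚ) (L : AddSubgroup V)
    (hT : ∀ x ∈ L, x ≠ 0 → 1 ≤ T (Q x)) {v w u : V} (hv : v ∈ L) (hu : u ∈ L)
    (hTv : T (Q v) = 1) (hTw : T (Q w) = 1) (h : v - w = 2 • u) : Q v = Q w := by
  obtain ⟨x, hx⟩ : ∃ x, x = v - u := ⟨_, rfl⟩
  have hxL : x ∈ L := hx ▸ L.sub_mem hv hu
  have hv' : v = x + u := by rw [hx]; abel
  have hw' : w = x - u := by
    have : w = v - 2 • u := by rw [← h]; abel
    rw [this, hx, two_nsmul]; abel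
  by_cases hu0 : u = 0
  · rw [hv', hw', hu0]; simp
  by_cases hx0 : x = 0
  · rw [hv', hw', hx0]; simp
  have hpar : Q v + Q w = Q x + Q x + (Q u + Q u) := by
    rw [hv', hw', sub_eq_add_neg, QuadraticMap.map_add Q x u, QuadraticMap.map_add Q x (-u),
      QuadraticMap.map_neg, QuadraticMap.polar_neg_right]
    ring
  have hTpar := congrArg T hpar
  simp only [map_add] at hTpar
  have := hT u hu hu0
  have := hT x hxL hx0
  linarith

/-- A universal lattice over `ℚ(√(n ^ 2 + 1))`, with `n` odd and `n ^ 2 + 1` squarefree, has rank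
greater than `log (2 * n) / log 4`. -/
theorem two_mul_lt_four_pow_finrank_of_universal {K : Type} [Field K] [NumberField K] {n : ℕ}
    (hn : n % 2 = 1) (hsq : Squarefree ((n : ℤ) ^ 2 + 1)) {s : K}
    (hs : s ^ 2 = (((n : ℤ) ^ 2 + 1 : ℤ) : K)) (hK : Module.finrank ℚ K = 2)
    {V : Type} [AddCommGroup V] [Module K V] [FiniteDimensional K V]
    [Module (𝓞 K) V] [IsScalarTower (𝓞 K) K V] {L : Submodule (𝓞 K) V} (hL : L.FG)
    (Q : QuadraticForm K V) (hint : ∀ x ∈ L, IsIntegral ℤ (Q x))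
    (hpos : ∀ x ∈ L, x ≠ 0 → ∀ σ : K →+* ℝ, 0 < σ (Q x))
    (huniv : ∀ α : 𝓞 K, (∀ σ : K →+* ℝ, 0 < σ (α : K)) → ∃ x ∈ L, Q x = (α : K)) :
    2 * n < 4 ^ Module.finrank K (Submodule.span K (L : Set V)) := by
  obtain ⟨d, hd⟩ : ∃ d : ℤ, d = (n : ℤ) ^ 2 + 1 := ⟨_, rfl⟩
  rw [← hd] at hs hsq
  have hd4 : d % 4 = 2 := by
    obtain ⟨k, rfl⟩ : ∃ k, n = 2 * k + 1 := ⟨n / 2, by omega⟩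
    rw [hd]; push_cast; ring_nf; omega
  have hirr (q : ℚ) : q ^ 2 ≠ d := by
    intro hq
    obtain ⟨z, rfl⟩ : ∃ z : ℤ, (z : ℚ) = q :=
      IsIntegrallyClosed.isIntegral_iff.1
        (IsIntegral.of_pow two_pos (hq ▸ isIntegral_algebraMap (R := ℤ) (x := d)))
    have hz : z ^ 2 = d := by exact_mod_cast hq
    rcases Int.even_or_odd' z with ⟨k, rfl | rfl⟩ <;> ring_nf at hz <;> omega
  obtain ⟨e, he⟩ := exists_algEquiv_quadraticAlgebra hirr hs hK
  let T : K →+ ℚ :=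
    { toFun z := (e.symm z).re - n * (e.symm z).im
      map_zero' := by simp
      map_add' x y := by simp; ring }
  have hσ (t : ℝ) (ht : t * t = d) : ∃ σ : K →+* ℝ,
      ∀ z, σ z = (e.symm z).re + (e.symm z).im * t := by
    let f : QuadraticAlgebra ℚ (d : ℚ) 0 →ₐ[ℚ] ℝ :=
      QuadraticAlgebra.lift ⟨t, by simp [ht, Algebra.smul_def]⟩
    exact ⟨(f.comp e.symm.toAlgHom).toRingHom, fun z => by
      simp [f, QuadraticAlgebra.lift, Algebra.smul_def]⟩
  have hdR : (d : ℝ) = (n : ℝ) ^ 2 + 1 := by rw [hd]; push_cast; rfl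
  have hT1 : ∀ x ∈ L.toAddSubgroup, x ≠ 0 → 1 ≤ T (Q x) := by
    intro x hx hx0
    obtain ⟨a, b, ha, hb⟩ := QuadraticAlgebra.exists_int_of_isIntegral hsq hd4
      ((hint x hx).map e.symm.toAlgHom.toRingHom.toIntAlgHom)
    change (e.symm (Q x)).re = a at ha
    change (e.symm (Q x)).im = b at hb
    change (1 : ℚ) ≤ (e.symm (Q x)).re - n * (e.symm (Q x)).im
    have hsd : √(d : ℝ) * √d = d := Real.mul_self_sqrt (by rw [hdR]; positivity)
    obtain ⟨σ, hσ₁⟩ := hσ _ hsd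
    obtain ⟨τ, hτ₁⟩ := hσ (-√d) (by rw [neg_mul_neg, hsd])
    have h1 := hpos x hx hx0 σ
    have h2 := hpos x hx hx0 τ
    rw [hσ₁, ha, hb] at h1
    rw [hτ₁, ha, hb] at h2
    rw [ha, hb]
    have hlt : (n : ℝ) < √d := Real.lt_sqrt_of_sq_lt (by rw [hdR]; linarith)
    have h3 : (0 : ℝ) < a - n * b := by
      push_cast at h1 h2
      rcases le_total (b : ℝ) 0 with h | h <;> nlinarith
    have h4 : 0 < a - n * b := by exact_mod_cast h3
    exact_mod_cast h4
  have hsint : IsIntegral ℤ s :=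
    IsIntegral.of_pow two_pos (hs ▸ isIntegral_algebraMap (R := ℤ) (x := d))
  have hnat (k : ℕ) : IsIntegral ℤ (k : K) := by
    simpa using isIntegral_algebraMap (R := ℤ) (A := K) (x := (k : ℤ))
  have hα (y : Fin (2 * n + 1)) :
      ∃ x ∈ L, Q x = (1 + n * (y : ℕ) : ℕ) + ((y : ℕ) : K) * s := by
    have hi : IsIntegral ℤ (((1 + n * (y : ℕ) : ℕ) : K) + ((y : ℕ) : K) * s) :=
      (hnat _).add ((hnat _).mul hsint)
    refine huniv ⟨_, hi⟩ fun σ => ?_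
    change 0 < σ (((1 + n * (y : ℕ) : ℕ) : K) + ((y : ℕ) : K) * s)
    have hsσ : σ s ^ 2 = (n : ℝ) ^ 2 + 1 := by rw [← map_pow, hs, map_intCast, hdR]
    have hy : ((y : ℕ) : ℝ) ≤ 2 * n := by exact_mod_cast Nat.lt_succ_iff.1 y.2
    have hy0 : (0 : ℝ) ≤ (y : ℕ) := Nat.cast_nonneg _
    rw [map_add, map_mul, map_natCast, map_natCast]
    push_cast
    have habs : |(y : ℕ) * σ s| < 1 + n * (y : ℕ) := by
      refine abs_lt_of_sq_lt_sq ?_ (by positivity)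
      rw [mul_pow, hsσ]
      nlinarith
    linarith [neg_abs_le ((y : ℕ) * σ s)]
  choose v hvL hv using hα
  have hsymm (y : Fin (2 * n + 1)) :
      (e.symm (Q (v y))).re = 1 + n * (y : ℕ) ∧ (e.symm (Q (v y))).im = (y : ℕ) := by
    rw [hv, ← he]
    simp [QuadraticAlgebra.re_one, QuadraticAlgebra.im_one]
  by_contra! hlt
  obtain ⟨i, j, hij, u, hu, huv⟩ := exists_sub_eq_two_nsmul hK hL le_rfl (ι := Fin (2 * n + 1))
    (by rw [Fintype.card_fin]; omega) v hvL
  have hTv (y) : T (Q (v y)) = 1 := by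
    change (e.symm (Q (v y))).re - n * (e.symm (Q (v y))).im = 1
    rw [(hsymm y).1, (hsymm y).2]; ring
  have hQ := Q.eq_of_sub_eq_two_nsmul T L.toAddSubgroup hT1 (hvL i) hu (hTv i) (hTv j) huv
  have him := (hsymm i).2
  rw [hQ, (hsymm j).2] at him
  exact hij (Fin.ext (by exact_mod_cast him.symm))

/-- For every positive integer `r` there are infinitely many squarefree `D > 1`
such that the real quadratic field `K = ℚ(√D)` admits no universal quadratic
`𝓞 K`-lattice of rank `≤ r`: every integral, totally positive definite quadratic
`𝓞 K`-lattice `(L, Q)` representing all totally positive elements of `𝓞 K`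
has rank `> r`. -/
theorem infinitely_many_D_without_small_universal_lattice (r : ℕ) (hr : 0 < r) :
    {D : ℤ | 1 < D ∧ Squarefree D ∧
      ∀ (K : Type) [Field K] [NumberField K] (sd : K),
        sd ^ 2 = (D : K) → Module.finrank ℚ K = 2 →
        ∀ (V : Type) [AddCommGroup V] [Module K V] [FiniteDimensional K V]
          [Module (𝓞 K) V] [IsScalarTower (𝓞 K) K V]
          (L : Submodule (𝓞 K) V), L.FG →
          ∀ Q : QuadraticForm K V,
            (∀ x ∈ L, IsIntegral ℤ (Q x)) →
            (∀ x ∈ L, x ≠ 0 → ∀ σ : K →+* ℝ, 0 < σ (Q x)) →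
            (∀ α : 𝓞 K, (∀ σ : K →+* ℝ, 0 < σ (α : K)) → ∃ x ∈ L, Q x = (α : K)) →
            ¬ Module.finrank K (Submodule.span K (L : Set V)) ≤ r}.Infinite := by
  have hinj : Function.Injective fun m : ℕ => ((2 * m + 1 : ℕ) : ℤ) ^ 2 + 1 := by
    intro a b hab
    have h : ((2 * a + 1) ^ 2 : ℕ) = (2 * b + 1) ^ 2 := by
      have := add_right_cancel hab
      exact_mod_cast this
    have := Nat.pow_left_injective two_ne_zero h
    omega
  refine ((infinite_squarefree_odd_sq_add_one.sdiff (Set.finite_Iio (4 ^ r))).image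
    hinj.injOn).mono ?_
  rintro _ ⟨m, ⟨hm, hmr⟩, rfl⟩
  have hmr : 4 ^ r ≤ m := by simpa using hmr
  have hsq : Squarefree (((2 * m + 1 : ℕ) : ℤ) ^ 2 + 1) := by
    exact_mod_cast Int.squarefree_natCast.2 hm
  refine ⟨lt_add_of_pos_left _ (by positivity), hsq, ?_⟩
  intro K _ _ sd hsd hK V _ _ _ _ _ L hL Q hint hpos huniv hle
  have h1 := two_mul_lt_four_pow_finrank_of_universal (by omega) hsq hsd hK hL Q hint hpos huniv
  have h2 := Nat.pow_le_pow_right (n := 4) (by norm_num) hle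
  omega
end

section
/- Let K be a totally real number field. Then the rank of every classical universal quadratic O_K-lattice is at least the order of the quotient group O_K^{×,+}/(O_K^×)², where O_K^{×,+} is the group of totally positive units of O_K and (O_K^×)² is its subgroup of squares of units. -/
open NumberField

/-- The subgroup of totally positive units of `𝓞 K`. -/
noncomputable def posUnits (K : Type) [Field K] [NumberField K] : Subgroup (𝓞 K)ˣ where
  carrier := {u | ∀ σ : K →+* ℝ, 0 < σ ((u : 𝓞 K) : K)}
  one_mem' := by
    intro σ
    simp
  mul_mem' := by
    intro a b ha hb σ
    have := mul_pos (ha σ) (hb σ)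
    rw [← map_mul] at this
    simpa using this
  inv_mem' := by
    intro a ha σ
    have h1 : σ (((a : 𝓞 K) : K)) * σ (((a⁻¹ : (𝓞 K)ˣ) : 𝓞 K) : K) = 1 := by
      rw [← map_mul]
      have : ((a : 𝓞 K) : K) * (((a⁻¹ : (𝓞 K)ˣ) : 𝓞 K) : K) = 1 := by
        calc ((a : 𝓞 K) : K) * (((a⁻¹ : (𝓞 K)ˣ) : 𝓞 K) : K)
            = (((a * a⁻¹ : (𝓞 K)ˣ) : 𝓞 K) : K) := by push_cast; ring
          _ = 1 := by simp
      rw [this, map_one]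
    nlinarith [ha σ]

/-- The subgroup (of the totally positive units) consisting of squares of units. -/
noncomputable def squareUnitsIn (K : Type) [Field K] [NumberField K] :
    Subgroup (posUnits K) :=
  Subgroup.subgroupOf (MonoidHom.range (powMonoidHom 2 : (𝓞 K)ˣ →* (𝓞 K)ˣ)) (posUnits K)

/-- The Gram determinant identity: evaluating `Q` at the component of `x` orthogonal to `y`,
scaled by `Q y`. -/
theorem QuadraticForm.map_smul_sub_smul_polar {K V : Type*} [Field K] [CharZero K]
    [AddCommGroup V] [Module K V] (Q : QuadraticForm K V) (x y : V) :
    Q (Q y • x - ((Q (x + y) - Q x - Q y) / 2) • y) =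
      Q y * (Q x * Q y - ((Q (x + y) - Q x - Q y) / 2) ^ 2) := by
  have h := QuadraticMap.map_add Q (Q y • x) (-(((Q (x + y) - Q x - Q y) / 2) • y))
  rw [← sub_eq_add_neg] at h
  rw [h, QuadraticMap.map_neg, QuadraticMap.map_smul, QuadraticMap.map_smul,
    QuadraticMap.polar_neg_right, QuadraticMap.polar_smul_left, QuadraticMap.polar_smul_right,
    QuadraticMap.polar]
  simp only [smul_eq_mul]
  ring

/-- In a totally real field, an algebraic integer whose real conjugates all have absolute value
less than one vanishes. -/
theorem NumberField.eq_zero_of_forall_abs_lt_one {K : Type*} [Field K] [NumberField K]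
    (htr : ∀ φ : K →+* ℂ, NumberField.ComplexEmbedding.IsReal φ) (a : 𝓞 K)
    (h : ∀ σ : K →+* ℝ, |σ (a : K)| < 1) : a = 0 := by
  by_contra ha
  have key : ∀ w : InfinitePlace K, w (a : K) < 1 := by
    intro w
    rw [← InfinitePlace.norm_embedding_eq, ← (htr w.embedding).coe_embedding_apply,
      Complex.norm_real, Real.norm_eq_abs]
    exact h _
  obtain ⟨w⟩ := (inferInstance : Nonempty (InfinitePlace K))
  exact absurd (InfinitePlace.one_le_of_lt_one ha fun z _ => key z) (not_le.mpr (key w))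

/-- Vectors of a classical positive definite lattice that represent totally positive units are
orthogonal unless the product of the two units is the square of an algebraic integer. -/
theorem eq_zero_or_sq_eq_of_posUnits {K : Type} [Field K] [NumberField K]
    (htr : ∀ φ : K →+* ℂ, NumberField.ComplexEmbedding.IsReal φ)
    {V : Type*} [AddCommGroup V] [Module K V] [Module (𝓞 K) V] [IsScalarTower (𝓞 K) K V]
    (L : Submodule (𝓞 K) V) (Q : QuadraticForm K V)
    (hposdef : ∀ x ∈ L, x ≠ 0 → ∀ σ : K →+* ℝ, 0 < σ (Q x))
    {x y : V} (hx : x ∈ L) (hy : y ∈ L) {u v : (𝓞 K)ˣ}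
    (hu : u ∈ posUnits K) (hv : v ∈ posUnits K)
    (hxu : Q x = ((u : 𝓞 K) : K)) (hyv : Q y = ((v : 𝓞 K) : K)) (b : 𝓞 K)
    (hb : (b : K) = (Q (x + y) - Q x - Q y) / 2) :
    b = 0 ∨ b ^ 2 = u * v := by
  have hQ := Q.map_smul_sub_smul_polar x y
  rw [← hb, hxu, hyv] at hQ
  have hwL : ((v : 𝓞 K) : K) • x - (b : K) • y ∈ L := by
    have := L.sub_mem (L.smul_mem (v : 𝓞 K) hx) (L.smul_mem b hy)
    rwa [← algebraMap_smul K (v : 𝓞 K) x, ← algebraMap_smul K b y] at this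
  by_cases hw : ((v : 𝓞 K) : K) • x - (b : K) • y = 0
  · right
    rw [hw, QuadraticMap.map_zero] at hQ
    have hv0 : ((v : 𝓞 K) : K) ≠ 0 := by
      simp
    have h := (mul_eq_zero.mp hQ.symm).resolve_left hv0
    apply RingOfIntegers.ext
    push_cast
    linear_combination -h
  · left
    have hsq : b ^ 2 * ((u * v)⁻¹ : (𝓞 K)ˣ) = 0 := by
      apply NumberField.eq_zero_of_forall_abs_lt_one htr
      intro σ
      have hpos := hposdef _ hwL hw σ
      rw [hQ, map_mul, map_sub, map_mul, map_pow] at hpos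
      have hlt := pos_of_mul_pos_right hpos (hv σ).le
      have hinv := (posUnits K).inv_mem ((posUnits K).mul_mem hu hv) σ
      have hone : σ ((u : 𝓞 K) : K) * σ ((v : 𝓞 K) : K) *
          σ (((u * v)⁻¹ : (𝓞 K)ˣ) : 𝓞 K) = 1 := by
        rw [← map_mul, ← map_mul, ← map_mul, ← map_mul, ← Units.val_mul, Units.mul_inv]
        simp
      rw [RingOfIntegers.coe_eq_algebraMap, map_mul, map_pow]
      rw [map_mul, map_pow,
        abs_of_nonneg (mul_nonneg (sq_nonneg _) hinv.le), ← hone]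
      exact mul_lt_mul_of_pos_right (sub_pos.mp hlt) hinv
    exact pow_eq_zero_iff two_ne_zero |>.mp ((Units.mul_left_eq_zero _).mp hsq)

/-- Totally positive units whose product is the square of an algebraic integer agree modulo
squares of units. -/
theorem posUnits_mk_eq_mk_of_sq_eq_mul {K : Type} [Field K] [NumberField K]
    {u v : posUnits K} {b : 𝓞 K} (h : b ^ 2 = (u : (𝓞 K)ˣ) * (v : (𝓞 K)ˣ)) :
    (u : posUnits K ⧸ squareUnitsIn K) = v := by
  have hb : IsUnit b := by
    rw [← isUnit_pow_iff two_ne_zero, h, ← Units.val_mul]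
    exact Units.isUnit _
  obtain ⟨c, rfl⟩ := hb
  have hc : c ^ 2 = (u : (𝓞 K)ˣ) * v := Units.ext (by simpa using h)
  rw [QuotientGroup.eq]
  refine Subgroup.mem_subgroupOf.mpr ⟨(u : (𝓞 K)ˣ)⁻¹ * c, ?_⟩
  change ((u : (𝓞 K)ˣ)⁻¹ * c) ^ 2 = (u : (𝓞 K)ˣ)⁻¹ * v
  rw [mul_pow, hc, pow_two]
  group

/-- Let `K` be a totally real number field.  The rank of every classical universal
quadratic `𝓞 K`-lattice `(L, Q)` is at least the order of the quotient group
`𝓞_K^{×,+} / (𝓞_K^×)²` of totally positive units modulo squares of units. -/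
theorem rank_ge_card_posUnits_mod_squares
    (K : Type) [Field K] [NumberField K]
    (htr : ∀ φ : K →+* ℂ, NumberField.ComplexEmbedding.IsReal φ)
    (V : Type) [AddCommGroup V] [Module K V] [FiniteDimensional K V]
    [Module (𝓞 K) V] [IsScalarTower (𝓞 K) K V]
    (L : Submodule (𝓞 K) V) (hLfg : L.FG)
    (Q : QuadraticForm K V)
    (hint : ∀ x ∈ L, IsIntegral ℤ (Q x))
    (hclassical : ∀ x ∈ L, ∀ y ∈ L, IsIntegral ℤ ((Q (x + y) - Q x - Q y) / 2))
    (hposdef : ∀ x ∈ L, x ≠ 0 → ∀ σ : K →+* ℝ, 0 < σ (Q x))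
    (huniversal : ∀ α : 𝓞 K, (∀ σ : K →+* ℝ, 0 < σ (α : K)) →
      ∃ x ∈ L, Q x = (α : K)) :
    Nat.card ((posUnits K) ⧸ squareUnitsIn K) ≤
      Module.finrank K (Submodule.span K (L : Set V)) := by
  cases finite_or_infinite (posUnits K ⧸ squareUnitsIn K) with
  | inr _ => simp
  | inl _ =>
  have := Fintype.ofFinite (posUnits K ⧸ squareUnitsIn K)
  choose x hxL hxQ using fun q : posUnits K ⧸ squareUnitsIn K =>
    huniversal ((q.out : (𝓞 K)ˣ) : 𝓞 K) q.out.2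
  have hortho : Q.polarBilin.IsOrthoᵢ x := by
    intro i j hij
    obtain ⟨b, hb⟩ : ∃ b : 𝓞 K, (b : K) = (Q (x i + x j) - Q (x i) - Q (x j)) / 2 :=
      ⟨⟨_, hclassical _ (hxL i) _ (hxL j)⟩, rfl⟩
    rcases eq_zero_or_sq_eq_of_posUnits htr L Q hposdef (hxL i) (hxL j) i.out.2 j.out.2
      (hxQ i) (hxQ j) b hb with h | h
    · rw [h, RingOfIntegers.coe_eq_algebraMap, map_zero] at hb
      change Q (x i + x j) - Q (x i) - Q (x j) = 0
      linear_combination -2 * hb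
    · refine absurd ?_ hij
      have := posUnits_mk_eq_mk_of_sq_eq_mul h
      rwa [QuotientGroup.out_eq', QuotientGroup.out_eq'] at this
  have hself : ∀ i, Q.polarBilin (x i) (x i) ≠ 0 := by
    intro i h
    change QuadraticMap.polar Q (x i) (x i) = 0 at h
    rw [QuadraticMap.polar_self, hxQ] at h
    simp at h
  have hli : LinearIndependent K x :=
    LinearMap.linearIndependent_of_isOrthoᵢ hortho hself
  rw [Nat.card_eq_fintype_card, ← finrank_span_eq_card hli]
  exact Submodule.finrank_mono (Submodule.span_mono (Set.range_subset_iff.mpr hxL))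
end

section
/- Let K be a totally real number field with discriminant Δ_K. If α ∈ O_K^+ satisfies N_{K/ℚ}(α) > Δ_K, then there exists a nonzero β ∈ O_K such that α − β² is totally positive. Consequently, every indecomposable element α ∈ O_K^+ satisfies N_{K/ℚ}(α) ≤ Δ_K. -/
open NumberField

section

open MeasureTheory NumberField.mixedEmbedding NumberField.InfinitePlace ENNReal NNReal

variable {K : Type*} [Field K] [NumberField K]

theorem NumberField.discr_pos_of_isTotallyReal [IsTotallyReal K] : 0 < discr K :=
  Int.sign_eq_one_iff_pos.mp <| by
    rw [sign_discr, IsTotallyReal.nrComplexPlaces_eq_zero, pow_zero]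

theorem NumberField.mixedEmbedding.minkowskiBound_one_of_isTotallyReal [IsTotallyReal K] :
    minkowskiBound K 1 = NNReal.sqrt ‖discr K‖₊ * 2 ^ Module.finrank ℚ K := by
  classical
  rw [minkowskiBound, volume_fundamentalDomain_fractionalIdealLatticeBasis,
    volume_fundamentalDomain_latticeBasis, mixedEmbedding.finrank,
    IsTotallyReal.nrComplexPlaces_eq_zero]
  simp

/-- Minkowski's convex body theorem for a box in a totally real field. -/
theorem NumberField.exists_ne_zero_forall_infinitePlace_lt_of_isTotallyReal [IsTotallyReal K]
    (f : InfinitePlace K → ℝ≥0) (h : NNReal.sqrt ‖discr K‖₊ < ∏ w, f w) :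
    ∃ β : 𝓞 K, β ≠ 0 ∧ ∀ w : InfinitePlace K, w β < f w := by
  refine exists_ne_zero_mem_ringOfIntegers_lt K (f := f) ?_
  rw [minkowskiBound_one_of_isTotallyReal, convexBodyLT_volume, convexBodyLTFactor,
    IsTotallyReal.nrComplexPlaces_eq_zero, ← IsTotallyReal.finrank, mul_comm]
  simp only [IsTotallyReal.mult_eq, pow_one, pow_zero, mul_one]
  exact_mod_cast mul_lt_mul_of_pos_left h (by positivity)

theorem NumberField.exists_ne_zero_forall_infinitePlace_sq_lt_of_isTotallyReal [IsTotallyReal K]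
    {α : 𝓞 K} (h : discr K < Algebra.norm ℤ α) :
    ∃ β : 𝓞 K, β ≠ 0 ∧ ∀ w : InfinitePlace K, w β ^ 2 < w α := by
  let g (w : InfinitePlace K) : ℝ≥0 := ⟨w α, apply_nonneg w _⟩
  have hg : ∏ w, g w = ‖Algebra.norm ℤ α‖₊ := by
    ext
    rw [NNReal.coe_prod]
    change ∏ w : InfinitePlace K, w (α : K) = _
    simpa [← Algebra.coe_norm_int, Int.norm_eq_abs] using prod_eq_abs_norm (α : K)
  have hlt : ‖discr K‖₊ < ‖Algebra.norm ℤ α‖₊ := by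
    rw [← NNReal.coe_lt_coe, coe_nnnorm, coe_nnnorm, Int.norm_eq_abs, Int.norm_eq_abs]
    have := abs_of_pos (discr_pos_of_isTotallyReal (K := K))
    exact_mod_cast this ▸ h.trans_le (le_abs_self _)
  obtain ⟨β, hβ, hlt⟩ := exists_ne_zero_forall_infinitePlace_lt_of_isTotallyReal
    (fun w ↦ NNReal.sqrt (g w)) <| by
      exact (NNReal.sqrt_lt_sqrt.mpr hlt).trans_eq (hg ▸ map_prod NNReal.sqrtHom g _)
  refine ⟨β, hβ, fun w ↦ ?_⟩
  have := hlt w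
  rw [Real.coe_sqrt] at this
  exact (Real.lt_sqrt (apply_nonneg w _)).mp this

end

/-- Let `K` be a totally real number field with discriminant `Δ_K`.
If a totally positive `α ∈ 𝓞 K` has norm `N(α) > Δ_K`, then there is a nonzero
`β ∈ 𝓞 K` with `α - β²` totally positive.  Consequently, every indecomposable
totally positive `α ∈ 𝓞 K` satisfies `N(α) ≤ Δ_K`. -/
theorem norm_indecomposable_le_discr
    (K : Type) [Field K] [NumberField K]
    (htr : ∀ φ : K →+* ℂ, NumberField.ComplexEmbedding.IsReal φ) :
    ∀ α : 𝓞 K, (∀ σ : K →+* ℝ, 0 < σ (α : K)) →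
      (NumberField.discr K < Algebra.norm ℤ α →
        ∃ β : 𝓞 K, β ≠ 0 ∧ ∀ σ : K →+* ℝ, 0 < σ ((α - β ^ 2 : 𝓞 K) : K)) ∧
      ((¬ ∃ β γ : 𝓞 K, (∀ σ : K →+* ℝ, 0 < σ (β : K)) ∧
          (∀ σ : K →+* ℝ, 0 < σ (γ : K)) ∧ α = β + γ) →
        Algebra.norm ℤ α ≤ NumberField.discr K) := by
  have : IsTotallyReal K := ⟨fun w ↦ InfinitePlace.isReal_iff.mpr (htr _)⟩
  intro α hα
  have exists_sq (h : discr K < Algebra.norm ℤ α) :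
      ∃ β : 𝓞 K, β ≠ 0 ∧ ∀ σ : K →+* ℝ, 0 < σ ((α - β ^ 2 : 𝓞 K) : K) := by
    obtain ⟨β, hβ, hlt⟩ := exists_ne_zero_forall_infinitePlace_sq_lt_of_isTotallyReal h
    refine ⟨β, hβ, fun σ ↦ ?_⟩
    have := hlt (InfinitePlace.mk (Complex.ofRealHom.comp σ))
    simpa [InfinitePlace.apply, abs_of_pos (hα σ)] using this
  refine ⟨exists_sq, fun hind ↦ not_lt.mp fun h ↦ ?_⟩
  obtain ⟨β, hβ, hpos⟩ := exists_sq h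
  refine hind ⟨β ^ 2, α - β ^ 2, fun σ ↦ ?_, hpos, by ring⟩
  have : σ β ≠ 0 := (map_ne_zero σ).mpr (RingOfIntegers.coe_ne_zero_iff.mpr hβ)
  simpa using sq_pos_of_ne_zero this
end

section
/- Let K be a primitive totally real number field of degree d ≥ 2 (i.e., there is no field F with ℚ ⊊ F ⊊ K) with discriminant Δ_K. If α ∈ O_K^+ satisfies N_{K/ℚ}(α) ≤ Δ_K^{1/(d² − d)} and α is not divisible in O_K by any rational integer n ≥ 2, then α is indecomposable. -/
open NumberField

namespace NumberField

/-- The discriminant of a family of `[K : ℚ]` integers is a square times the discriminant. -/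
theorem exists_discr_eq_sq_mul_discr {K ι : Type*} [Field K] [NumberField K] [Fintype ι]
    [DecidableEq ι] (hι : Fintype.card ι = Module.finrank ℚ K) (v : ι → 𝓞 K) :
    ∃ n : ℤ, Algebra.discr ℚ (fun i ↦ (v i : K)) = n ^ 2 * discr K := by
  have hcard : Fintype.card (Module.Free.ChooseBasisIndex ℤ (𝓞 K)) = Fintype.card ι := by
    rw [hι, ← RingOfIntegers.rank, Module.finrank_eq_card_chooseBasisIndex]
  let b := (RingOfIntegers.basis K).reindex (Fintype.equivOfCardEq hcard)
  refine ⟨(b.toMatrix v).det, ?_⟩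
  have h := Algebra.discr_of_matrix_vecMul b (b.toMatrix v)
  rw [b.toMatrix_map_vecMul, discr_eq_discr K b] at h
  have hcast : Algebra.discr ℚ (fun i ↦ (v i : K)) = (Algebra.discr ℤ v : ℤ) := by
    rw [Algebra.discr_def, Algebra.discr_def, Int.cast_det]
    congr 1
    ext i j
    simp only [Algebra.traceMatrix_apply, Algebra.traceForm_apply, Matrix.map_apply,
      Algebra.coe_trace_int, map_mul]
  rw [hcast, h]
  push_cast
  rfl

/-- In a primitive number field, a non-rational element is separated by distinct embeddings. -/
theorem ringHom_eq_of_apply_eq {K L : Type*} [Field K] [NumberField K] [Field L]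
    (hprim : ∀ F : Subfield K, F = ⊥ ∨ F = ⊤) {τ : K} (hτ : τ ∉ (algebraMap ℚ K).fieldRange)
    {φ ψ : K →+* L} (h : φ τ = ψ τ) : φ = ψ := by
  have hmem : τ ∈ φ.eqLocusField ψ := h
  rcases hprim (φ.eqLocusField ψ) with hbot | htop
  · rw [hbot] at hmem
    exact absurd ((bot_le : (⊥ : Subfield K) ≤ _) hmem) hτ
  · ext x
    have hx : x ∈ φ.eqLocusField ψ := htop ▸ Subfield.mem_top x
    exact hx

/-- If `β` is a rational multiple of `α`, then the denominator of the ratio divides `α`. -/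
theorem den_dvd_of_coe_eq_mul {K : Type*} [Field K] [NumberField K] {α β : 𝓞 K} {q : ℚ}
    (h : (β : K) = q * α) : (((q.den : ℤ) : 𝓞 K)) ∣ α := by
  have hq : (β : K) * q.den = q.num * α := by
    have hd : (q.den : K) ≠ 0 := by exact_mod_cast q.den_nz
    have hqK : (q : K) = q.num / q.den := by exact_mod_cast (Rat.num_div_den q).symm
    rw [h, hqK]
    field_simp
  have hO : β * q.den = q.num * α := RingOfIntegers.coe_injective (by simpa using hq)
  obtain ⟨u, w, huw⟩ := Rat.isCoprime_num_den q
  have huw' : (u : 𝓞 K) * q.num + w * q.den = 1 := by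
    exact_mod_cast congrArg (Int.cast (R := 𝓞 K)) huw
  refine ⟨u * β + w * α, ?_⟩
  push_cast
  linear_combination (-α) * huw' + (-(u : 𝓞 K)) * hO

end NumberField

/-- A Vandermonde determinant with distinct nodes in `(0, 1)` has absolute value less than `1`. -/
theorem Matrix.abs_det_vandermonde_lt_one {n : ℕ} (hn : 2 ≤ n) {t : Fin n → ℝ}
    (h0 : ∀ i, 0 < t i) (h1 : ∀ i, t i < 1) (hinj : Function.Injective t) :
    |(Matrix.vandermonde t).det| < 1 := by
  have hlt : ∀ i j, |t j - t i| < 1 := fun i j ↦ by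
    rw [abs_lt]
    constructor <;> linarith [h0 i, h0 j, h1 i, h1 j]
  have hpos : ∀ i, ∀ j ∈ Finset.Ioi i, 0 < |t j - t i| := fun i j hj ↦
    abs_pos.2 (sub_ne_zero.2 (hinj.ne (Finset.mem_Ioi.1 hj).ne'))
  rw [Matrix.det_vandermonde]
  simp only [Finset.abs_prod]
  let i₀ : Fin n := ⟨0, by omega⟩
  let i₁ : Fin n := ⟨1, by omega⟩
  have h01 : i₁ ∈ Finset.Ioi i₀ := by simp [i₀, i₁]
  calc ∏ i, ∏ j ∈ Finset.Ioi i, |t j - t i| < ∏ _i : Fin n, (1 : ℝ) := by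
        refine Finset.prod_lt_prod (fun i _ ↦ Finset.prod_pos (hpos i))
          (fun i _ ↦ Finset.prod_le_one (fun _ _ ↦ abs_nonneg _) fun j _ ↦ (hlt i j).le)
          ⟨i₀, Finset.mem_univ _, ?_⟩
        calc ∏ j ∈ Finset.Ioi i₀, |t j - t i₀| < ∏ _j ∈ Finset.Ioi i₀, (1 : ℝ) :=
              Finset.prod_lt_prod (hpos i₀) (fun j _ ↦ (hlt i₀ j).le) ⟨i₁, h01, hlt i₀ i₁⟩
          _ = 1 := Finset.prod_const_one
    _ = 1 := Finset.prod_const_one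

namespace NumberField

/-- If the conjugates of `β / α` are distinct and lie in `(0, 1)`, then the discriminant is
positive and less than `N(α) ^ (2 (d - 1))`. -/
theorem discr_lt_norm_pow {K : Type*} [Field K] [NumberField K] {d : ℕ} (hd : 2 ≤ d)
    (hK : Module.finrank ℚ K = d) (s : Fin d → K →+* ℝ)
    (e : Fin d ≃ (K →ₐ[ℚ] ℂ)) (hs : ∀ i x, (s i x : ℂ) = e i x)
    {α β : 𝓞 K} (hα : ∀ i, 0 < s i α) (hβ : ∀ i, 0 < s i β) (hβα : ∀ i, s i β < s i α)
    (hinj : Function.Injective fun i ↦ s i (β / α : K)) :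
    0 < discr K ∧ (discr K : ℝ) < (Algebra.norm ℤ α : ℝ) ^ (2 * (d - 1)) ∧
      0 < Algebra.norm ℤ α := by
  have hnorm : (Algebra.norm ℤ α : ℝ) = ∏ i, s i α := by
    have h := Algebra.norm_eq_prod_embeddings ℚ ℂ (α : K)
    rw [← Algebra.coe_norm_int, ← e.prod_comp] at h
    apply Complex.ofReal_injective
    push_cast
    simp only [hs]
    simpa using h
  have hnpos : (0 : ℝ) < Algebra.norm ℤ α := hnorm ▸ Finset.prod_pos fun i _ ↦ hα i
  let t : Fin d → ℝ := fun i ↦ s i (β / α : K)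
  have ht : ∀ i, t i = s i β / s i α := fun i ↦ map_div₀ _ _ _
  have ht0 : ∀ i, 0 < t i := fun i ↦ ht i ▸ div_pos (hβ i) (hα i)
  have ht1 : ∀ i, t i < 1 := fun i ↦ ht i ▸ (div_lt_one (hα i)).2 (hβα i)
  let v : Fin d → 𝓞 K := fun k ↦ α ^ (d - 1 - (k : ℕ)) * β ^ (k : ℕ)
  let M : Matrix (Fin d) (Fin d) ℝ := Matrix.of fun i k ↦ s i (v k)
  have hM : M.det = (Algebra.norm ℤ α : ℝ) ^ (d - 1) * (Matrix.vandermonde t).det := by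
    rw [hnorm, ← Finset.prod_pow, ← Matrix.det_mul_column]
    congr 1
    ext i k
    have hk : d - 1 = (d - 1 - (k : ℕ)) + k := by omega
    simp only [M, v, Matrix.of_apply, Matrix.vandermonde_apply, ht, map_mul, map_pow]
    conv_rhs => rw [hk, pow_add, div_pow, mul_assoc, mul_div_cancel₀ _ (pow_ne_zero _ (hα i).ne')]
  have hV0 : (Matrix.vandermonde t).det ≠ 0 := Matrix.det_vandermonde_ne_zero_iff.2 hinj
  have hM0 : M.det ≠ 0 := hM ▸ mul_ne_zero (pow_ne_zero _ hnpos.ne') hV0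
  obtain ⟨n, hn⟩ := exists_discr_eq_sq_mul_discr (by rw [Fintype.card_fin, hK]) v
  have hdet : (n : ℝ) ^ 2 * discr K = M.det ^ 2 := by
    have h := Algebra.discr_eq_det_embeddingsMatrixReindex_pow_two ℚ ℂ (fun i ↦ (v i : K)) e
    have hMe : (Algebra.embeddingsMatrixReindex ℚ ℂ (fun i ↦ (v i : K)) e).det = (M.det : ℂ) := by
      have hmap : Complex.ofRealHom.mapMatrix M =
          (Algebra.embeddingsMatrixReindex ℚ ℂ (fun i ↦ (v i : K)) e).transpose := by
        ext i k
        simp [M, hs, Algebra.embeddingsMatrixReindex, Algebra.embeddingsMatrix]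
      rw [← Matrix.det_transpose, ← hmap, ← RingHom.map_det]
      rfl
    rw [hMe, hn] at h
    apply Complex.ofReal_injective
    simpa using h
  have hMpos : 0 < M.det ^ 2 := by positivity
  have hn0 : n ≠ 0 := by
    rintro rfl
    rw [Int.cast_zero, zero_pow two_ne_zero, zero_mul] at hdet
    exact hMpos.ne hdet
  have hdpos : (0 : ℝ) < discr K := pos_of_mul_pos_right (hdet ▸ hMpos) (sq_nonneg _)
  have hn1 : (1 : ℝ) ≤ (n : ℝ) ^ 2 := by
    exact_mod_cast Int.add_one_le_iff.2 (sq_pos_of_ne_zero hn0)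
  refine ⟨by exact_mod_cast hdpos, ?_, by exact_mod_cast hnpos⟩
  have hV1 : (Matrix.vandermonde t).det ^ 2 < 1 :=
    (sq_lt_one_iff_abs_lt_one _).2 (Matrix.abs_det_vandermonde_lt_one hd ht0 ht1 hinj)
  calc (discr K : ℝ) ≤ (n : ℝ) ^ 2 * discr K := le_mul_of_one_le_left hdpos.le hn1
    _ = (Algebra.norm ℤ α : ℝ) ^ (2 * (d - 1)) * (Matrix.vandermonde t).det ^ 2 := by
        rw [hdet, hM, mul_pow, ← pow_mul, mul_comm (d - 1)]
    _ < (Algebra.norm ℤ α : ℝ) ^ (2 * (d - 1)) := mul_lt_of_lt_one_right (by positivity) hV1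

end NumberField

/-- Let `K` be a primitive totally real number field of degree `d ≥ 2` (no proper
intermediate subfield) with discriminant `Δ_K`.  If a totally positive `α ∈ 𝓞 K`
has norm `N(α) ≤ Δ_K ^ (1/(d² - d))` and is not divisible in `𝓞 K` by any rational
integer `n ≥ 2`, then `α` is indecomposable. -/
theorem indecomposable_of_small_norm_primitive
    (K : Type) [Field K] [NumberField K]
    (htr : ∀ φ : K →+* ℂ, NumberField.ComplexEmbedding.IsReal φ)
    (hdeg : 2 ≤ Module.finrank ℚ K)
    (hprim : ∀ F : Subfield K, F = ⊥ ∨ F = ⊤) :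
    ∀ α : 𝓞 K, (∀ σ : K →+* ℝ, 0 < σ (α : K)) →
      ((Algebra.norm ℤ α : ℝ) ≤ (NumberField.discr K : ℝ) ^
        ((1 : ℝ) / ((Module.finrank ℚ K : ℝ) ^ 2 - (Module.finrank ℚ K : ℝ)))) →
      (∀ n : ℤ, 2 ≤ n → ¬ (n : 𝓞 K) ∣ α) →
      ¬ ∃ β γ : 𝓞 K, (∀ σ : K →+* ℝ, 0 < σ (β : K)) ∧
        (∀ σ : K →+* ℝ, 0 < σ (γ : K)) ∧ α = β + γ := by
  rintro α hα hle hdiv ⟨β, γ, hβ, hγ, rfl⟩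
  set d := Module.finrank ℚ K with hd
  let e : Fin d ≃ (K →ₐ[ℚ] ℂ) := Fintype.equivOfCardEq (by rw [AlgHom.card, Fintype.card_fin])
  let s : Fin d → K →+* ℝ := fun i ↦ (htr (e i : K →+* ℂ)).embedding
  have hs : ∀ i x, (s i x : ℂ) = e i x := fun i x ↦
    ComplexEmbedding.IsReal.coe_embedding_apply (htr (e i : K →+* ℂ)) x
  have hβα : ∀ i, s i β < s i (β + γ : 𝓞 K) := fun i ↦ by
    have := hγ (s i)
    simpa using this
  by_cases hτ : (β / (β + γ : 𝓞 K) : K) ∈ (algebraMap ℚ K).fieldRange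
  · obtain ⟨q, hq⟩ := hτ
    let i₀ : Fin d := ⟨0, by omega⟩
    have hα0 : (((β + γ : 𝓞 K)) : K) ≠ 0 := fun h ↦ by
      have := hα (s i₀)
      rw [h, map_zero] at this
      exact this.false
    have hqs : (q : ℝ) = s i₀ β / s i₀ (β + γ : 𝓞 K) := by
      rw [← map_div₀, ← hq]
      simp
    have hq0 : 0 < q := by
      have : (0 : ℝ) < q := hqs ▸ div_pos (hβ _) (hα _)
      exact_mod_cast this
    have hq1 : q < 1 := by
      have : (q : ℝ) < 1 := hqs ▸ (div_lt_one (hα _)).2 (hβα _)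
      exact_mod_cast this
    refine hdiv q.den ?_ (den_dvd_of_coe_eq_mul (β := β) (q := q) ?_)
    · have hden : q.den ≠ 1 := fun h ↦ by
        have hqn : q = q.num := (Rat.den_eq_one_iff q).1 h |>.symm
        rw [hqn] at hq0 hq1
        norm_cast at hq0 hq1
        omega
      have := q.den_pos
      omega
    · rw [eq_div_iff hα0] at hq
      simpa using hq.symm
  · have hinj : Function.Injective fun i ↦ s i (β / (β + γ : 𝓞 K) : K) := fun i j hij ↦ by
      have h := ringHom_eq_of_apply_eq hprim hτ hij
      apply e.injective
      ext x
      rw [← hs, ← hs, h]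
    obtain ⟨hdpos, hlt, hnpos⟩ := discr_lt_norm_pow hdeg hd.symm s e hs
      (fun i ↦ hα (s i)) (fun i ↦ hβ (s i)) hβα hinj
    refine hlt.not_ge ?_
    have hD : (1 : ℝ) ≤ discr K := by exact_mod_cast hdpos
    have hdR : (2 : ℝ) ≤ d := by exact_mod_cast hdeg
    have hexp : (1 : ℝ) / ((d : ℝ) ^ 2 - d) * (2 * (d - 1) : ℕ) ≤ 1 := by
      have hpos : (0 : ℝ) < (d : ℝ) ^ 2 - d := by nlinarith
      rw [Nat.cast_mul, Nat.cast_sub (by omega), one_div_mul_eq_div, div_le_one hpos]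
      push_cast
      nlinarith
    calc (Algebra.norm ℤ (β + γ) : ℝ) ^ (2 * (d - 1))
        ≤ ((discr K : ℝ) ^ ((1 : ℝ) / ((d : ℝ) ^ 2 - d))) ^ (2 * (d - 1)) :=
          pow_le_pow_left₀ (by exact_mod_cast hnpos.le) hle _
      _ = (discr K : ℝ) ^ ((1 : ℝ) / ((d : ℝ) ^ 2 - d) * (2 * (d - 1) : ℕ)) := by
          rw [Real.rpow_mul_natCast (by linarith)]
      _ ≤ (discr K : ℝ) ^ (1 : ℝ) := Real.rpow_le_rpow_of_exponent_le hD hexp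
      _ = discr K := Real.rpow_one _
end

section
/- Let K be a totally real number field of degree d. Suppose there exist pairwise distinct β₁, …, β_u ∈ O_K^+ and δ ∈ O_K^{∨,+} such that Tr_{K/ℚ}(δ·β_i) = 1 for all i = 1, …, u. Then every classical universal quadratic O_K-lattice has rank ≥ u/d, and, provided u ≥ 240, every universal quadratic O_K-lattice has rank ≥ √u/d. -/
open scoped InnerProductSpace

section
variable {E : Type*} [NormedAddCommGroup E] [InnerProductSpace ℝ E]

theorem sq_sum_inner_self_le_finrank_mul [FiniteDimensional ℝ E] {ι : Type*} [Fintype ι]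
    (x : ι → E) :
    (∑ i, ⟪x i, x i⟫_ℝ) ^ 2 ≤ Module.finrank ℝ E * ∑ i, ∑ j, ⟪x i, x j⟫_ℝ ^ 2 := by
  let b := stdOrthonormalBasis ℝ E
  set a : ι → Fin (Module.finrank ℝ E) → ℝ := fun i k => ⟪x i, b k⟫_ℝ with ha
  have hin : ∀ i j, ⟪x i, x j⟫_ℝ = ∑ k, a i k * a j k := by
    intro i j
    rw [← b.sum_inner_mul_inner]
    exact Finset.sum_congr rfl fun k _ => by rw [real_inner_comm (x j)]
  have h1 : ∑ i, ⟪x i, x i⟫_ℝ = ∑ k, ∑ i, a i k * a i k := by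
    simp_rw [hin]; exact Finset.sum_comm
  have h2 : ∑ i, ∑ j, ⟪x i, x j⟫_ℝ ^ 2 = ∑ k, ∑ l, (∑ i, a i k * a i l) ^ 2 := by
    simp_rw [hin, sq, Finset.sum_mul_sum]
    calc ∑ i, ∑ j, ∑ k, ∑ l, a i k * a j k * (a i l * a j l)
        = ∑ i, ∑ k, ∑ l, ∑ j, a i k * a j k * (a i l * a j l) := by
          refine Finset.sum_congr rfl fun i _ => ?_
          rw [Finset.sum_comm]
          exact Finset.sum_congr rfl fun k _ => Finset.sum_comm
      _ = ∑ k, ∑ l, ∑ i, ∑ j, a i k * a j k * (a i l * a j l) := by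
          rw [Finset.sum_comm]
          exact Finset.sum_congr rfl fun k _ => Finset.sum_comm
      _ = _ := by
          refine Finset.sum_congr rfl fun k _ => Finset.sum_congr rfl fun l _ =>
            Finset.sum_congr rfl fun i _ => Finset.sum_congr rfl fun j _ => by ring
  rw [h1, h2]
  calc (∑ k, ∑ i, a i k * a i k) ^ 2
      ≤ Module.finrank ℝ E * ∑ k, (∑ i, a i k * a i k) ^ 2 := by
        simpa using sq_sum_le_card_mul_sum_sq (s := Finset.univ)
          (f := fun k : Fin (Module.finrank ℝ E) => ∑ i, a i k * a i k)
    _ ≤ _ := by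
        gcongr with k
        exact Finset.single_le_sum (f := fun l => (∑ i, a i k * a i l) ^ 2)
          (fun l _ => sq_nonneg _) (Finset.mem_univ k)

theorem card_le_finrank_of_pairwise_inner_eq_zero [FiniteDimensional ℝ E] (M : Finset E)
    (h0 : ∀ m ∈ M, m ≠ 0) (ho : ∀ m ∈ M, ∀ m' ∈ M, m ≠ m' → ⟪m, m'⟫_ℝ = 0) :
    M.card ≤ Module.finrank ℝ E := by
  have := linearIndependent_of_ne_zero_of_inner_eq_zero (𝕜 := ℝ) (v := fun m : M => (m : E))
    (fun m => h0 m m.2) (fun m m' h => ho m m.2 m' m'.2 (fun e => h (Subtype.ext e)))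
  simpa using this.fintype_card_le_finrank

theorem sum_inner_sq_le_of_pairwise_inner_eq_zero (M : Finset E) {r : ℝ} (hr : 0 < r)
    (hM : ∀ m ∈ M, ⟪m, m⟫_ℝ = r) (ho : ∀ m ∈ M, ∀ m' ∈ M, m ≠ m' → ⟪m, m'⟫_ℝ = 0) (d : E) :
    ∑ m ∈ M, ⟪m, d⟫_ℝ ^ 2 ≤ r * ⟪d, d⟫_ℝ := by
  have h := real_inner_self_nonneg (x := r • d - ∑ m ∈ M, ⟪m, d⟫_ℝ • m)
  have h1 : ⟪∑ m ∈ M, ⟪m, d⟫_ℝ • m, d⟫_ℝ = ∑ m ∈ M, ⟪m, d⟫_ℝ ^ 2 := by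
    rw [sum_inner]
    exact Finset.sum_congr rfl fun m _ => by rw [real_inner_smul_left, sq]
  have h2 : ⟪∑ m ∈ M, ⟪m, d⟫_ℝ • m, ∑ m ∈ M, ⟪m, d⟫_ℝ • m⟫_ℝ = r * ∑ m ∈ M, ⟪m, d⟫_ℝ ^ 2 := by
    rw [sum_inner, Finset.mul_sum]
    refine Finset.sum_congr rfl fun m hm => ?_
    rw [inner_sum, Finset.sum_eq_single m]
    · rw [real_inner_smul_left, real_inner_smul_right, hM m hm]; ring
    · intro m' hm' hne
      rw [real_inner_smul_left, real_inner_smul_right, ho m hm m' hm' hne.symm]; ring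
    · exact fun h => absurd hm h
  have h3 : ⟪d, ∑ m ∈ M, ⟪m, d⟫_ℝ • m⟫_ℝ = ∑ m ∈ M, ⟪m, d⟫_ℝ ^ 2 := by
    rw [real_inner_comm, h1]
  simp only [inner_sub_left, inner_sub_right, h2, real_inner_smul_left, real_inner_smul_right, h1,
    h3] at h
  by_contra! hc
  nlinarith

theorem eq_of_inner_eq {x y : E} {r : ℝ} (hx : ⟪x, x⟫_ℝ = r) (hy : ⟪y, y⟫_ℝ = r)
    (h : ⟪x, y⟫_ℝ = r) : x = y := by
  rw [← sub_eq_zero, ← inner_self_eq_zero (𝕜 := ℝ), inner_sub_left, inner_sub_right,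
    inner_sub_right, real_inner_comm x y, hx, hy, h]
  ring

theorem eq_neg_of_inner_eq_neg {x y : E} {r : ℝ} (hx : ⟪x, x⟫_ℝ = r) (hy : ⟪y, y⟫_ℝ = r)
    (h : ⟪x, y⟫_ℝ = -r) : x = -y :=
  eq_of_inner_eq hx (by simpa using hy) (by simp [h])

theorem abs_inner_le_of_inner_self_eq {x y : E} {r : ℝ} (hx : ⟪x, x⟫_ℝ = r)
    (hy : ⟪y, y⟫_ℝ = r) : -r ≤ ⟪x, y⟫_ℝ ∧ ⟪x, y⟫_ℝ ≤ r := by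
  have h1 := real_inner_self_nonneg (x := x - y)
  have h2 := real_inner_self_nonneg (x := x + y)
  rw [inner_sub_left, inner_sub_right, inner_sub_right, real_inner_comm x y] at h1
  rw [inner_add_left, inner_add_right, inner_add_right, real_inner_comm x y] at h2
  constructor <;> linarith

/-- A finite set of vectors of equal length, any two of which are orthogonal or proportional,
contains an orthogonal set of at least half its size. -/
theorem exists_pairwise_orthogonal_subset (C : Finset E) {r : ℝ}
    (hC : ∀ x ∈ C, ⟪x, x⟫_ℝ = r)
    (hp : ∀ x ∈ C, ∀ y ∈ C, ⟪x, y⟫_ℝ = r ∨ ⟪x, y⟫_ℝ = 0 ∨ ⟪x, y⟫_ℝ = -r) :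
    ∃ M ⊆ C, (∀ m ∈ M, ∀ m' ∈ M, m ≠ m' → ⟪m, m'⟫_ℝ = 0) ∧ C.card ≤ 2 * M.card := by
  classical
  obtain ⟨M, hM, hmax⟩ := Finset.exists_max_image
    (C.powerset.filter fun M => ∀ m ∈ M, ∀ m' ∈ M, m ≠ m' → ⟪m, m'⟫_ℝ = 0) Finset.card
    ⟨∅, by simp⟩
  simp only [Finset.mem_filter, Finset.mem_powerset] at hM hmax
  refine ⟨M, hM.1, hM.2, ?_⟩
  have hsub : C ⊆ M ∪ M.image (fun m => -m) := by
    intro c hc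
    by_contra hcM
    simp only [Finset.mem_union, Finset.mem_image, not_or, not_exists, not_and] at hcM
    have horth : ∀ m ∈ M, ⟪c, m⟫_ℝ = 0 := by
      intro m hm
      rcases hp c hc m (hM.1 hm) with h | h | h
      · exact absurd (eq_of_inner_eq (hC c hc) (hC m (hM.1 hm)) h ▸ hm) hcM.1
      · exact h
      · exact absurd (eq_neg_of_inner_eq_neg (hC c hc) (hC m (hM.1 hm)) h).symm (hcM.2 m hm)
    have := hmax (insert c M) ⟨Finset.insert_subset hc hM.1, ?_⟩
    · rw [Finset.card_insert_of_notMem hcM.1] at this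
      omega
    · intro m hm m' hm' hne
      rw [Finset.mem_insert] at hm hm'
      rcases hm with rfl | hm <;> rcases hm' with rfl | hm'
      · exact absurd rfl hne
      · exact horth _ hm'
      · rw [real_inner_comm]; exact horth _ hm
      · exact hM.2 m hm m' hm' hne
  calc C.card ≤ _ := Finset.card_le_card hsub
    _ ≤ M.card + (M.image (fun m => -m)).card := Finset.card_union_le _ _
    _ ≤ M.card + M.card := Nat.add_le_add_left Finset.card_image_le _
    _ = _ := by ring

/-- One pillar of an equiangular system of angle `1/3`: subtracting the projection to `h`
turns it into a system of pairwise orthogonal or proportional vectors. -/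
theorem exists_orthogonal_of_pillar (P : Finset E) {h : E} (hh : ⟪h, h⟫_ℝ = 2)
    (h6 : ∀ x ∈ P, ⟪x, x⟫_ℝ = 6) (hxh : ∀ x ∈ P, ⟪x, h⟫_ℝ = 2 ∨ ⟪x, h⟫_ℝ = -2)
    (hP : ∀ x ∈ P, ∀ y ∈ P,
      ⟪x, y⟫_ℝ = 6 ∨ ⟪x, y⟫_ℝ = 2 ∨ ⟪x, y⟫_ℝ = -2 ∨ ⟪x, y⟫_ℝ = -6) :
    ∃ M : Finset E, (∀ m ∈ M, ∃ x ∈ P, ∃ t : ℝ, m = x - t • h) ∧ (∀ m ∈ M, ⟪m, h⟫_ℝ = 0) ∧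
      (∀ m ∈ M, ⟪m, m⟫_ℝ = 4) ∧ (∀ m ∈ M, ∀ m' ∈ M, m ≠ m' → ⟪m, m'⟫_ℝ = 0) ∧
      P.card ≤ 4 * M.card := by
  classical
  let f : E → E := fun x => x - (⟪x, h⟫_ℝ / 2) • h
  have hfin : ∀ x y, ⟪f x, f y⟫_ℝ = ⟪x, y⟫_ℝ - ⟪x, h⟫_ℝ * ⟪y, h⟫_ℝ / 2 := by
    intro x y
    simp only [f, inner_sub_left, inner_sub_right, real_inner_smul_left, real_inner_smul_right, hh,
      real_inner_comm y h]
    ring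
  have h4 : ∀ x ∈ P, ⟪f x, f x⟫_ℝ = 4 := by
    intro x hx
    rw [hfin, h6 x hx]
    rcases hxh x hx with h | h <;> rw [h] <;> norm_num
  have h1 : P.card ≤ 2 * (P.image f).card := by
    refine Finset.card_le_mul_card_image _ _ fun c _ => ?_
    refine (Finset.card_le_card (t := ({c + h, c - h} : Finset E)) ?_).trans
      (Finset.card_le_two (a := c + h) (b := c - h))
    intro x hx
    rw [Finset.mem_filter] at hx
    obtain ⟨hx, rfl⟩ := hx
    rcases hxh x hx with h | h <;> simp [f, h]
  obtain ⟨M, hMC, hM, hcard⟩ := exists_pairwise_orthogonal_subset (P.image f) (r := 4)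
    (by simpa using h4) (by
      simp only [Finset.mem_image, forall_exists_index, and_imp, forall_apply_eq_imp_iff₂]
      intro x hx y hy
      have hb := abs_inner_le_of_inner_self_eq (h4 x hx) (h4 y hy)
      rw [hfin] at hb ⊢
      rcases hxh x hx with h | h <;> rcases hxh y hy with h' | h' <;>
      rcases hP x hx y hy with h'' | h'' | h'' | h'' <;> rw [h, h', h''] at hb ⊢ <;>
      first
        | (exfalso; linarith [hb.1, hb.2])
        | norm_num)
  have hmem : ∀ m ∈ M, ∃ x ∈ P, f x = m := fun m hm => by simpa using hMC hm
  refine ⟨M, fun m hm => ?_, fun m hm => ?_, fun m hm => ?_, hM, by omega⟩ <;>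
    obtain ⟨x, hx, rfl⟩ := hmem m hm
  · exact ⟨x, hx, _, rfl⟩
  · simp only [f, inner_sub_left, real_inner_smul_left, hh]
    ring
  · exact h4 x hx

theorem card_pillar_le_finrank [FiniteDimensional ℝ E] (P : Finset E) {h h' h'' : E}
    (hh : ⟪h, h⟫_ℝ = 2) (hh' : ⟪h', h'⟫_ℝ = 2) (hh'' : ⟪h'', h''⟫_ℝ = 2)
    (h01 : ⟪h, h'⟫_ℝ = 0) (h02 : ⟪h, h''⟫_ℝ = 0) (h12 : ⟪h', h''⟫_ℝ = 0)
    (h6 : ∀ x ∈ P, ⟪x, x⟫_ℝ = 6) (hxh : ∀ x ∈ P, ⟪x, h⟫_ℝ = 2 ∨ ⟪x, h⟫_ℝ = -2)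
    (hxh' : ∀ x ∈ P, ⟪x, h'⟫_ℝ = 0) (hxh'' : ∀ x ∈ P, ⟪x, h''⟫_ℝ = 0)
    (hP : ∀ x ∈ P, ∀ y ∈ P,
      ⟪x, y⟫_ℝ = 6 ∨ ⟪x, y⟫_ℝ = 2 ∨ ⟪x, y⟫_ℝ = -2 ∨ ⟪x, y⟫_ℝ = -6) :
    P.card + 12 ≤ 4 * Module.finrank ℝ E := by
  classical
  obtain ⟨M, hMx, hMh, hM4, hM, hcard⟩ := exists_orthogonal_of_pillar P hh h6 hxh hP
  have hMh' : ∀ m ∈ M, ⟪m, h'⟫_ℝ = 0 := by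
    intro m hm
    obtain ⟨x, hx, t, rfl⟩ := hMx m hm
    simp [inner_sub_left, real_inner_smul_left, hxh' x hx, h01]
  have hMh'' : ∀ m ∈ M, ⟪m, h''⟫_ℝ = 0 := by
    intro m hm
    obtain ⟨x, hx, t, rfl⟩ := hMx m hm
    simp [inner_sub_left, real_inner_smul_left, hxh'' x hx, h02]
  have key := card_le_finrank_of_pairwise_inner_eq_zero (insert h (insert h' (insert h'' M)))
    (by
      simp only [Finset.mem_insert]
      rintro m (rfl | rfl | rfl | hm) rfl
      · simp at hh
      · simp at hh'
      · simp at hh''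
      · simpa using hM4 _ hm)
    (by
      simp only [Finset.mem_insert]
      rintro m (rfl | rfl | rfl | hm) m' (rfl | rfl | rfl | hm') hne
      all_goals first
        | exact absurd rfl hne
        | assumption
        | (rw [real_inner_comm]; assumption)
        | (rw [real_inner_comm]; exact hMh _ ‹_›)
        | (rw [real_inner_comm]; exact hMh' _ ‹_›)
        | (rw [real_inner_comm]; exact hMh'' _ ‹_›)
        | exact hMh _ ‹_›
        | exact hMh' _ ‹_›
        | exact hMh'' _ ‹_›
        | exact hM _ ‹_› _ ‹_› hne)
  rw [Finset.card_insert_of_notMem, Finset.card_insert_of_notMem, Finset.card_insert_of_notMem]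
    at key
  · omega
  · intro hm
    have := hMh'' _ hm
    linarith
  · simp only [Finset.mem_insert]
    rintro (rfl | hm)
    · linarith
    · have := hMh' _ hm
      linarith
  · simp only [Finset.mem_insert]
    rintro (rfl | rfl | hm)
    · linarith
    · linarith
    · have := hMh _ hm
      linarith

theorem card_pillar_le_sixteen (P : Finset E) {h h' : E} (hh : ⟪h, h⟫_ℝ = 2)
    (hh' : ⟪h', h'⟫_ℝ = 2) (h01 : ⟪h, h'⟫_ℝ = 0)
    (h6 : ∀ x ∈ P, ⟪x, x⟫_ℝ = 6) (hxh : ∀ x ∈ P, ⟪x, h⟫_ℝ = 2 ∨ ⟪x, h⟫_ℝ = -2)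
    (hxh' : ∀ x ∈ P, ⟪x, h'⟫_ℝ = 0)
    (hP : ∀ x ∈ P, ∀ y ∈ P,
      ⟪x, y⟫_ℝ = 6 ∨ ⟪x, y⟫_ℝ = 2 ∨ ⟪x, y⟫_ℝ = -2 ∨ ⟪x, y⟫_ℝ = -6)
    {y : E} (hy6 : ⟪y, y⟫_ℝ = 6) (hyh : ⟪y, h⟫_ℝ = 0) (hyh' : ⟪y, h'⟫_ℝ = 2 ∨ ⟪y, h'⟫_ℝ = -2)
    (hPy : ∀ x ∈ P, ⟪x, y⟫_ℝ = 6 ∨ ⟪x, y⟫_ℝ = 2 ∨ ⟪x, y⟫_ℝ = -2 ∨ ⟪x, y⟫_ℝ = -6) :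
    P.card ≤ 16 := by
  obtain ⟨M, hMx, hMh, hM4, hM, hcard⟩ := exists_orthogonal_of_pillar P hh h6 hxh hP
  set d := y - (⟪y, h'⟫_ℝ / 2) • h' with hd
  have hdd : ⟪d, d⟫_ℝ = 4 := by
    simp only [hd, inner_sub_left, inner_sub_right, real_inner_smul_left, real_inner_smul_right,
      hh', hy6, real_inner_comm y h']
    rcases hyh' with h | h <;> rw [h] <;> norm_num
  have hmd : ∀ m ∈ M, 4 ≤ ⟪m, d⟫_ℝ ^ 2 := by
    intro m hm
    obtain ⟨x, hx, t, rfl⟩ := hMx m hm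
    have : ⟪x - t • h, d⟫_ℝ = ⟪x, y⟫_ℝ := by
      simp [hd, inner_sub_left, inner_sub_right, real_inner_smul_left, real_inner_smul_right,
        hxh' x hx, h01, real_inner_comm y h, hyh]
    rw [this]
    rcases hPy x hx with h | h | h | h <;> rw [h] <;> norm_num
  have hB := sum_inner_sq_le_of_pairwise_inner_eq_zero M (by norm_num) hM4 hM d
  have hS := Finset.card_nsmul_le_sum M _ 4 hmd
  rw [hdd] at hB
  rw [nsmul_eq_mul] at hS
  have : (M.card : ℝ) ≤ 4 := by linarith
  have : M.card ≤ 4 := by exact_mod_cast this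
  omega
/-- The vectors lying in the span of an orthogonal triple, with prescribed coordinates up to
sign. -/
theorem card_le_eight_of_inner_eq (T : Finset E) {h₁ h₂ h₃ : E}
    (hh₁ : ⟪h₁, h₁⟫_ℝ = 2) (hh₂ : ⟪h₂, h₂⟫_ℝ = 2) (hh₃ : ⟪h₃, h₃⟫_ℝ = 2)
    (h₁₂ : ⟪h₁, h₂⟫_ℝ = 0) (h₁₃ : ⟪h₁, h₃⟫_ℝ = 0) (h₂₃ : ⟪h₂, h₃⟫_ℝ = 0)
    (h6 : ∀ x ∈ T, ⟪x, x⟫_ℝ = 6)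
    (hT : ∀ x ∈ T, (⟪x, h₁⟫_ℝ = 2 ∨ ⟪x, h₁⟫_ℝ = -2) ∧ (⟪x, h₂⟫_ℝ = 2 ∨ ⟪x, h₂⟫_ℝ = -2) ∧
      (⟪x, h₃⟫_ℝ = 2 ∨ ⟪x, h₃⟫_ℝ = -2)) :
    T.card ≤ 8 := by
  classical
  let f : E → E := fun x => (⟪x, h₁⟫_ℝ / 2) • h₁ + (⟪x, h₂⟫_ℝ / 2) • h₂ + (⟪x, h₃⟫_ℝ / 2) • h₃
  have hf : ∀ x ∈ T, x = f x := by
    intro x hx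
    have hxf : ⟪x, f x⟫_ℝ = (⟪x, h₁⟫_ℝ ^ 2 + ⟪x, h₂⟫_ℝ ^ 2 + ⟪x, h₃⟫_ℝ ^ 2) / 2 := by
      simp only [f, inner_add_right, real_inner_smul_right]
      ring
    have hff : ⟪f x, f x⟫_ℝ = (⟪x, h₁⟫_ℝ ^ 2 + ⟪x, h₂⟫_ℝ ^ 2 + ⟪x, h₃⟫_ℝ ^ 2) / 2 := by
      simp only [f, inner_add_right, real_inner_smul_right, inner_add_left, real_inner_smul_left,
        hh₁, hh₂, hh₃, h₁₂, h₁₃, h₂₃, real_inner_comm h₁ h₂, real_inner_comm h₁ h₃,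
        real_inner_comm h₂ h₃]
      ring
    have hv : (⟪x, h₁⟫_ℝ ^ 2 + ⟪x, h₂⟫_ℝ ^ 2 + ⟪x, h₃⟫_ℝ ^ 2) / 2 = 6 := by
      obtain ⟨a | a, b | b, c | c⟩ := hT x hx <;> rw [a, b, c] <;> norm_num
    exact eq_of_inner_eq (h6 x hx) (hff.trans hv) (hxf.trans hv)
  let s : Finset ℝ := {2, -2}
  have hs : s.card ≤ 2 := Finset.card_le_two
  have hle : T.card ≤ (s ×ˢ s ×ˢ s).card := by
    refine Finset.card_le_card_of_injOn (fun x => (⟪x, h₁⟫_ℝ, ⟪x, h₂⟫_ℝ, ⟪x, h₃⟫_ℝ)) ?_ ?_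
    · intro x hx
      simpa [s] using hT x hx
    · intro x hx y hy hxy
      simp only [Prod.mk.injEq] at hxy
      rw [hf x hx, hf y hy]
      simp only [f, hxy]
  rw [Finset.card_product, Finset.card_product] at hle
  calc T.card ≤ _ := hle
    _ ≤ 2 * (2 * 2) := by gcongr

theorem card_le_of_orthogonal_triple [FiniteDimensional ℝ E] (T : Finset E) {h₁ h₂ h₃ : E}
    (hh₁ : ⟪h₁, h₁⟫_ℝ = 2) (hh₂ : ⟪h₂, h₂⟫_ℝ = 2) (hh₃ : ⟪h₃, h₃⟫_ℝ = 2)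
    (h₁₂ : ⟪h₁, h₂⟫_ℝ = 0) (h₁₃ : ⟪h₁, h₃⟫_ℝ = 0) (h₂₃ : ⟪h₂, h₃⟫_ℝ = 0)
    (h6 : ∀ x ∈ T, ⟪x, x⟫_ℝ = 6)
    (hT : ∀ x ∈ T, ∀ y ∈ T,
      ⟪x, y⟫_ℝ = 6 ∨ ⟪x, y⟫_ℝ = 2 ∨ ⟪x, y⟫_ℝ = -2 ∨ ⟪x, y⟫_ℝ = -6)
    (hTh : ∀ x ∈ T,
      ((⟪x, h₁⟫_ℝ = 2 ∨ ⟪x, h₁⟫_ℝ = -2) ∧ (⟪x, h₂⟫_ℝ = 2 ∨ ⟪x, h₂⟫_ℝ = -2) ∧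
        (⟪x, h₃⟫_ℝ = 2 ∨ ⟪x, h₃⟫_ℝ = -2)) ∨
      ((⟪x, h₁⟫_ℝ = 2 ∨ ⟪x, h₁⟫_ℝ = -2) ∧ ⟪x, h₂⟫_ℝ = 0 ∧ ⟪x, h₃⟫_ℝ = 0) ∨
      ((⟪x, h₂⟫_ℝ = 2 ∨ ⟪x, h₂⟫_ℝ = -2) ∧ ⟪x, h₁⟫_ℝ = 0 ∧ ⟪x, h₃⟫_ℝ = 0) ∨
      ((⟪x, h₃⟫_ℝ = 2 ∨ ⟪x, h₃⟫_ℝ = -2) ∧ ⟪x, h₁⟫_ℝ = 0 ∧ ⟪x, h₂⟫_ℝ = 0)) :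
    T.card ≤ 56 ∨ T.card + 4 ≤ 4 * Module.finrank ℝ E := by
  classical
  set T₀ := T.filter fun x => (⟪x, h₁⟫_ℝ = 2 ∨ ⟪x, h₁⟫_ℝ = -2) ∧
    (⟪x, h₂⟫_ℝ = 2 ∨ ⟪x, h₂⟫_ℝ = -2) ∧ (⟪x, h₃⟫_ℝ = 2 ∨ ⟪x, h₃⟫_ℝ = -2) with hT₀
  set P₁ := T.filter fun x =>
    (⟪x, h₁⟫_ℝ = 2 ∨ ⟪x, h₁⟫_ℝ = -2) ∧ ⟪x, h₂⟫_ℝ = 0 ∧ ⟪x, h₃⟫_ℝ = 0 with hP₁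
  set P₂ := T.filter fun x =>
    (⟪x, h₂⟫_ℝ = 2 ∨ ⟪x, h₂⟫_ℝ = -2) ∧ ⟪x, h₁⟫_ℝ = 0 ∧ ⟪x, h₃⟫_ℝ = 0 with hP₂
  set P₃ := T.filter fun x =>
    (⟪x, h₃⟫_ℝ = 2 ∨ ⟪x, h₃⟫_ℝ = -2) ∧ ⟪x, h₁⟫_ℝ = 0 ∧ ⟪x, h₂⟫_ℝ = 0 with hP₃
  have hunion : T.card ≤ T₀.card + (P₁.card + (P₂.card + P₃.card)) := by
    calc T.card ≤ (T₀ ∪ (P₁ ∪ (P₂ ∪ P₃))).card := by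
          refine Finset.card_le_card fun x hx => ?_
          simp only [hT₀, hP₁, hP₂, hP₃, Finset.mem_union, Finset.mem_filter, hx, true_and]
          exact hTh x hx
      _ ≤ T₀.card + (P₁ ∪ (P₂ ∪ P₃)).card := Finset.card_union_le _ _
      _ ≤ T₀.card + (P₁.card + (P₂ ∪ P₃).card) :=
        Nat.add_le_add_left (Finset.card_union_le _ _) _
      _ ≤ _ := Nat.add_le_add_left (Nat.add_le_add_left (Finset.card_union_le _ _) _) _
  have h₂₁ : ⟪h₂, h₁⟫_ℝ = 0 := by rwa [real_inner_comm]
  have h₃₁ : ⟪h₃, h₁⟫_ℝ = 0 := by rwa [real_inner_comm]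
  have h₃₂ : ⟪h₃, h₂⟫_ℝ = 0 := by rwa [real_inner_comm]
  have b₀ : T₀.card ≤ 8 := card_le_eight_of_inner_eq T₀ hh₁ hh₂ hh₃ h₁₂ h₁₃ h₂₃
    (fun x hx => h6 x (Finset.mem_of_mem_filter x hx)) (fun x hx => (Finset.mem_filter.1 hx).2)
  have q₁ := fun x (hx : x ∈ P₁) => Finset.mem_filter.1 hx
  have q₂ := fun x (hx : x ∈ P₂) => Finset.mem_filter.1 hx
  have q₃ := fun x (hx : x ∈ P₃) => Finset.mem_filter.1 hx
  have b₁ : P₁.card + 12 ≤ 4 * Module.finrank ℝ E :=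
    card_pillar_le_finrank P₁ hh₁ hh₂ hh₃ h₁₂ h₁₃ h₂₃ (fun x hx => h6 x (q₁ x hx).1)
      (fun x hx => (q₁ x hx).2.1) (fun x hx => (q₁ x hx).2.2.1) (fun x hx => (q₁ x hx).2.2.2)
      (fun x hx y hy => hT x (q₁ x hx).1 y (q₁ y hy).1)
  have b₂ : P₂.card + 12 ≤ 4 * Module.finrank ℝ E :=
    card_pillar_le_finrank P₂ hh₂ hh₁ hh₃ h₂₁ h₂₃ h₁₃ (fun x hx => h6 x (q₂ x hx).1)
      (fun x hx => (q₂ x hx).2.1) (fun x hx => (q₂ x hx).2.2.1) (fun x hx => (q₂ x hx).2.2.2)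
      (fun x hx y hy => hT x (q₂ x hx).1 y (q₂ y hy).1)
  have b₃ : P₃.card + 12 ≤ 4 * Module.finrank ℝ E :=
    card_pillar_le_finrank P₃ hh₃ hh₁ hh₂ h₃₁ h₃₂ h₁₂ (fun x hx => h6 x (q₃ x hx).1)
      (fun x hx => (q₃ x hx).2.1) (fun x hx => (q₃ x hx).2.2.1) (fun x hx => (q₃ x hx).2.2.2)
      (fun x hx y hy => hT x (q₃ x hx).1 y (q₃ y hy).1)
  have c₁₂ : P₂.Nonempty → P₁.card ≤ 16 := fun ⟨y, hy⟩ =>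
    card_pillar_le_sixteen P₁ hh₁ hh₂ h₁₂ (fun x hx => h6 x (q₁ x hx).1)
      (fun x hx => (q₁ x hx).2.1) (fun x hx => (q₁ x hx).2.2.1)
      (fun x hx y hy => hT x (q₁ x hx).1 y (q₁ y hy).1) (h6 y (q₂ y hy).1) (q₂ y hy).2.2.1
      (q₂ y hy).2.1 (fun x hx => hT x (q₁ x hx).1 y (q₂ y hy).1)
  have c₁₃ : P₃.Nonempty → P₁.card ≤ 16 := fun ⟨y, hy⟩ =>
    card_pillar_le_sixteen P₁ hh₁ hh₃ h₁₃ (fun x hx => h6 x (q₁ x hx).1)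
      (fun x hx => (q₁ x hx).2.1) (fun x hx => (q₁ x hx).2.2.2)
      (fun x hx y hy => hT x (q₁ x hx).1 y (q₁ y hy).1) (h6 y (q₃ y hy).1) (q₃ y hy).2.2.1
      (q₃ y hy).2.1 (fun x hx => hT x (q₁ x hx).1 y (q₃ y hy).1)
  have c₂₁ : P₁.Nonempty → P₂.card ≤ 16 := fun ⟨y, hy⟩ =>
    card_pillar_le_sixteen P₂ hh₂ hh₁ h₂₁ (fun x hx => h6 x (q₂ x hx).1)
      (fun x hx => (q₂ x hx).2.1) (fun x hx => (q₂ x hx).2.2.1)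
      (fun x hx y hy => hT x (q₂ x hx).1 y (q₂ y hy).1) (h6 y (q₁ y hy).1) (q₁ y hy).2.2.1
      (q₁ y hy).2.1 (fun x hx => hT x (q₂ x hx).1 y (q₁ y hy).1)
  have c₂₃ : P₃.Nonempty → P₂.card ≤ 16 := fun ⟨y, hy⟩ =>
    card_pillar_le_sixteen P₂ hh₂ hh₃ h₂₃ (fun x hx => h6 x (q₂ x hx).1)
      (fun x hx => (q₂ x hx).2.1) (fun x hx => (q₂ x hx).2.2.2)
      (fun x hx y hy => hT x (q₂ x hx).1 y (q₂ y hy).1) (h6 y (q₃ y hy).1) (q₃ y hy).2.2.2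
      (q₃ y hy).2.1 (fun x hx => hT x (q₂ x hx).1 y (q₃ y hy).1)
  have c₃₁ : P₁.Nonempty → P₃.card ≤ 16 := fun ⟨y, hy⟩ =>
    card_pillar_le_sixteen P₃ hh₃ hh₁ h₃₁ (fun x hx => h6 x (q₃ x hx).1)
      (fun x hx => (q₃ x hx).2.1) (fun x hx => (q₃ x hx).2.2.1)
      (fun x hx y hy => hT x (q₃ x hx).1 y (q₃ y hy).1) (h6 y (q₁ y hy).1) (q₁ y hy).2.2.2
      (q₁ y hy).2.1 (fun x hx => hT x (q₃ x hx).1 y (q₁ y hy).1)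
  have c₃₂ : P₂.Nonempty → P₃.card ≤ 16 := fun ⟨y, hy⟩ =>
    card_pillar_le_sixteen P₃ hh₃ hh₂ h₃₂ (fun x hx => h6 x (q₃ x hx).1)
      (fun x hx => (q₃ x hx).2.1) (fun x hx => (q₃ x hx).2.2.2)
      (fun x hx y hy => hT x (q₃ x hx).1 y (q₃ y hy).1) (h6 y (q₂ y hy).1) (q₂ y hy).2.2.2
      (q₂ y hy).2.1 (fun x hx => hT x (q₃ x hx).1 y (q₂ y hy).1)
  simp only [← Finset.card_pos] at c₁₂ c₁₃ c₂₁ c₂₃ c₃₁ c₃₂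
  omega

theorem card_le_finrank_of_pairwise_inner_eq_two [FiniteDimensional ℝ E] (M : Finset E)
    (h6 : ∀ x ∈ M, ⟪x, x⟫_ℝ = 6) (h2 : ∀ x ∈ M, ∀ y ∈ M, x ≠ y → ⟪x, y⟫_ℝ = 2) :
    M.card ≤ Module.finrank ℝ E := by
  classical
  have hli : LinearIndependent ℝ (fun m : M => (m : E)) := by
    rw [Fintype.linearIndependent_iff]
    intro g hg i
    have hin : ∀ j : M, 4 * g j + 2 * ∑ k, g k = 0 := by
      intro j
      have h0 : ⟪∑ k, g k • (k : E), (j : E)⟫_ℝ = 0 := by rw [hg, inner_zero_left]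
      have hk : ∀ k : M, ⟪g k • (k : E), (j : E)⟫_ℝ = (if k = j then 4 * g j else 0) + 2 * g k := by
        intro k
        rw [real_inner_smul_left]
        split_ifs with h
        · rw [h, h6 j j.2]; ring
        · rw [h2 k k.2 j j.2 fun e => h (Subtype.ext e)]; ring
      rw [sum_inner, Finset.sum_congr rfl fun k _ => hk k, Finset.sum_add_distrib,
        Finset.sum_ite_eq' , ← Finset.mul_sum] at h0
      simpa using h0
    have hsum : (4 + 2 * (M.card : ℝ)) * ∑ k, g k = 0 := by
      have := Finset.sum_congr rfl fun j (_ : j ∈ Finset.univ) => hin j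
      rw [Finset.sum_add_distrib, ← Finset.mul_sum] at this
      simp only [Finset.sum_const, Finset.card_univ, Fintype.card_coe, nsmul_eq_mul, mul_zero]
        at this
      linarith
    have hs : ∑ k, g k = 0 := by
      rcases mul_eq_zero.1 hsum with h | h
      · have : (0 : ℝ) ≤ M.card := Nat.cast_nonneg _
        linarith
      · exact h
    have := hin i
    rw [hs] at this
    linarith
  simpa using hli.fintype_card_le_finrank

/-- The vectors of an equiangular system of angle `1/3`, each line being represented at most
twice. -/
theorem card_le_of_equiangular [FiniteDimensional ℝ E] (T : Finset E)
    (h6 : ∀ x ∈ T, ⟪x, x⟫_ℝ = 6)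
    (hT : ∀ x ∈ T, ∀ y ∈ T,
      ⟪x, y⟫_ℝ = 6 ∨ ⟪x, y⟫_ℝ = 2 ∨ ⟪x, y⟫_ℝ = -2 ∨ ⟪x, y⟫_ℝ = -6) :
    T.card ≤ 56 ∨ T.card + 4 ≤ 4 * Module.finrank ℝ E ∨ T.card ≤ 2 * Module.finrank ℝ E := by
  classical
  by_cases htri : ∃ x ∈ T, ∃ y ∈ T, ∃ z ∈ T, (⟪x, y⟫_ℝ = 2 ∨ ⟪x, y⟫_ℝ = -2) ∧
      (⟪x, z⟫_ℝ = 2 ∨ ⟪x, z⟫_ℝ = -2) ∧ ⟪x, y⟫_ℝ * ⟪x, z⟫_ℝ * ⟪y, z⟫_ℝ = -8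
  · obtain ⟨x, hx, y, hy, z, hz, hxy, hxz, hxyz⟩ := htri
    have htriple : ∃ p₁ p₂ p₃ : E, ⟪p₁, p₁⟫_ℝ = 6 ∧ ⟪p₂, p₂⟫_ℝ = 6 ∧ ⟪p₃, p₃⟫_ℝ = 6 ∧
        ⟪p₁, p₂⟫_ℝ = -2 ∧ ⟪p₁, p₃⟫_ℝ = -2 ∧ ⟪p₂, p₃⟫_ℝ = -2 ∧
        ∀ w ∈ T, (⟪w, p₁⟫_ℝ = 6 ∨ ⟪w, p₁⟫_ℝ = 2 ∨ ⟪w, p₁⟫_ℝ = -2 ∨ ⟪w, p₁⟫_ℝ = -6) ∧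
          (⟪w, p₂⟫_ℝ = 6 ∨ ⟪w, p₂⟫_ℝ = 2 ∨ ⟪w, p₂⟫_ℝ = -2 ∨ ⟪w, p₂⟫_ℝ = -6) ∧
          (⟪w, p₃⟫_ℝ = 6 ∨ ⟪w, p₃⟫_ℝ = 2 ∨ ⟪w, p₃⟫_ℝ = -2 ∨ ⟪w, p₃⟫_ℝ = -6) := by
      refine ⟨x, (-⟪x, y⟫_ℝ / 2) • y, (-⟪x, z⟫_ℝ / 2) • z, h6 x hx, ?_, ?_, ?_, ?_, ?_,
        fun w hw => ⟨hT w hw x hx, ?_, ?_⟩⟩ <;>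
        simp only [real_inner_smul_left, real_inner_smul_right, h6 y hy, h6 z hz]
      · rcases hxy with h | h <;> rw [h] <;> norm_num
      · rcases hxz with h | h <;> rw [h] <;> norm_num
      · rcases hxy with h | h <;> rw [h] <;> norm_num
      · rcases hxz with h | h <;> rw [h] <;> norm_num
      · linarith
      · rcases hxy with h | h <;> rcases hT w hw y hy with h' | h' | h' | h' <;> rw [h, h'] <;>
          norm_num
      · rcases hxz with h | h <;> rcases hT w hw z hz with h' | h' | h' | h' <;> rw [h, h'] <;>
          norm_num
    obtain ⟨p₁, p₂, p₃, p11, p22, p33, p12, p13, p23, hw⟩ := htriple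
    have p21 : ⟪p₂, p₁⟫_ℝ = -2 := by rwa [real_inner_comm]
    have p31 : ⟪p₃, p₁⟫_ℝ = -2 := by rwa [real_inner_comm]
    have p32 : ⟪p₃, p₂⟫_ℝ = -2 := by rwa [real_inner_comm]
    have key := card_le_of_orthogonal_triple T (h₁ := (1 / 2 : ℝ) • (p₁ + p₂))
      (h₂ := (1 / 2 : ℝ) • (p₁ + p₃)) (h₃ := (-1 / 2 : ℝ) • (p₂ + p₃))
    simp only [real_inner_smul_left, real_inner_smul_right, inner_add_left, inner_add_right,
      p11, p22, p33, p12, p13, p23, p21, p31, p32] at key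
    have key' := key (by norm_num) (by norm_num) (by norm_num) (by norm_num) (by norm_num)
      (by norm_num) h6 hT ?_
    · tauto
    · intro w hwT
      have hpos := real_inner_self_nonneg (x := w
        - ((2 * ⟪w, p₁⟫_ℝ + ⟪w, p₂⟫_ℝ + ⟪w, p₃⟫_ℝ) / 8) • p₁
        - ((⟪w, p₁⟫_ℝ + 2 * ⟪w, p₂⟫_ℝ + ⟪w, p₃⟫_ℝ) / 8) • p₂
        - ((⟪w, p₁⟫_ℝ + ⟪w, p₂⟫_ℝ + 2 * ⟪w, p₃⟫_ℝ) / 8) • p₃)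
      simp only [real_inner_smul_left, real_inner_smul_right, inner_sub_left, inner_sub_right,
        p11, p22, p33, p12, p13, p23, p21, p31, p32, h6 w hwT, real_inner_comm w p₁,
        real_inner_comm w p₂, real_inner_comm w p₃] at hpos
      have hbd : (⟪w, p₁⟫_ℝ + ⟪w, p₂⟫_ℝ) ^ 2 + (⟪w, p₁⟫_ℝ + ⟪w, p₃⟫_ℝ) ^ 2
          + (⟪w, p₂⟫_ℝ + ⟪w, p₃⟫_ℝ) ^ 2 ≤ 48 := by
        linarith
      clear hpos key
      obtain ⟨ha, hb, hc⟩ := hw w hwT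
      rcases ha with a | a | a | a <;> rcases hb with b | b | b | b <;>
        rcases hc with c | c | c | c <;> rw [a, b, c] at hbd ⊢ <;>
        first
          | (exfalso; norm_num at hbd; done)
          | norm_num
  · push Not at htri
    right; right
    rcases T.eq_empty_or_nonempty with rfl | ⟨x₀, hx₀⟩
    · simp
    let f : E → E := fun x => if 0 < ⟪x₀, x⟫_ℝ then x else -x
    have hf : ∀ x, f x = x ∨ f x = -x := by
      intro x
      simp only [f]
      split_ifs <;> simp
    have hf0 : ∀ x ∈ T, ⟪x₀, f x⟫_ℝ = 2 ∨ f x = x₀ := by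
      intro x hx
      rcases hT x₀ hx₀ x hx with h | h | h | h
      · right
        simp only [f, h]
        norm_num
        exact (eq_of_inner_eq (h6 _ hx₀) (h6 _ hx) h).symm
      · left
        simp only [f, h]
        norm_num [h]
      · left
        simp only [f, h]
        norm_num [h]
      · right
        simp only [f, h]
        norm_num
        exact (eq_neg_of_inner_eq_neg (h6 _ hx₀) (h6 _ hx) h).symm
    have hcard : T.card ≤ 2 * (T.image f).card := by
      refine Finset.card_le_mul_card_image _ _ fun c _ => ?_
      refine (Finset.card_le_card (t := ({c, -c} : Finset E)) ?_).trans
        (Finset.card_le_two (a := c) (b := -c))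
      intro x hx
      rw [Finset.mem_filter] at hx
      obtain ⟨-, rfl⟩ := hx
      rcases hf x with h | h <;> rw [h] <;> simp
    have hf6 : ∀ x ∈ T, ⟪f x, f x⟫_ℝ = 6 := by
      intro x hx
      rcases hf x with h | h <;> rw [h] <;> simpa using h6 x hx
    refine hcard.trans (Nat.mul_le_mul_left 2
      (card_le_finrank_of_pairwise_inner_eq_two (T.image f) (by simpa using hf6) ?_))
    simp only [Finset.mem_image, forall_exists_index, and_imp, forall_apply_eq_imp_iff₂]
    intro x hx y hy hne
    rcases hf0 x hx with hx0 | hx0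
    · rcases hf0 y hy with hy0 | hy0
      · have hxy : ⟪f x, f y⟫_ℝ = 6 ∨ ⟪f x, f y⟫_ℝ = 2 ∨ ⟪f x, f y⟫_ℝ = -2 ∨
            ⟪f x, f y⟫_ℝ = -6 := by
          rcases hf x with h | h <;> rcases hf y with h' | h' <;> rw [h, h'] <;>
            rcases hT x hx y hy with h'' | h'' | h'' | h'' <;> simp [h'']
        rcases hxy with h | h | h | h
        · exact absurd (eq_of_inner_eq (hf6 x hx) (hf6 y hy) h) hne
        · exact h
        · exfalso
          refine htri x₀ hx₀ x hx y hy ?_ ?_ ?_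
          · rcases hf x with h' | h' <;> rw [h'] at hx0
            · exact Or.inl hx0
            · right; rw [inner_neg_right] at hx0; linarith
          · rcases hf y with h' | h' <;> rw [h'] at hy0
            · exact Or.inl hy0
            · right; rw [inner_neg_right] at hy0; linarith
          · have : ⟪x₀, x⟫_ℝ * ⟪x₀, y⟫_ℝ * ⟪x, y⟫_ℝ
                = ⟪x₀, f x⟫_ℝ * ⟪x₀, f y⟫_ℝ * ⟪f x, f y⟫_ℝ := by
              rcases hf x with h | h <;> rcases hf y with h' | h' <;> rw [h, h'] <;> simp
            rw [this, hx0, hy0, h]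
            norm_num
        · have := eq_neg_of_inner_eq_neg (hf6 x hx) (hf6 y hy) h
          rw [this, inner_neg_right] at hx0
          linarith
      · rcases hf0 y hy with h | h
        · rw [hy0, h6 _ hx₀] at h
          norm_num at h
        · rw [hy0, real_inner_comm]
          exact hx0
    · rcases hf0 y hy with hy0 | hy0
      · rw [hx0]; exact hy0
      · exact absurd (hx0.trans hy0.symm) hne

/-- A bound for the number of lines meeting at angles `π/2` and `π/3`. -/
theorem card_le_of_root_lines [FiniteDimensional ℝ E] {u : ℕ} (x : Fin u → E)
    (h2 : ∀ i, ⟪x i, x i⟫_ℝ = 2)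
    (hx : ∀ i j, i ≠ j → ⟪x i, x j⟫_ℝ = 0 ∨ ⟪x i, x j⟫_ℝ = 1 ∨ ⟪x i, x j⟫_ℝ = -1) :
    u ≤ 225 ∨ u ≤ Module.finrank ℝ E ^ 2 := by
  classical
  set n := Module.finrank ℝ E with hn
  let A : Fin u → Finset (Fin u) := fun i =>
    Finset.univ.filter fun j => ⟪x i, x j⟫_ℝ = 1 ∨ ⟪x i, x j⟫_ℝ = -1
  have hA : ∀ i, (A i).card ≤ 56 ∨ (A i).card + 4 ≤ 4 * n ∨ (A i).card ≤ 2 * n := by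
    intro i
    let f : Fin u → E := fun j => (2 * ⟪x i, x j⟫_ℝ) • x j - x i
    have hfin : ∀ j k, ⟪f j, f k⟫_ℝ = 4 * ⟪x i, x j⟫_ℝ * ⟪x i, x k⟫_ℝ * ⟪x j, x k⟫_ℝ
        - 2 * ⟪x i, x j⟫_ℝ ^ 2 - 2 * ⟪x i, x k⟫_ℝ ^ 2 + 2 := by
      intro j k
      simp only [f, inner_sub_left, inner_sub_right, real_inner_smul_left, real_inner_smul_right,
        h2, real_inner_comm (x i) (x j)]
      ring
    have hAi : ∀ j ∈ A i, ⟪x i, x j⟫_ℝ = 1 ∨ ⟪x i, x j⟫_ℝ = -1 := fun j hj =>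
      (Finset.mem_filter.1 hj).2
    have h6 : ∀ j ∈ A i, ⟪f j, f j⟫_ℝ = 6 := by
      intro j hj
      rw [hfin, h2]
      rcases hAi j hj with h | h <;> rw [h] <;> norm_num
    have hval : ∀ j ∈ A i, ∀ k ∈ A i, ⟪f j, f k⟫_ℝ = 6 ∨ ⟪f j, f k⟫_ℝ = 2 ∨
        ⟪f j, f k⟫_ℝ = -2 ∨ ⟪f j, f k⟫_ℝ = -6 := by
      intro j hj k hk
      rcases eq_or_ne j k with rfl | hjk
      · exact Or.inl (h6 j hj)
      rw [hfin]
      rcases hAi j hj with h | h <;> rcases hAi k hk with h' | h' <;>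
        rcases hx j k hjk with h'' | h'' | h'' <;> rw [h, h', h''] <;> norm_num
    have hinj : Set.InjOn f (A i) := by
      intro j hj k hk hjk
      by_contra hne
      have h := hfin j k
      rw [← hjk, h6 j hj] at h
      rcases hAi j hj with h1 | h1 <;> rcases hAi k hk with h1' | h1' <;>
        rcases hx j k hne with h'' | h'' | h'' <;> rw [h1, h1', h''] at h <;> norm_num at h
    have := card_le_of_equiangular ((A i).image f) (by simpa using h6) (by
      simp only [Finset.mem_image, forall_exists_index, and_imp, forall_apply_eq_imp_iff₂]
      exact hval)
    rwa [Finset.card_image_of_injOn hinj] at this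
  have hsum : ∀ i, ∑ j, ⟪x i, x j⟫_ℝ ^ 2 = 4 + (A i).card := by
    intro i
    have : ∀ j, ⟪x i, x j⟫_ℝ ^ 2 = (if j = i then 4 else 0)
        + if ⟪x i, x j⟫_ℝ = 1 ∨ ⟪x i, x j⟫_ℝ = -1 then 1 else 0 := by
      intro j
      split_ifs with h h' h'
      · rw [h, h2] at h'; norm_num at h'
      · rw [h, h2]; norm_num
      · rcases h' with h' | h' <;> rw [h'] <;> norm_num
      · rcases hx i j (Ne.symm h) with h'' | h'' | h''
        · rw [h'']; norm_num
        · exact absurd (Or.inl h'') h'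
        · exact absurd (Or.inr h'') h'
    rw [Finset.sum_congr rfl fun j _ => this j, Finset.sum_add_distrib, Finset.sum_ite_eq',
      Finset.sum_boole]
    simp [A]
  have htr := sq_sum_inner_self_le_finrank_mul x
  simp only [h2, hsum, ← hn] at htr
  by_contra! hcon
  obtain ⟨hu, hun⟩ := hcon
  have hbound : ∀ m : ℕ, (∀ i, (A i).card ≤ m) → 4 * u ≤ n * (4 + m) := by
    intro m hm
    have h1 : ∑ i, ((4 : ℝ) + (A i).card) ≤ u * (4 + m) := by
      calc ∑ i, ((4 : ℝ) + (A i).card) ≤ ∑ _i : Fin u, ((4 : ℝ) + m) := by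
            gcongr with i; exact hm i
        _ = _ := by simp; ring
    have h3 : ((u : ℝ) * 2) ^ 2 ≤ n * (u * (4 + m)) := by
      calc ((u : ℝ) * 2) ^ 2 = (∑ _i : Fin u, (2 : ℝ)) ^ 2 := by simp
        _ ≤ _ := htr
        _ ≤ _ := by gcongr
    have hu0 : (0 : ℝ) < u := by exact_mod_cast (by omega : 0 < u)
    have h4 : (4 : ℝ) * u ≤ n * (4 + m) := by
      by_contra! hc
      nlinarith
    exact_mod_cast h4
  have hn16 : 16 ≤ n := by
    by_contra! hlt
    have := hbound 56 fun i => by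
      rcases hA i with h | h | h <;> omega
    nlinarith
  have := hbound (4 * n - 4) fun i => by
    rcases hA i with h | h | h <;> omega
  have h4 : 4 + (4 * n - 4) = 4 * n := by omega
  rw [h4] at this
  nlinarith
end

/-- A finite-dimensional rational space with a positive definite form embeds isometrically into
a Euclidean space of the same dimension. -/
theorem exists_euclidean_realization {W : Type*} [AddCommGroup W] [Module ℚ W]
    [FiniteDimensional ℚ W] (B : LinearMap.BilinForm ℚ W) (hB : LinearMap.IsSymm B)
    (hpos : ∀ x, x ≠ 0 → 0 < B x x) :
    ∃ g : W → EuclideanSpace ℝ (Fin (Module.finrank ℚ W)),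
      ∀ x y, ⟪g x, g y⟫_ℝ = (B x y : ℝ) := by
  let _ : Invertible (2 : ℚ) := invertibleOfNonzero two_ne_zero
  obtain ⟨v, hv⟩ := LinearMap.BilinForm.exists_orthogonal_basis hB
  have hvpos : ∀ k, 0 < B (v k) (v k) := fun k => hpos _ (v.ne_zero k)
  have hrepr : ∀ y k, B y (v k) = v.repr y k * B (v k) (v k) := by
    intro y k
    conv_lhs => rw [← v.sum_repr y]
    rw [map_sum, LinearMap.sum_apply, Finset.sum_eq_single k]
    · simp
    · intro l _ hl
      have : B (v l) (v k) = 0 := hv hl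
      simp [this]
    · simp
  refine ⟨fun x => WithLp.toLp 2 fun k => (B x (v k) : ℝ) / √(B (v k) (v k) : ℝ), fun x y => ?_⟩
  have hxy : B x y = ∑ k, B x (v k) * B y (v k) / B (v k) (v k) := by
    conv_lhs => rw [← v.sum_repr y]
    rw [map_sum]
    refine Finset.sum_congr rfl fun k _ => ?_
    have := (hvpos k).ne'
    rw [hrepr y k, map_smul, smul_eq_mul]
    field_simp
  rw [hxy, PiLp.inner_apply]
  push_cast
  refine Finset.sum_congr rfl fun k _ => ?_
  have h0 : (0 : ℝ) ≤ (B (v k) (v k) : ℝ) := by exact_mod_cast (hvpos k).le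
  simp only [RCLike.inner_apply, conj_trivial]
  rw [div_mul_div_comm, Real.mul_self_sqrt h0, mul_comm]

theorem trace_pos_of_totally_positive {K : Type*} [Field K] [NumberField K]
    (htr : ∀ φ : K →+* ℂ, NumberField.ComplexEmbedding.IsReal φ) (a : K)
    (ha : ∀ σ : K →+* ℝ, 0 < σ a) : 0 < Algebra.trace ℚ K a := by
  have h := trace_eq_sum_embeddings ℂ (K := ℚ) (L := K) (x := a)
  have hσ : ∀ σ : K →ₐ[ℚ] ℂ, σ a = (((htr σ.toRingHom).embedding a : ℝ) : ℂ) := fun σ =>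
    ((htr σ.toRingHom).coe_embedding_apply a).symm
  rw [Finset.sum_congr rfl fun σ _ => hσ σ, ← Complex.ofReal_sum] at h
  have h' : ((Algebra.trace ℚ K a : ℚ) : ℝ)
      = ∑ σ : K →ₐ[ℚ] ℂ, (htr σ.toRingHom).embedding a := by
    apply Complex.ofReal_injective
    rw [← h]
    simp
  have hne : (Finset.univ : Finset (K →ₐ[ℚ] ℂ)).Nonempty := ⟨IsAlgClosed.lift, Finset.mem_univ _⟩
  have : (0 : ℝ) < ((Algebra.trace ℚ K a : ℚ) : ℝ) := by
    rw [h']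
    exact Finset.sum_pos (fun σ _ => ha _) hne
  exact_mod_cast this

theorem exists_euclidean_realization_trace_polar {K : Type*} [Field K] [NumberField K]
    (htr : ∀ φ : K →+* ℂ, NumberField.ComplexEmbedding.IsReal φ) (δ : K)
    (hδ : ∀ σ : K →+* ℝ, 0 < σ δ) {W : Type*} [AddCommGroup W] [Module K W]
    [FiniteDimensional K W] (Q : QuadraticForm K W)
    (hQ : ∀ x, x ≠ 0 → ∀ σ : K →+* ℝ, 0 < σ (Q x)) :
    ∃ g : W → EuclideanSpace ℝ (Fin (Module.finrank ℚ K * Module.finrank K W)),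
      ∀ x y, ⟪g x, g y⟫_ℝ = (Algebra.trace ℚ K (δ * QuadraticMap.polar Q x y) : ℝ) := by
  let _ : Module ℚ W := Module.compHom W (algebraMap ℚ K)
  have : IsScalarTower ℚ K W := IsScalarTower.of_compHom ℚ K W
  have : FiniteDimensional ℚ W := FiniteDimensional.trans ℚ K W
  rw [Module.finrank_mul_finrank ℚ K W]
  have hsmul : ∀ (c : ℚ) (a : K),
      Algebra.trace ℚ K (δ * (algebraMap ℚ K c • a)) = c • Algebra.trace ℚ K (δ * a) := by
    intro c a
    rw [algebraMap_smul, mul_smul_comm, map_smul]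
  let B : LinearMap.BilinForm ℚ W := LinearMap.mk₂ ℚ
    (fun x y => Algebra.trace ℚ K (δ * QuadraticMap.polar Q x y))
    (fun x y z => by rw [QuadraticMap.polar_add_left, mul_add, map_add])
    (fun c x y => by rw [← algebraMap_smul K c x, QuadraticMap.polar_smul_left, hsmul])
    (fun x y z => by rw [QuadraticMap.polar_add_right, mul_add, map_add])
    (fun c x y => by rw [← algebraMap_smul K c y, QuadraticMap.polar_smul_right, hsmul])
  refine exists_euclidean_realization B ⟨fun x y => ?_⟩ fun x hx => ?_
  · simp [B, QuadraticMap.polar_comm Q x y]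
  · have h : QuadraticMap.polar Q x x = Q x + Q x := by
      rw [QuadraticMap.polar_self, two_smul]
    have := trace_pos_of_totally_positive htr (δ * Q x) fun σ => by
      rw [map_mul]; exact mul_pos (hδ σ) (hQ x hx σ)
    simp only [B, LinearMap.mk₂_apply, h, mul_add, map_add]
    linarith

open NumberField in
theorem exists_smul_mem_of_mem_span {K : Type*} [Field K] [NumberField K] {V : Type*}
    [AddCommGroup V] [Module K V] [Module (𝓞 K) V] [IsScalarTower (𝓞 K) K V]
    (L : Submodule (𝓞 K) V) {x : V} (hx : x ∈ Submodule.span K (L : Set V)) :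
    ∃ a : 𝓞 K, a ≠ 0 ∧ a • x ∈ L := by
  induction hx using Submodule.span_induction with
  | mem x hx => exact ⟨1, one_ne_zero, by simpa using hx⟩
  | zero => exact ⟨1, one_ne_zero, by simp⟩
  | add x y _ _ hx hy =>
    obtain ⟨a, ha, hax⟩ := hx
    obtain ⟨b, hb, hby⟩ := hy
    refine ⟨a * b, mul_ne_zero ha hb, ?_⟩
    rw [smul_add]
    refine L.add_mem ?_ ?_
    · rw [mul_comm, mul_smul]; exact L.smul_mem b hax
    · rw [mul_smul]; exact L.smul_mem a hby
  | smul c x _ hx =>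
    obtain ⟨a, ha, hax⟩ := hx
    obtain ⟨p, q, hq, rfl⟩ := IsFractionRing.div_surjective (A := 𝓞 K) c
    have hq0 : q ≠ 0 := nonZeroDivisors.ne_zero hq
    have hq0' : algebraMap (𝓞 K) K q ≠ 0 := by simpa using hq0
    refine ⟨q * a, mul_ne_zero hq0 ha, ?_⟩
    have : (q * a) • (algebraMap (𝓞 K) K p / algebraMap (𝓞 K) K q) • x = p • a • x := by
      rw [← algebraMap_smul K (q * a), ← algebraMap_smul K p, ← algebraMap_smul K a, smul_smul,
        smul_smul, map_mul]
      congr 1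
      field_simp
    rw [this]
    exact L.smul_mem p hax

open NumberField in
/-- Representing the trace-one elements `β i` by a lattice gives vectors of norm two in a
Euclidean space of dimension `d * r` whose other inner products are traces of polar forms and
lie strictly between `-2` and `2`. -/
theorem exists_euclidean_of_trace_one {K : Type*} [Field K] [NumberField K]
    (htr : ∀ φ : K →+* ℂ, NumberField.ComplexEmbedding.IsReal φ)
    {u : ℕ} {β : Fin u → 𝓞 K} (hβinj : Function.Injective β)
    (hβpos : ∀ i, ∀ σ : K →+* ℝ, 0 < σ ((β i : 𝓞 K) : K))
    {δ : K} (hδpos : ∀ σ : K →+* ℝ, 0 < σ δ)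
    (hδβ : ∀ i, Algebra.trace ℚ K (δ * ((β i : 𝓞 K) : K)) = 1)
    {V : Type*} [AddCommGroup V] [Module K V] [FiniteDimensional K V]
    [Module (𝓞 K) V] [IsScalarTower (𝓞 K) K V] (L : Submodule (𝓞 K) V)
    (Q : QuadraticForm K V) (hQpos : ∀ x ∈ L, x ≠ 0 → ∀ σ : K →+* ℝ, 0 < σ (Q x))
    (huniv : ∀ α : 𝓞 K, (∀ σ : K →+* ℝ, 0 < σ (α : K)) → ∃ x ∈ L, Q x = (α : K)) :
    ∃ (x : Fin u → V) (y : Fin u → EuclideanSpace ℝ (Fin (Module.finrank ℚ K *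
        Module.finrank K (Submodule.span K (L : Set V))))),
      (∀ i, x i ∈ L) ∧
      (∀ i j, ⟪y i, y j⟫_ℝ = (Algebra.trace ℚ K (δ * QuadraticMap.polar Q (x i) (x j)) : ℝ)) ∧
      (∀ i, ⟪y i, y i⟫_ℝ = 2) ∧
      ∀ i j, i ≠ j → -2 < ⟪y i, y j⟫_ℝ ∧ ⟪y i, y j⟫_ℝ < 2 := by
  choose x hxL hxQ using fun i => huniv (β i) (hβpos i)
  have hspan : ∀ w ∈ Submodule.span K (L : Set V), w ≠ 0 → ∀ σ : K →+* ℝ, 0 < σ (Q w) := by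
    intro w hw hw0 σ
    obtain ⟨a, ha, haw⟩ := exists_smul_mem_of_mem_span L hw
    have ha' : algebraMap (𝓞 K) K a ≠ 0 := by simpa using ha
    rw [← algebraMap_smul K a w] at haw
    have h := hQpos _ haw (smul_ne_zero ha' hw0) σ
    rw [QuadraticMap.map_smul, smul_eq_mul, map_mul, map_mul] at h
    exact pos_of_mul_pos_right h (mul_self_nonneg _)
  obtain ⟨g, hg⟩ := exists_euclidean_realization_trace_polar htr δ hδpos
    (Q.comp (Submodule.span K (L : Set V)).subtype) fun w hw =>
      hspan w w.2 (by simpa using hw)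
  have hin : ∀ i j, ⟪g ⟨x i, Submodule.subset_span (hxL i)⟩,
      g ⟨x j, Submodule.subset_span (hxL j)⟩⟫_ℝ
        = (Algebra.trace ℚ K (δ * QuadraticMap.polar Q (x i) (x j)) : ℝ) :=
    fun i j => hg _ _
  refine ⟨x, fun i => g ⟨x i, Submodule.subset_span (hxL i)⟩, hxL, hin, fun i => ?_,
    fun i j hij => ?_⟩
  · rw [hin, QuadraticMap.polar_self, two_smul, mul_add, map_add, hxQ, hδβ]
    norm_num
  · have hne : β i ≠ β j := fun h => hij (hβinj h)
    have htpos : ∀ w ∈ L, w ≠ 0 → 0 < Algebra.trace ℚ K (δ * Q w) := fun w hw hw0 =>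
      trace_pos_of_totally_positive htr _ fun σ => by
        rw [map_mul]; exact mul_pos (hδpos σ) (hQpos w hw hw0 σ)
    have hadd := htpos (x i + x j) (L.add_mem (hxL i) (hxL j)) fun h => hne <| by
      apply RingOfIntegers.ext
      rw [← hxQ i, ← hxQ j, eq_neg_of_add_eq_zero_left h, QuadraticMap.map_neg]
    have hsub := htpos (x i - x j) (L.sub_mem (hxL i) (hxL j)) fun h => hne <| by
      apply RingOfIntegers.ext
      rw [← hxQ i, ← hxQ j, sub_eq_zero.1 h]
    have e1 : Q (x i + x j) = Q (x i) + Q (x j) + QuadraticMap.polar Q (x i) (x j) := by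
      rw [QuadraticMap.polar]; ring
    have e2 : Q (x i - x j) = Q (x i) + Q (x j) - QuadraticMap.polar Q (x i) (x j) := by
      have h := QuadraticMap.polar_neg_right Q (x i) (x j)
      rw [QuadraticMap.polar, ← sub_eq_add_neg, QuadraticMap.map_neg] at h
      linear_combination h
    rw [e1, mul_add, mul_add, map_add, map_add, hxQ, hxQ, hδβ, hδβ] at hadd
    rw [e2, mul_sub, mul_add, map_sub, map_add, hxQ, hxQ, hδβ, hδβ] at hsub
    rw [hin]
    constructor
    · exact_mod_cast (by linarith : (-2 : ℚ) < _)
    · exact_mod_cast (by linarith : _ < (2 : ℚ))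


open NumberField

/-- Let `K` be a totally real number field of degree `d`.  Suppose there are
pairwise distinct totally positive `β 0, …, β (u-1) ∈ 𝓞 K` and a totally positive
element `δ` of the codifferent of `K` with `Tr(δ·β i) = 1` for all `i`.  Then every
classical universal quadratic `𝓞 K`-lattice has rank `≥ u / d`, and (provided
`u ≥ 240`) every universal quadratic `𝓞 K`-lattice has rank `≥ √u / d`. -/
theorem rank_lower_bound_from_trace_one_elements
    (K : Type) [Field K] [NumberField K]
    (htr : ∀ φ : K →+* ℂ, NumberField.ComplexEmbedding.IsReal φ)
    (u : ℕ) (β : Fin u → 𝓞 K) (hβinj : Function.Injective β)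
    (hβpos : ∀ i, ∀ σ : K →+* ℝ, 0 < σ ((β i : 𝓞 K) : K))
    (δ : K)
    (hδcodiff : ∀ α : 𝓞 K, ∃ n : ℤ, Algebra.trace ℚ K (δ * (α : K)) = (n : ℚ))
    (hδpos : ∀ σ : K →+* ℝ, 0 < σ δ)
    (hδβ : ∀ i, Algebra.trace ℚ K (δ * ((β i : 𝓞 K) : K)) = 1) :
    (∀ (V : Type) [AddCommGroup V] [Module K V] [FiniteDimensional K V]
      [Module (𝓞 K) V] [IsScalarTower (𝓞 K) K V]
      (L : Submodule (𝓞 K) V), L.FG →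
      ∀ Q : QuadraticForm K V,
        (∀ x ∈ L, IsIntegral ℤ (Q x)) →
        (∀ x ∈ L, ∀ y ∈ L, IsIntegral ℤ ((Q (x + y) - Q x - Q y) / 2)) →
        (∀ x ∈ L, x ≠ 0 → ∀ σ : K →+* ℝ, 0 < σ (Q x)) →
        (∀ α : 𝓞 K, (∀ σ : K →+* ℝ, 0 < σ (α : K)) → ∃ x ∈ L, Q x = (α : K)) →
        (u : ℝ) / (Module.finrank ℚ K : ℝ) ≤
          (Module.finrank K (Submodule.span K (L : Set V)) : ℝ)) ∧
    (240 ≤ u →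
      ∀ (V : Type) [AddCommGroup V] [Module K V] [FiniteDimensional K V]
        [Module (𝓞 K) V] [IsScalarTower (𝓞 K) K V]
        (L : Submodule (𝓞 K) V), L.FG →
        ∀ Q : QuadraticForm K V,
          (∀ x ∈ L, IsIntegral ℤ (Q x)) →
          (∀ x ∈ L, x ≠ 0 → ∀ σ : K →+* ℝ, 0 < σ (Q x)) →
          (∀ α : 𝓞 K, (∀ σ : K →+* ℝ, 0 < σ (α : K)) → ∃ x ∈ L, Q x = (α : K)) →
          Real.sqrt (u : ℝ) / (Module.finrank ℚ K : ℝ) ≤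
            (Module.finrank K (Submodule.span K (L : Set V)) : ℝ)) := by
  have hd : (0 : ℝ) < Module.finrank ℚ K := by exact_mod_cast Module.finrank_pos
  have hint : ∀ a : K, IsIntegral ℤ a → ∃ n : ℤ, Algebra.trace ℚ K (δ * a) = n := fun a ha =>
    hδcodiff ⟨a, ha⟩
  refine ⟨?_, fun hu => ?_⟩
  · intro V _ _ _ _ _ L _ Q _ hcl hQpos huniv
    obtain ⟨x, y, hxL, hin, hy2, hlt⟩ :=
      exists_euclidean_of_trace_one htr hβinj hβpos hδpos hδβ L Q hQpos huniv
    have horth : ∀ i j, i ≠ j → ⟪y i, y j⟫_ℝ = 0 := by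
      intro i j hij
      obtain ⟨n, hn⟩ := hint _ (hcl (x i) (hxL i) (x j) (hxL j))
      have h2 : ⟪y i, y j⟫_ℝ = 2 * (n : ℝ) := by
        rw [hin]
        have : Algebra.trace ℚ K (δ * QuadraticMap.polar Q (x i) (x j)) = 2 * n := by
          have e : δ * QuadraticMap.polar Q (x i) (x j)
              = δ * ((Q (x i + x j) - Q (x i) - Q (x j)) / 2)
                + δ * ((Q (x i + x j) - Q (x i) - Q (x j)) / 2) := by
            rw [QuadraticMap.polar]; ring
          rw [e, map_add, hn]; ring
        rw [this]; push_cast; ring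
      obtain ⟨h3, h4⟩ := hlt i j hij
      rw [h2] at h3 h4 ⊢
      have h5 : -1 < n := by exact_mod_cast (by linarith : (-1 : ℝ) < n)
      have h6 : n < 1 := by exact_mod_cast (by linarith : (n : ℝ) < 1)
      obtain rfl : n = 0 := by omega
      simp
    have hli := linearIndependent_of_ne_zero_of_inner_eq_zero (𝕜 := ℝ) (v := y)
      (fun i h => by simpa [h] using hy2 i) (fun i j hij => horth i j hij)
    have hcard := hli.fintype_card_le_finrank
    rw [finrank_euclideanSpace_fin, Fintype.card_fin] at hcard
    rw [div_le_iff₀' hd]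
    exact_mod_cast hcard
  · intro V _ _ _ _ _ L _ Q hQint hQpos huniv
    obtain ⟨x, y, hxL, hin, hy2, hlt⟩ :=
      exists_euclidean_of_trace_one htr hβinj hβpos hδpos hδβ L Q hQpos huniv
    have hroot := card_le_of_root_lines y hy2 fun i j hij => by
      obtain ⟨n, hn⟩ := hint (QuadraticMap.polar Q (x i) (x j))
        (((hQint _ (L.add_mem (hxL i) (hxL j))).sub (hQint _ (hxL i))).sub (hQint _ (hxL j)))
      obtain ⟨h3, h4⟩ := hlt i j hij
      rw [hin, hn] at h3 h4 ⊢
      have h5 : -2 < n := by exact_mod_cast h3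
      have h6 : n < 2 := by exact_mod_cast h4
      obtain rfl | rfl | rfl : n = 0 ∨ n = 1 ∨ n = -1 := by omega
      all_goals simp
    rw [finrank_euclideanSpace_fin] at hroot
    rw [div_le_iff₀' hd]
    refine Real.sqrt_le_iff.2 ⟨by positivity, ?_⟩
    exact_mod_cast hroot.resolve_left (by omega)
end

section
/- Let K be a totally real number field such that every totally positive element of O_K is a sum of squares of elements of O_K. Then K = ℚ or K = ℚ(√5). -/
open NumberField
open Module

theorem forall_eq_one_of_one_le_prod {ι : Type*} [Fintype ι] {x : ι → ℝ} (hx : ∀ i, 0 < x i)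
    (hprod : 1 ≤ ∏ i, x i) (hsum : ∑ i, x i ≤ Fintype.card ι) (i : ι) : x i = 1 := by
  by_contra hi
  have hlog : 0 ≤ ∑ i, Real.log (x i) := by
    rw [← Real.log_prod fun i _ => (hx i).ne']
    exact Real.log_nonneg hprod
  have hlt : ∑ i, Real.log (x i) < ∑ i, (x i - 1) :=
    Finset.sum_lt_sum (fun i _ => Real.log_le_sub_one_of_pos (hx i))
      ⟨i, Finset.mem_univ i, Real.log_lt_sub_one_of_pos (hx i) hi⟩
  rw [Finset.sum_sub_distrib] at hlt
  simp only [Finset.sum_const, Finset.card_univ, nsmul_eq_mul, mul_one] at hlt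
  linarith

theorem card_le_sum_of_one_le_prod {ι : Type*} [Fintype ι] {x : ι → ℝ} (hx : ∀ i, 0 < x i)
    (hprod : 1 ≤ ∏ i, x i) : (Fintype.card ι : ℝ) ≤ ∑ i, x i := by
  by_contra! h
  have h1 := forall_eq_one_of_one_le_prod hx hprod h.le
  simp [h1] at h

theorem Algebra.norm_eq_of_minpoly_eq {F K : Type*} [Field F] [Field K] [Algebra F K]
    [FiniteDimensional F K] {x y : K} (h : minpoly F x = minpoly F y) :
    Algebra.norm F x = Algebra.norm F y := by
  have hdeg (z : K) : (minpoly F z).natDegree * finrank (IntermediateField.adjoin F {z}) K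
      = finrank F K := by
    rw [← IntermediateField.adjoin.finrank (Algebra.IsIntegral.isIntegral z), finrank_mul_finrank]
  have hpos : 0 < (minpoly F y).natDegree := minpoly.natDegree_pos (Algebra.IsIntegral.isIntegral y)
  have hfin : finrank (IntermediateField.adjoin F {x}) K
      = finrank (IntermediateField.adjoin F {y}) K := by
    refine Nat.eq_of_mul_eq_mul_left hpos ?_
    rw [hdeg y, ← h, hdeg x]
  apply FaithfulSMul.algebraMap_injective F (AlgebraicClosure F)
  rw [Algebra.norm_eq_prod_roots (K := F) (F := AlgebraicClosure F) (IsAlgClosed.splits _),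
    Algebra.norm_eq_prod_roots (K := F) (F := AlgebraicClosure F) (IsAlgClosed.splits _), h, hfin]

open Polynomial in
theorem minpoly_eq_of_sq_add_self {F K : Type*} [Field F] [Field K] [Algebra F K]
    {u : K} {θ : F} (hu : u ∉ (algebraMap F K).range) (hθ : u ^ 2 + u = algebraMap F K θ) :
    minpoly F u = X ^ 2 + X - C θ := by
  have hmonic : (X ^ 2 + X - C θ : F[X]).Monic := by monicity!
  have hdeg : (X ^ 2 + X - C θ : F[X]).natDegree = 2 := by compute_degree!
  have hroot : aeval u (X ^ 2 + X - C θ : F[X]) = 0 := by simp [hθ]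
  have hint : IsIntegral F u := ⟨_, hmonic, by simpa [aeval_def] using hroot⟩
  refine (eq_of_monic_of_dvd_of_natDegree_le (minpoly.monic hint) hmonic
    (minpoly.dvd F u hroot) ?_).symm
  rw [hdeg]
  exact (minpoly.two_le_natDegree_iff hint).2 hu

open Polynomial in
theorem norm_aeval_conj (F : Type*) {K : Type*} [Field F] [Field K] [CharZero K] [Algebra ℚ F]
    [Algebra F K] [FiniteDimensional ℚ K] [IsScalarTower ℚ F K]
    {u : K} {θ : F} (hu : u ∉ (algebraMap F K).range) (hθ : u ^ 2 + u = algebraMap F K θ)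
    (q : F[X]) : Algebra.norm ℚ (aeval u q) = Algebra.norm ℚ (aeval (-1 - u) q) := by
  have : FiniteDimensional F K := FiniteDimensional.right ℚ F K
  have : FiniteDimensional ℚ F := FiniteDimensional.left ℚ F K
  have hconj : aeval (-1 - u) (minpoly F u) = 0 := by
    rw [minpoly_eq_of_sq_add_self hu hθ]
    simp only [map_add, map_sub, map_pow, aeval_X, aeval_C, ← hθ]
    ring
  rw [← Algebra.norm_norm (S := F), ← Algebra.norm_norm (S := F) (a := aeval (-1 - u) q)]
  congr 1
  apply Algebra.norm_eq_of_minpoly_eq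
  have hint : IsIntegral F (aeval u q) := Algebra.IsIntegral.isIntegral _
  refine minpoly.eq_of_irreducible_of_monic (minpoly.irreducible hint) ?_ (minpoly.monic hint)
  have hdvd : minpoly F u ∣ (minpoly F (aeval u q)).comp q :=
    minpoly.dvd F u (by rw [aeval_comp, minpoly.aeval])
  rw [← aeval_comp]
  exact aeval_eq_zero_of_dvd_aeval_eq_zero hdvd hconj

section
variable {K : Type*} [Field K] [NumberField K]

/-- The product of the real embeddings. -/
noncomputable def prodEmb (K : Type*) [Field K] [NumberField K] : K →* ℝ where
  toFun x := ∏ σ : K →+* ℝ, σ x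
  map_one' := by simp
  map_mul' x y := by simp [Finset.prod_mul_distrib]

theorem prodEmb_apply (x : K) : prodEmb K x = ∏ σ : K →+* ℝ, σ x := rfl

/-- The real embeddings of a totally real field, seen as its complex embeddings. -/
noncomputable def realEmbEquiv (K : Type*) [Field K] [NumberField K] [IsTotallyReal K] :
    (K →+* ℝ) ≃ (K →+* ℂ) :=
  Equiv.ofBijective (fun σ => Complex.ofRealHom.comp σ) (by
    refine ⟨fun σ τ h => RingHom.ext fun x => ?_, fun φ => ?_⟩
    · exact Complex.ofReal_injective (RingHom.congr_fun h x)
    · exact ⟨(IsTotallyReal.complexEmbedding_isReal φ).embedding, RingHom.ext fun x => by simp⟩)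

theorem card_realEmb [IsTotallyReal K] : Fintype.card (K →+* ℝ) = finrank ℚ K := by
  rw [Fintype.card_congr (realEmbEquiv K), Embeddings.card]

instance [IsTotallyReal K] : Nonempty (K →+* ℝ) := ⟨(realEmbEquiv K).symm (Classical.arbitrary _)⟩

theorem prodEmb_eq_norm [IsTotallyReal K] (x : K) : prodEmb K x = (Algebra.norm ℚ x : ℚ) := by
  apply Complex.ofReal_injective
  have h := Algebra.norm_eq_prod_embeddings ℚ ℂ x
  simp only [eq_ratCast] at h
  rw [prodEmb_apply, Complex.ofReal_ratCast, h, Complex.ofReal_prod]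
  exact Fintype.prod_equiv ((realEmbEquiv K).trans (RingHom.equivRatAlgHom K ℂ)) _ _ fun σ => rfl

theorem exists_int_prodEmb [IsTotallyReal K] (x : 𝓞 K) :
    ∃ m : ℤ, prodEmb K (algebraMap (𝓞 K) K x) = m :=
  ⟨Algebra.norm ℤ x, by rw [prodEmb_eq_norm, ← Algebra.coe_norm_int]; simp⟩

theorem one_le_abs_prodEmb [IsTotallyReal K] {x : 𝓞 K} (hx : x ≠ 0) :
    1 ≤ |prodEmb K (algebraMap (𝓞 K) K x)| := by
  obtain ⟨m, hm⟩ := exists_int_prodEmb x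
  have h0 : prodEmb K (algebraMap (𝓞 K) K x) ≠ 0 := by
    rw [prodEmb_apply, Finset.prod_ne_zero_iff]
    intro σ _
    simpa using hx
  rw [hm] at h0 ⊢
  exact_mod_cast Int.one_le_abs (by exact_mod_cast h0)

theorem isUnit_iff_abs_prodEmb [IsTotallyReal K] (x : 𝓞 K) :
    IsUnit x ↔ |prodEmb K (algebraMap (𝓞 K) K x)| = 1 := by
  rw [isUnit_iff_norm, prodEmb_eq_norm, RingOfIntegers.coe_norm]
  norm_cast

theorem abs_prodEmb_unit [IsTotallyReal K] (u : (𝓞 K)ˣ) : |prodEmb K (algebraMap (𝓞 K) K u)| = 1 :=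
  (isUnit_iff_abs_prodEmb _).1 u.isUnit

end

section
variable {K : Type*} [Field K]

/-- Positivity under all real embeddings. -/
def TotPos (x : K) : Prop := ∀ σ : K →+* ℝ, 0 < σ x

theorem TotPos.mul {x y : K} (hx : TotPos x) (hy : TotPos y) : TotPos (x * y) := fun σ => by
  rw [map_mul]; exact mul_pos (hx σ) (hy σ)

theorem TotPos.add {x y : K} (hx : TotPos x) (hy : TotPos y) : TotPos (x + y) := fun σ => by
  rw [map_add]; exact add_pos (hx σ) (hy σ)

theorem totPos_sq {x : K} (hx : x ≠ 0) : TotPos (x ^ 2) := fun σ => by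
  rw [map_pow]
  exact sq_pos_of_ne_zero ((map_ne_zero σ).2 hx)

theorem totPos_mul_of_signs_eq {x y : K} (hx : x ≠ 0) (hy : y ≠ 0)
    (h : ∀ σ : K →+* ℝ, 0 < σ x ↔ 0 < σ y) : TotPos (x * y) := fun σ => by
  rw [map_mul]
  have h1 := h σ
  rcases lt_or_gt_of_ne ((map_ne_zero σ).2 hx) with hx' | hx' <;>
  rcases lt_or_gt_of_ne ((map_ne_zero σ).2 hy) with hy' | hy'
  · exact mul_pos_of_neg_of_neg hx' hy'
  · linarith [h1.2 hy']
  · linarith [h1.1 hx']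
  · exact mul_pos hx' hy'

theorem coe_unit_ne_zero (u : (𝓞 K)ˣ) : (u : K) ≠ 0 := by simp

variable [NumberField K]

theorem TotPos.prodEmb_pos {x : K} (hx : TotPos x) : 0 < prodEmb K x :=
  Finset.prod_pos fun σ _ => hx σ

theorem card_infinitePlace [IsTotallyReal K] :
    Units.rank K + 1 = Fintype.card (K →+* ℝ) := by
  have h1 : 0 < Fintype.card (InfinitePlace K) := Fintype.card_pos
  have h2 := InfinitePlace.card_eq_nrRealPlaces_add_nrComplexPlaces K
  rw [IsTotallyReal.nrComplexPlaces_eq_zero, ← IsTotallyReal.finrank] at h2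
  rw [card_realEmb, Units.rank]
  omega

/-- The unit with sign `b` and exponents `e` in a fundamental system. -/
noncomputable def signedUnit (K : Type*) [Field K] [NumberField K]
    (p : Bool × (Fin (Units.rank K) → Bool)) : (𝓞 K)ˣ :=
  (if p.1 then -1 else 1) * ∏ i, Units.fundSystem K i ^ (if p.2 i then 1 else 0 : ℤ)

theorem exists_sq_exponents (z : (𝓞 K)ˣ) : ∃ (ζ : Units.torsion K) (k : Fin (Units.rank K) → ℤ),
    z ^ 2 = ((ζ ^ 2 : Units.torsion K) : (𝓞 K)ˣ) * ∏ i, Units.fundSystem K i ^ (2 * k i) := by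
  obtain ⟨⟨ζ, k⟩, h, -⟩ := Units.exist_unique_eq_mul_prod K z
  refine ⟨ζ, k, ?_⟩
  rw [h, mul_pow, ← Finset.prod_pow]
  simp only [← zpow_natCast, ← zpow_mul, SubgroupClass.coe_zpow]
  simp [mul_comm]

/-- The signs of a unit under the real embeddings. -/
noncomputable def unitSigns (K : Type*) [Field K] [NumberField K]
    (u : (𝓞 K)ˣ) (σ : K →+* ℝ) : Bool := decide (0 < σ (u : K))

theorem signedUnit_injective [IsTotallyReal K]
    (hU : ∀ u : (𝓞 K)ˣ, TotPos (u : K) → ∃ z, u = z ^ 2) :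
    Function.Injective fun p => unitSigns K (signedUnit K p) := by
  rintro p q hpq
  have hpos : TotPos ((signedUnit K p * signedUnit K q : (𝓞 K)ˣ) : K) := by
    have := totPos_mul_of_signs_eq (coe_unit_ne_zero (signedUnit K p))
      (coe_unit_ne_zero (signedUnit K q)) fun σ => by
        simpa [unitSigns] using congr_fun hpq σ
    simpa using this
  have hprod : signedUnit K p * signedUnit K q =
      ((if p.1 then -1 else 1) * (if q.1 then -1 else 1)) * ∏ i, Units.fundSystem K i ^
        ((if p.2 i then 1 else 0) + (if q.2 i then 1 else 0) : ℤ) := by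
    simp only [zpow_add, Finset.prod_mul_distrib, signedUnit]
    exact mul_mul_mul_comm _ _ _ _
  obtain ⟨z, hz⟩ := hU _ hpos
  obtain ⟨ζ, k, hk⟩ := exists_sq_exponents z
  let ν : Units.torsion K := ⟨-1, neg_one_mem_torsion⟩
  have huniq := (Units.exist_unique_eq_mul_prod K (z ^ 2)).unique (y₁ := (ζ ^ 2, fun i => 2 * k i))
    (y₂ := ((if p.1 then ν else 1) * (if q.1 then ν else 1),
      fun i => (if p.2 i then 1 else 0) + (if q.2 i then 1 else 0))) hk (by
      rw [← hz, hprod]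
      congr 1
      cases p.1 <;> cases q.1 <;> simp [ν])
  have he (i) : 2 * k i = (if p.2 i then 1 else 0) + (if q.2 i then 1 else 0) :=
    congr_fun (congr_arg Prod.snd huniq) i
  have h2 : p.2 = q.2 := by
    funext i
    have := he i
    revert this
    cases p.2 i <;> cases q.2 i <;> simp <;> omega
  have h1 : p.1 = q.1 := by
    by_contra hne
    have hneg : signedUnit K p * signedUnit K q =
        -(∏ i, Units.fundSystem K i ^ (if p.2 i then 1 else 0 : ℤ)) ^ 2 := by
      rw [hprod, ← h2]
      simp only [zpow_add, Finset.prod_mul_distrib]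
      revert hne
      cases p.1 <;> cases q.1 <;> simp [sq]
    obtain ⟨σ⟩ := (inferInstance : Nonempty (K →+* ℝ))
    have := hpos σ
    rw [hneg] at this
    simp only [Units.val_neg, Units.val_pow_eq_pow_val, map_neg, map_pow] at this
    nlinarith [sq_nonneg (σ ((∏ i, Units.fundSystem K i ^ (if p.2 i then 1 else 0 : ℤ) :
      (𝓞 K)ˣ) : K))]
  exact Prod.ext h1 h2

open scoped Classical in
theorem exists_unit_mul_totPos [IsTotallyReal K]
    (hU : ∀ u : (𝓞 K)ˣ, TotPos (u : K) → ∃ z, u = z ^ 2) {x : K} (hx : x ≠ 0) :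
    ∃ u : (𝓞 K)ˣ, TotPos (u * x) := by
  have hcard : Fintype.card (Bool × (Fin (Units.rank K) → Bool)) =
      Fintype.card ((K →+* ℝ) → Bool) := by
    simp [← card_infinitePlace, pow_succ']
  obtain ⟨p, hp⟩ := ((Fintype.bijective_iff_injective_and_card _).2
    ⟨signedUnit_injective hU, hcard⟩).surjective fun σ => decide (0 < σ x)
  exact ⟨signedUnit K p, totPos_mul_of_signs_eq (coe_unit_ne_zero _) hx fun σ => by
    simpa [unitSigns] using congr_fun hp σ⟩
/-- Totally positive integers that are not a sum of two totally positive integers. -/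
def IsIndec (α : 𝓞 K) : Prop :=
  TotPos (algebraMap (𝓞 K) K α) ∧
    ∀ β γ : 𝓞 K, TotPos (algebraMap (𝓞 K) K β) → TotPos (algebraMap (𝓞 K) K γ) → α ≠ β + γ

/-- Every totally positive integer is a sum of squares. -/
def SumSq (K : Type*) [Field K] [NumberField K] : Prop :=
  ∀ α : 𝓞 K, TotPos (algebraMap (𝓞 K) K α) → ∃ (n : ℕ) (f : Fin n → 𝓞 K), α = ∑ i, f i ^ 2

omit [NumberField K] in
theorem sum_sq_eq_zero_or_totPos {ι : Type*} (s : Finset ι) (f : ι → 𝓞 K) :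
    ∑ i ∈ s, f i ^ 2 = 0 ∨ TotPos (algebraMap (𝓞 K) K (∑ i ∈ s, f i ^ 2)) := by
  classical
  induction s using Finset.induction_on with
  | empty => simp
  | insert a s ha ih =>
    rw [Finset.sum_insert ha]
    by_cases h0 : f a = 0
    · simpa [h0] using ih
    · have h1 : TotPos (algebraMap (𝓞 K) K (f a ^ 2)) := by
        rw [map_pow]
        exact totPos_sq (by simpa using h0)
      rcases ih with h | h
      · right; rwa [h, add_zero]
      · right; rw [map_add]; exact h1.add h

theorem TotPos.ne_zero [IsTotallyReal K] {x : K} (hx : TotPos x) : x ≠ 0 := by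
  rintro rfl
  obtain ⟨σ⟩ := (inferInstance : Nonempty (K →+* ℝ))
  simpa using hx σ

theorem TotPos.one_le_prodEmb [IsTotallyReal K] {x : 𝓞 K} (hx : TotPos (algebraMap (𝓞 K) K x)) :
    1 ≤ prodEmb K (algebraMap (𝓞 K) K x) := by
  rw [← abs_of_pos hx.prodEmb_pos]
  exact one_le_abs_prodEmb (by simpa using hx.ne_zero)

theorem TotPos.prodEmb_add_le [IsTotallyReal K] {x y : K} (hx : TotPos x) (hy : TotPos y) :
    prodEmb K x + prodEmb K y ≤ prodEmb K (x + y) := by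
  obtain ⟨σ⟩ := (inferInstance : Nonempty (K →+* ℝ))
  exact Finset.prod_add_prod_le (Finset.mem_univ σ) (map_add σ x y).ge
    (fun τ _ _ => by simpa using (hy τ).le) (fun τ _ _ => by simpa using (hx τ).le)
    (fun τ _ => (hx τ).le) fun τ _ => (hy τ).le

theorem IsIndec.exists_sq [IsTotallyReal K] (H : SumSq K) {α : 𝓞 K} (hα : IsIndec α) :
    ∃ β, α = β ^ 2 := by
  obtain ⟨n, f, hf⟩ := H α hα.1
  have h0 : ∑ i, f i ^ 2 ≠ 0 := by
    rw [← hf]; simpa using hα.1.ne_zero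
  obtain ⟨j, hj, hj0⟩ := Finset.exists_ne_zero_of_sum_ne_zero h0
  rw [← Finset.add_sum_erase _ _ hj] at hf
  rcases sum_sq_eq_zero_or_totPos (Finset.univ.erase j) f with h | h
  · exact ⟨f j, by rw [hf, h, add_zero]⟩
  · refine (hα.2 _ _ ?_ h hf).elim
    rw [map_pow]
    refine totPos_sq ?_
    rintro h
    exact hj0 (by simpa using h)

theorem isIndec_of_prodEmb_eq_one [IsTotallyReal K] {α : 𝓞 K} (hα : TotPos (algebraMap (𝓞 K) K α))
    (h1 : prodEmb K (algebraMap (𝓞 K) K α) = 1) : IsIndec α := by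
  refine ⟨hα, ?_⟩
  rintro β γ hβ hγ rfl
  rw [map_add] at h1
  linarith [hβ.prodEmb_add_le hγ, hβ.one_le_prodEmb, hγ.one_le_prodEmb]

theorem exists_unit_sq_of_totPos [IsTotallyReal K] (H : SumSq K) (u : (𝓞 K)ˣ)
    (hu : TotPos (algebraMap (𝓞 K) K u)) : ∃ z, u = z ^ 2 := by
  have h1 := abs_prodEmb_unit u
  rw [abs_of_pos hu.prodEmb_pos] at h1
  obtain ⟨β, hβ⟩ := (isIndec_of_prodEmb_eq_one hu h1).exists_sq H
  have hunit : IsUnit β := by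
    have := u.isUnit
    rw [hβ] at this
    exact (isUnit_pow_iff two_ne_zero).1 this
  exact ⟨hunit.unit, Units.ext (by simpa using hβ)⟩

theorem IsIndec.prodEmb_eq_one [IsTotallyReal K] (H : SumSq K) (m : ℕ) :
    ∀ α : 𝓞 K, IsIndec α → prodEmb K (algebraMap (𝓞 K) K α) ≤ m →
      prodEmb K (algebraMap (𝓞 K) K α) = 1 := by
  induction m with
  | zero =>
    intro α hα hm
    have := hα.1.one_le_prodEmb
    norm_num at hm
    linarith
  | succ m ih =>
    intro α hα hm
    obtain ⟨β, rfl⟩ := hα.exists_sq H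
    have hβ : β ≠ 0 := by
      rintro rfl
      simpa using hα.1.ne_zero
    obtain ⟨u, hu⟩ := exists_unit_mul_totPos (exists_unit_sq_of_totPos H)
      (x := (algebraMap (𝓞 K) K β)) (by simpa using hβ)
    rw [← map_mul] at hu
    have hγ : IsIndec ((u : 𝓞 K) * β) := by
      refine ⟨hu, fun a b ha hb hab => ?_⟩
      have hw : TotPos (algebraMap (𝓞 K) K ((u⁻¹ : (𝓞 K)ˣ) ^ 2)) := by
        rw [map_pow]; exact totPos_sq (coe_unit_ne_zero _)
      refine hα.2 ((u⁻¹ : (𝓞 K)ˣ) ^ 2 * (a * a)) ((u⁻¹ : (𝓞 K)ˣ) ^ 2 * (a * b + (a * b + b * b)))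
        ?_ ?_ ?_
      · rw [map_mul, map_mul]
        exact hw.mul (ha.mul ha)
      · simp only [map_mul, map_add]
        rw [map_pow] at hw ⊢
        exact hw.mul ((ha.mul hb).add ((ha.mul hb).add (hb.mul hb)))
      · have h1 : β = (u⁻¹ : (𝓞 K)ˣ) * (a + b) := by rw [← hab, Units.inv_mul_cancel_left]
        rw [h1]; ring
    have hsq : prodEmb K (algebraMap (𝓞 K) K (β ^ 2)) =
        prodEmb K (algebraMap (𝓞 K) K ((u : 𝓞 K) * β)) ^ 2 := by
      rw [map_pow, map_mul, map_pow, map_mul, mul_pow, ← sq_abs (prodEmb K (algebraMap (𝓞 K) K u)),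
        abs_prodEmb_unit, one_pow, one_mul]
    have h1 := hu.one_le_prodEmb
    obtain ⟨g, hg⟩ := exists_int_prodEmb ((u : 𝓞 K) * β)
    rw [hsq] at hm ⊢
    rcases eq_or_ne (prodEmb K (algebraMap (𝓞 K) K ((u : 𝓞 K) * β))) 1 with h | h
    · rw [h, one_pow]
    · rw [ih _ hγ ?_, one_pow]
      rw [hg] at h1 h hm ⊢
      norm_cast at h1 h hm ⊢
      have : 1 < g := lt_of_le_of_ne h1 (Ne.symm h)
      push_cast at hm
      nlinarith

theorem exists_unit_sq_sum [IsTotallyReal K] (H : SumSq K) (m : ℕ) :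
    ∀ α : 𝓞 K, TotPos (algebraMap (𝓞 K) K α) → prodEmb K (algebraMap (𝓞 K) K α) ≤ m →
      ∃ s : Multiset (𝓞 K)ˣ, (s.map fun v : (𝓞 K)ˣ => algebraMap (𝓞 K) K v ^ 2).sum =
        algebraMap (𝓞 K) K α := by
  induction m with
  | zero =>
    intro α hα hm
    have := hα.one_le_prodEmb
    norm_num at hm
    linarith
  | succ m ih =>
    intro α hα hm
    by_cases hi : IsIndec α
    · have h1 := hi.prodEmb_eq_one H _ _ hm
      obtain ⟨u, rfl⟩ := (isUnit_iff_abs_prodEmb α).2 (by rw [h1, abs_one])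
      obtain ⟨z, rfl⟩ := exists_unit_sq_of_totPos H u hα
      exact ⟨{z}, by simp⟩
    · simp only [IsIndec, not_and, not_forall, not_not] at hi
      obtain ⟨β, γ, hβ, hγ, rfl⟩ := hi hα
      rw [map_add] at hm
      have h1 := hβ.prodEmb_add_le hγ
      have h2 := hβ.one_le_prodEmb
      have h3 := hγ.one_le_prodEmb
      push_cast at hm
      obtain ⟨s, hs⟩ := ih β hβ (by linarith)
      obtain ⟨t, ht⟩ := ih γ hγ (by linarith)
      exact ⟨s + t, by simp [hs, ht]⟩

theorem TotPos.exists_unit_sq_sum [IsTotallyReal K] (H : SumSq K) {α : 𝓞 K}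
    (hα : TotPos (algebraMap (𝓞 K) K α)) :
    ∃ s : Multiset (𝓞 K)ˣ, (s.map fun v : (𝓞 K)ˣ => algebraMap (𝓞 K) K v ^ 2).sum =
        algebraMap (𝓞 K) K α :=
  let ⟨m, hm⟩ := exists_nat_ge (prodEmb K (algebraMap (𝓞 K) K α))
  _root_.exists_unit_sq_sum H m α hα hm
/-- The sum of the real embeddings. -/
noncomputable def sumEmb (K : Type*) [Field K] [NumberField K] : K →+ ℝ where
  toFun x := ∑ σ : K →+* ℝ, σ x
  map_zero' := by simp
  map_add' x y := by simp [Finset.sum_add_distrib]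

theorem sumEmb_apply (x : K) : sumEmb K x = ∑ σ : K →+* ℝ, σ x := rfl

omit [NumberField K] in
theorem TotPos.inv {x : K} (hx : TotPos x) : TotPos x⁻¹ := fun σ => by
  rw [map_inv₀]; exact inv_pos.2 (hx σ)

omit [NumberField K] in
theorem TotPos.div {x y : K} (hx : TotPos x) (hy : TotPos y) : TotPos (x / y) := by
  rw [div_eq_mul_inv]; exact hx.mul hy.inv

theorem TotPos.one_le_prodEmb_div {x d : K} (hd : TotPos d) (h : prodEmb K d ≤ prodEmb K x) :
    1 ≤ ∏ σ : K →+* ℝ, σ (x / d) := by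
  have := Finset.prod_div_distrib (s := Finset.univ) (fun σ : K →+* ℝ => σ x) fun σ => σ d
  simp only [map_div₀, this]
  exact (one_le_div hd.prodEmb_pos).2 h

theorem TotPos.card_le_sumEmb {x d : K} (hx : TotPos x) (hd : TotPos d)
    (h : prodEmb K d ≤ prodEmb K x) : (Fintype.card (K →+* ℝ) : ℝ) ≤ sumEmb K (x / d) :=
  card_le_sum_of_one_le_prod (hx.div hd) (hd.one_le_prodEmb_div h)

theorem TotPos.eq_of_sumEmb_le [IsTotallyReal K] {x d : K} (hx : TotPos x) (hd : TotPos d)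
    (h : prodEmb K d ≤ prodEmb K x) (hs : sumEmb K (x / d) ≤ Fintype.card (K →+* ℝ)) : x = d := by
  obtain ⟨σ⟩ := (inferInstance : Nonempty (K →+* ℝ))
  have h1 := forall_eq_one_of_one_le_prod (hx.div hd) (hd.one_le_prodEmb_div h) hs σ
  rw [← map_one σ] at h1
  exact (div_eq_one_iff_eq hd.ne_zero).1 (σ.injective h1)

theorem sumEmb_mono {x y : K} (h : ∀ σ : K →+* ℝ, σ x ≤ σ y) : sumEmb K x ≤ sumEmb K y :=
  Finset.sum_le_sum fun σ _ => h σ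

theorem TotPos.prodEmb_mono {x y : K} (hx : TotPos x) (h : ∀ σ : K →+* ℝ, σ x ≤ σ y) :
    prodEmb K x ≤ prodEmb K y :=
  Finset.prod_le_prod (fun σ _ => (hx σ).le) fun σ _ => h σ

theorem prodEmb_unit_sq [IsTotallyReal K] (u : (𝓞 K)ˣ) : prodEmb K ((u : K) ^ 2) = 1 := by
  rw [map_pow, ← sq_abs, abs_prodEmb_unit, one_pow]

omit [NumberField K] in
theorem totPos_unit_sq_add_unit_sq (v w : (𝓞 K)ˣ) : TotPos ((v : K) ^ 2 + (w : K) ^ 2) :=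
  (totPos_sq (coe_unit_ne_zero v)).add (totPos_sq (coe_unit_ne_zero w))

omit [NumberField K] in
theorem totPos_one_add_unit_sq (u : (𝓞 K)ˣ) : TotPos (1 + (u : K) ^ 2) := by
  simpa using totPos_unit_sq_add_unit_sq 1 u

omit [NumberField K] in
theorem coe_mul_inv_unit (v w : (𝓞 K)ˣ) : ((v * w⁻¹ : (𝓞 K)ˣ) : K) = (v : K) / (w : K) := by
  rw [eq_div_iff (coe_unit_ne_zero w), ← map_mul, ← Units.val_mul, inv_mul_cancel_right]

theorem prodEmb_unit_sq_add_unit_sq [IsTotallyReal K] (v w : (𝓞 K)ˣ) :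
    prodEmb K ((v : K) ^ 2 + (w : K) ^ 2) = prodEmb K (1 + ((v * w⁻¹ : (𝓞 K)ˣ) : K) ^ 2) := by
  have : (v : K) ^ 2 + (w : K) ^ 2 = (w : K) ^ 2 * (1 + ((v * w⁻¹ : (𝓞 K)ˣ) : K) ^ 2) := by
    have := coe_unit_ne_zero w
    rw [coe_mul_inv_unit]
    field_simp
    ring
  rw [this, map_mul, prodEmb_unit_sq, one_mul]

theorem two_le_prodEmb_one_add_sq [IsTotallyReal K] (u : (𝓞 K)ˣ) :
    2 ≤ prodEmb K (1 + (u : K) ^ 2) := by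
  have h := TotPos.prodEmb_add_le (x := (1 : K)) (y := (u : K) ^ 2) (fun σ => by simp)
    (totPos_sq (coe_unit_ne_zero u))
  rw [prodEmb_unit_sq, map_one] at h
  linarith

/-- Units outside `F` for which the product of the conjugates of `1 + u ^ 2` is minimal. -/
def IsMinUnit (F : IntermediateField ℚ K) (u : (𝓞 K)ˣ) : Prop :=
  (u : K) ∉ F ∧ ∀ v : (𝓞 K)ˣ, (v : K) ∉ F →
    prodEmb K (1 + (u : K) ^ 2) ≤ prodEmb K (1 + (v : K) ^ 2)

theorem exists_isMinUnit [IsTotallyReal K] {F : IntermediateField ℚ K}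
    (h : ∃ u : (𝓞 K)ˣ, (u : K) ∉ F) : ∃ u, IsMinUnit F u := by
  have hN (u : (𝓞 K)ˣ) : ∃ m : ℕ, prodEmb K (1 + (u : K) ^ 2) = m := by
    obtain ⟨m, hm⟩ := exists_int_prodEmb (1 + (u : 𝓞 K) ^ 2)
    rw [map_add, map_one, map_pow] at hm
    have h2 := two_le_prodEmb_one_add_sq u
    rw [hm] at h2
    lift m to ℕ using by have : (0 : ℝ) ≤ m := by linarith
                         exact_mod_cast this
    exact ⟨m, by simpa using hm⟩
  choose N hN using hN
  obtain ⟨u, hu, hmin⟩ := (measure N).wf.has_min {u | (u : K) ∉ F} h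
  refine ⟨u, hu, fun v hv => ?_⟩
  rw [hN, hN]
  exact_mod_cast not_lt.1 (hmin v hv)

theorem IsMinUnit.neg {F : IntermediateField ℚ K} {u : (𝓞 K)ˣ} (hu : IsMinUnit F u) :
    IsMinUnit F (-u) := by
  simpa [IsMinUnit] using hu

theorem IsMinUnit.inv [IsTotallyReal K] {F : IntermediateField ℚ K} {u : (𝓞 K)ˣ}
    (hu : IsMinUnit F u) : IsMinUnit F u⁻¹ := by
  have h := coe_mul_inv_unit 1 u
  rw [one_mul] at h
  refine ⟨fun h' => hu.1 ?_, ?_⟩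
  · rw [h] at h'
    simpa using F.inv_mem h'
  · have := prodEmb_unit_sq_add_unit_sq 1 u
    rw [one_mul] at this
    rw [← this]
    simpa using hu.2

theorem IsMinUnit.le_of_div_notMem [IsTotallyReal K] {F : IntermediateField ℚ K} {u : (𝓞 K)ˣ}
    (hu : IsMinUnit F u) {v w : (𝓞 K)ˣ} (h : (v : K) / (w : K) ∉ F) :
    prodEmb K (1 + (u : K) ^ 2) ≤ prodEmb K ((v : K) ^ 2 + (w : K) ^ 2) := by
  rw [prodEmb_unit_sq_add_unit_sq]
  exact hu.2 _ (by rwa [coe_mul_inv_unit])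

omit [NumberField K] in
theorem totPos_one_add_add_sq {x : K} : TotPos (1 + x + x ^ 2) := fun σ => by
  simp only [map_add, map_one, map_pow]
  nlinarith [sq_nonneg (σ x + 1 / 2)]

theorem IsMinUnit.one_add_ne_zero {F : IntermediateField ℚ K} {u : (𝓞 K)ˣ}
    (hu : IsMinUnit F u) : 1 + (u : 𝓞 K) ≠ 0 := fun h => hu.1 <| by
  rw [show (u : 𝓞 K) = -1 by linear_combination h]
  simp

theorem IsMinUnit.prodEmb_ne_one [IsTotallyReal K] {F : IntermediateField ℚ K} {u : (𝓞 K)ˣ}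
    (hu : IsMinUnit F u) : prodEmb K (1 + (u : K) + (u : K) ^ 2) ≠ 1 := by
  intro h1
  have hne : (1 + (u : K)) ≠ 0 := by
    have := hu.one_add_ne_zero
    rwa [← map_one (algebraMap (𝓞 K) K), ← map_add, Ne,
      FaithfulSMul.algebraMap_eq_zero_iff (𝓞 K) K]
  have h2 := one_le_abs_prodEmb hu.one_add_ne_zero
  have h3 := two_le_prodEmb_one_add_sq u
  have h4 : prodEmb K ((1 + (u : K)) ^ 2 * (1 + (u : K) ^ 2)) ≤
      prodEmb K ((1 + (u : K) + (u : K) ^ 2) ^ 2) := by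
    refine ((totPos_sq hne).mul (totPos_one_add_unit_sq u)).prodEmb_mono fun σ => ?_
    simp only [map_add, map_one, map_pow, map_mul]
    nlinarith [sq_nonneg (σ u)]
  rw [map_mul, map_pow, map_pow, h1] at h4
  rw [map_add, map_one] at h2
  have h5 : 1 ≤ prodEmb K (1 + (u : K)) ^ 2 := by
    rw [← sq_abs]; nlinarith
  nlinarith

/-- For a minimal unit `u`, the element `1 + u + u ^ 2` lies in `F`, possibly after division by
`u ^ 2`. -/
theorem IsMinUnit.mem_or_div_mem [IsTotallyReal K] (H : SumSq K) {F : IntermediateField ℚ K}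
    {u : (𝓞 K)ˣ} (hu : IsMinUnit F u) (hS : sumEmb K ((u : K) / (1 + (u : K) ^ 2)) ≤ 0) :
    1 + (u : K) + (u : K) ^ 2 ∈ F ∨ (1 + (u : K) + (u : K) ^ 2) / (u : K) ^ 2 ∈ F := by
  have hd := totPos_one_add_unit_sq u
  set d : K := 1 + (u : K) ^ 2 with hd_def
  set f : K := 1 + (u : K) + (u : K) ^ 2 with hf_def
  have hf : TotPos f := totPos_one_add_add_sq
  have hdd : sumEmb K (d / d) = Fintype.card (K →+* ℝ) := by
    rw [div_self hd.ne_zero]; simp [sumEmb_apply]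
  have hfd : sumEmb K (f / d) ≤ Fintype.card (K →+* ℝ) := by
    rw [show f = d + u by rw [hf_def, hd_def]; ring, add_div, map_add, hdd]
    linarith
  have hlt : prodEmb K f < prodEmb K d := by
    by_contra! h
    have h1 := hf.eq_of_sumEmb_le hd h hfd
    exact coe_unit_ne_zero u (by linear_combination h1)
  obtain ⟨s, hs⟩ := TotPos.exists_unit_sq_sum (α := 1 + u + (u : 𝓞 K) ^ 2) H (by simpa using hf)
  replace hs : (s.map fun v : (𝓞 K)ˣ => (v : K) ^ 2).sum = f := by simpa [hf_def] using hs
  have hnonneg (t : Multiset (𝓞 K)ˣ) (σ : K →+* ℝ) :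
      0 ≤ σ (t.map fun v : (𝓞 K)ˣ => (v : K) ^ 2).sum := by
    rw [map_multiset_sum, Multiset.map_map]
    refine Multiset.sum_nonneg fun x hx => ?_
    obtain ⟨v, -, rfl⟩ := Multiset.mem_map.1 hx
    simpa using sq_nonneg _
  have hpair {v w : (𝓞 K)ˣ} (hvw : ∀ σ : K →+* ℝ, σ ((v : K) ^ 2 + (w : K) ^ 2) ≤ σ f) :
      (v : K) / (w : K) ∈ F := by
    by_contra h
    have h1 := hu.le_of_div_notMem h
    have h2 := (totPos_unit_sq_add_unit_sq v w).prodEmb_mono hvw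
    linarith
  rcases s.empty_or_exists_mem with rfl | ⟨v, hv⟩
  · simp only [Multiset.map_zero, Multiset.sum_zero] at hs
    exact (hf.ne_zero hs.symm).elim
  obtain ⟨s, rfl⟩ := Multiset.exists_cons_of_mem hv
  have hvs {w : (𝓞 K)ˣ} (hw : w ∈ s) (σ : K →+* ℝ) : σ ((w : K) ^ 2 + (v : K) ^ 2) ≤ σ f := by
    obtain ⟨t, rfl⟩ := Multiset.exists_cons_of_mem hw
    have := hnonneg t σ
    rw [← hs]
    simp only [Multiset.map_cons, Multiset.sum_cons, map_add] at this ⊢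
    linarith
  have hv0 := coe_unit_ne_zero v
  have hu0 := coe_unit_ne_zero u
  have hfv : f / (v : K) ^ 2 ∈ F := by
    rw [← hs, Multiset.map_cons, Multiset.sum_cons, add_div, div_self (pow_ne_zero 2 hv0),
      div_eq_mul_inv, ← Multiset.sum_map_mul_right]
    refine F.add_mem F.one_mem (F.multiset_sum_mem _ fun x hx => ?_)
    obtain ⟨w, hw, rfl⟩ := Multiset.mem_map.1 hx
    rw [← div_eq_mul_inv, ← div_pow]
    exact pow_mem (hpair (hvs hw)) 2
  by_cases hvF : (v : K) ∈ F
  · left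
    simpa [hv0] using F.mul_mem hfv (pow_mem hvF 2)
  by_cases hvuF : (v : K) / (u : K) ∈ F
  · right
    have := F.mul_mem hfv (pow_mem hvuF 2)
    rwa [div_pow, div_mul_div_cancel₀ (pow_ne_zero 2 hv0)] at this
  exfalso
  rcases s.empty_or_exists_mem with rfl | ⟨w, hw⟩
  · apply hu.prodEmb_ne_one
    simp only [Multiset.map_cons, Multiset.map_zero, Multiset.sum_cons, Multiset.sum_zero,
      add_zero] at hs
    rw [← hf_def, ← hs, prodEmb_unit_sq]
  have hwv := hpair (hvs hw)
  have hw0 := coe_unit_ne_zero w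
  have hwF : (w : K) ∉ F := fun h => hvF <| by
    have := F.div_mem h hwv
    rwa [div_div_cancel₀ hw0] at this
  have hwuF : (w : K) / (u : K) ∉ F := fun h => hvuF <| by
    have := F.div_mem h hwv
    rwa [div_div_div_cancel_left' _ _ hw0] at this
  have hE1 {x : (𝓞 K)ˣ} (hx : (x : K) ∉ F) :=
    (totPos_unit_sq_add_unit_sq x 1).card_le_sumEmb hd
      (hu.le_of_div_notMem (w := 1) (by simpa using hx))
  have hE2 {x : (𝓞 K)ˣ} (hx : (x : K) / (u : K) ∉ F) :=
    (totPos_unit_sq_add_unit_sq x u).card_le_sumEmb hd (hu.le_of_div_notMem hx)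
  have hsum (x : (𝓞 K)ˣ) : sumEmb K (((x : K) ^ 2 + ((1 : (𝓞 K)ˣ) : K) ^ 2) / d) +
      sumEmb K (((x : K) ^ 2 + (u : K) ^ 2) / d) =
      2 * sumEmb K ((x : K) ^ 2 / d) + Fintype.card (K →+* ℝ) := by
    rw [← map_add, ← add_div, ← hdd, two_mul, ← map_add, ← map_add, ← add_div, ← add_div]
    congr 2
    simp only [Units.val_one, map_one, hd_def]
    ring
  have hvw : sumEmb K ((v : K) ^ 2 / d) + sumEmb K ((w : K) ^ 2 / d) ≤ Fintype.card (K →+* ℝ) := by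
    refine le_trans ?_ hfd
    rw [← map_add, ← add_div]
    refine sumEmb_mono fun σ => ?_
    rw [map_div₀, map_div₀]
    refine div_le_div_of_nonneg_right ?_ (hd σ).le
    rw [add_comm]
    exact hvs hw σ
  have hvd := (totPos_unit_sq_add_unit_sq v 1).eq_of_sumEmb_le hd
    (hu.le_of_div_notMem (w := 1) (by simpa using hvF)) (by
      linarith [hE1 hvF, hE2 hvuF, hE1 hwF, hE2 hwuF, hsum v, hsum w])
  have hvu : (v : K) ^ 2 = (u : K) ^ 2 := by
    rw [hd_def] at hvd
    simp only [Units.val_one, map_one] at hvd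
    linear_combination hvd
  rcases sq_eq_sq_iff_eq_or_eq_neg.1 hvu with h | h
  · exact hvuF (by rw [h, div_self hu0]; exact F.one_mem)
  · exact hvuF (by rw [h, neg_div, div_self hu0]; exact F.neg_mem F.one_mem)

theorem exists_isMinUnit_mem [IsTotallyReal K] (H : SumSq K) {F : IntermediateField ℚ K}
    (h : ∃ u : (𝓞 K)ˣ, (u : K) ∉ F) :
    ∃ u, IsMinUnit F u ∧ (u : K) ^ 2 + (u : K) ∈ F := by
  obtain ⟨u, hu, hS⟩ : ∃ u, IsMinUnit F u ∧ sumEmb K ((u : K) / (1 + (u : K) ^ 2)) ≤ 0 := by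
    obtain ⟨u, hu⟩ := exists_isMinUnit h
    rcases le_total (sumEmb K ((u : K) / (1 + (u : K) ^ 2))) 0 with h | h
    · exact ⟨u, hu, h⟩
    · refine ⟨-u, hu.neg, ?_⟩
      simpa [neg_div] using h
  have key {x : K} (hx : 1 + x + x ^ 2 ∈ F) : x ^ 2 + x ∈ F := by
    have := F.sub_mem hx F.one_mem
    ring_nf at this ⊢
    exact this
  rcases hu.mem_or_div_mem H hS with h | h
  · exact ⟨u, hu, key h⟩
  · refine ⟨u⁻¹, hu.inv, key ?_⟩
    have hinv := coe_mul_inv_unit 1 u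
    rw [one_mul, Units.val_one, map_one] at hinv
    have hu0 := coe_unit_ne_zero u
    convert h using 1
    rw [hinv]
    field_simp
    ring
end

theorem golden_identity {r s t e : ℝ} (hr : r ^ 2 = r + 1) (hst : s * t = e) :
    ((1 + s) ^ 2 + 1) * ((1 + t) ^ 2 + 1) -
        ((s + (r + 1)) ^ 2 + (r + 1)) * ((t + (2 - r)) ^ 2 + (2 - r)) =
      -1 + (4 * r - 5) * s ^ 2 + (-4 * r - 1) * t ^ 2 + 2 * (1 + e) * (r - 1) * s -
        2 * (1 + e) * r * t := by
  grind

theorem golden_ineq {r s t : ℝ} (hr : r ^ 2 = r + 1) (hr0 : 0 < r)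
    (h : (s * t = 1 ∧ t ≤ s ∧ 0 < t ∧ 3 ≤ s + t) ∨ (s * t = -1 ∧ 4 ≤ s ∧ t < 0 ∧ -1 / 4 ≤ t)) :
    ((s + r ^ 2) ^ 2 + r ^ 2) * ((t + (1 - r) ^ 2) ^ 2 + (1 - r) ^ 2) <
      ((1 + s) ^ 2 + 1) * ((1 + t) ^ 2 + 1) := by
  have hr1 : 1.61 < r := by nlinarith
  have hr2 : r < 1.62 := by nlinarith
  rw [show (1 - r) ^ 2 = 2 - r by linear_combination hr, hr]
  rw [← sub_pos]
  rcases h with ⟨h1, h2, h3, h4⟩ | ⟨h1, h2, h3, h4⟩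
  · rw [golden_identity hr h1]
    have h5 : 2.6 ≤ s := by nlinarith
    have h6 : t ≤ 0.4 := by nlinarith
    have h7 : 1.44 * (2.6 * 2.6) ≤ (4 * r - 5) * s ^ 2 := by
      apply mul_le_mul <;> nlinarith
    have h8 : (4 * r + 1) * t ^ 2 ≤ 7.48 * (0.4 * 0.4) := by
      apply mul_le_mul <;> nlinarith
    nlinarith
  · rw [golden_identity hr h1]
    have h7 : 1.44 * (4 * 4) ≤ (4 * r - 5) * s ^ 2 := by
      apply mul_le_mul <;> nlinarith
    have h8 : (4 * r + 1) * t ^ 2 ≤ 7.48 * (1 / 16) := by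
      apply mul_le_mul <;> nlinarith
    linarith

section
variable {K : Type*} [Field K] [NumberField K]

theorem eq_top_of_units_mem [IsTotallyReal K] (H : SumSq K) {F : IntermediateField ℚ K}
    (h : ∀ u : (𝓞 K)ˣ, (u : K) ∈ F) : F = ⊤ := by
  have hint (α : 𝓞 K) : algebraMap (𝓞 K) K α ∈ F := by
    obtain ⟨N, hN⟩ : ∃ N : ℕ, ∀ σ : K →+* ℝ, -σ (algebraMap (𝓞 K) K α) < N := by
      obtain ⟨C, hC⟩ := (Set.finite_range fun σ : K →+* ℝ => -σ (algebraMap (𝓞 K) K α)).bddAbove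
      obtain ⟨N, hN⟩ := exists_nat_gt C
      exact ⟨N, fun σ => (hC ⟨σ, rfl⟩).trans_lt hN⟩
    obtain ⟨s, hs⟩ := TotPos.exists_unit_sq_sum (α := α + N) H fun σ => by
      have := hN σ
      simp only [map_add, map_natCast]
      linarith
    have hmem : (s.map fun v : (𝓞 K)ˣ => (v : K) ^ 2).sum ∈ F :=
      F.multiset_sum_mem _ fun x hx => by
        obtain ⟨w, hw, rfl⟩ := Multiset.mem_map.1 hx
        exact pow_mem (h w) 2
    rw [hs, map_add, map_natCast] at hmem
    simpa using F.sub_mem hmem (natCast_mem F N)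
  refine eq_top_iff.2 fun x _ => ?_
  obtain ⟨a, b, -, rfl⟩ := IsFractionRing.div_surjective (A := 𝓞 K) x
  exact F.div_mem (hint a) (hint b)

theorem prodEmb_ratCast [IsTotallyReal K] (q : ℚ) :
    prodEmb K (q : K) = (q : ℝ) ^ Fintype.card (K →+* ℝ) := by
  simp [prodEmb_apply]

open Polynomial in
theorem prodEmb_aeval_conj [IsTotallyReal K] {F : IntermediateField ℚ K} {u : K} (hu : u ∉ F)
    (hθ : u ^ 2 + u ∈ F) (q : F[X]) :
    prodEmb K (aeval u q) = prodEmb K (aeval (-1 - u) q) := by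
  rw [prodEmb_eq_norm, prodEmb_eq_norm, norm_aeval_conj F (θ := ⟨_, hθ⟩) _ rfl]
  rintro ⟨x, rfl⟩
  exact hu x.2

open Polynomial in
theorem abs_prodEmb_one_add_unit [IsTotallyReal K] {F : IntermediateField ℚ K} {u : (𝓞 K)ˣ}
    (hu : (u : K) ∉ F) (hθ : (u : K) ^ 2 + (u : K) ∈ F) : |prodEmb K (1 + (u : K))| = 1 := by
  have h := prodEmb_aeval_conj hu hθ (-X)
  simp only [map_neg, aeval_X] at h
  rw [show 1 + (u : K) = -(-1 - (u : K)) by ring, ← h, ← map_neg, ← Units.val_neg,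
    abs_prodEmb_unit]

/-- If not all units are rational then there is a golden unit. -/
theorem exists_golden_unit [IsTotallyReal K] (H : SumSq K)
    (h : ∃ u : (𝓞 K)ˣ, (u : K) ∉ (⊥ : IntermediateField ℚ K)) :
    ∃ w : (𝓞 K)ˣ, (w : K) ∉ (⊥ : IntermediateField ℚ K) ∧ (w : K) ^ 2 = w + 1 := by
  obtain ⟨u, hu, hθ⟩ := exists_isMinUnit_mem H h
  refine ⟨-u, by simpa using hu.1, ?_⟩
  have h1 := abs_prodEmb_one_add_unit hu.1 hθ
  obtain ⟨c, hc⟩ := IntermediateField.mem_bot.1 hθ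
  rw [eq_ratCast] at hc
  have h2 : |(c : ℝ)| ^ Fintype.card (K →+* ℝ) = 1 := by
    rw [← abs_pow, ← prodEmb_ratCast (K := K), hc,
      show (u : K) ^ 2 + u = u * (1 + u) by ring, map_mul,
      abs_mul, h1, abs_prodEmb_unit, one_mul]
  rw [pow_eq_one_iff_of_nonneg (abs_nonneg _) Fintype.card_ne_zero] at h2
  norm_cast at h2
  rcases eq_or_eq_neg_of_abs_eq h2 with rfl | rfl
  · simp only [Units.val_neg, map_neg]
    push_cast at hc
    linear_combination -hc
  · obtain ⟨σ⟩ := (inferInstance : Nonempty (K →+* ℝ))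
    have := congr_arg σ hc
    simp only [map_add, map_pow, map_ratCast] at this
    push_cast at this
    nlinarith [sq_nonneg (σ (u : K) + 1 / 2)]
open Polynomial

theorem map_golden {w : K} (hw : w ^ 2 = w + 1) (σ : K →+* ℝ) : σ w ^ 2 = σ w + 1 := by
  rw [← map_pow, hw, map_add, map_one]

theorem map_golden_eq_or {w : K} (hw : w ^ 2 = w + 1) (σ τ : K →+* ℝ) :
    τ w = σ w ∨ τ w = 1 - σ w := by
  have h : (τ w - σ w) * (τ w - (1 - σ w)) = 0 := by
    linear_combination map_golden hw τ - map_golden hw σ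
  rcases mul_eq_zero.1 h with h | h
  · exact Or.inl (sub_eq_zero.1 h)
  · exact Or.inr (sub_eq_zero.1 h)

theorem prodEmb_aeval_golden_conj [IsTotallyReal K] {w : K} (hw : w ^ 2 = w + 1)
    (hw' : w ∉ (⊥ : IntermediateField ℚ K)) (p : ℚ[X]) :
    prodEmb K (aeval w p) = prodEmb K (aeval (1 - w) p) := by
  have h := norm_aeval_conj ℚ (u := -w) (θ := 1) (fun h => hw' ?_) (by simp [hw]) (p.comp (-X))
  · simp only [aeval_comp, map_neg, aeval_X] at h
    rw [neg_neg, show -(-1 - -w) = 1 - w by ring] at h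
    rw [prodEmb_eq_norm, prodEmb_eq_norm, h]
  · obtain ⟨q, hq⟩ := h
    exact IntermediateField.mem_bot.2 ⟨-q, by rw [map_neg, hq, neg_neg]⟩

theorem map_aeval_rat (σ : K →+* ℝ) (w : K) (p : ℚ[X]) : σ (aeval w p) = aeval (σ w) p :=
  (aeval_algHom_apply σ.toRatAlgHom w p).symm

theorem prodEmb_aeval_golden_sq [IsTotallyReal K] {w : K} (hw : w ^ 2 = w + 1)
    (hw' : w ∉ (⊥ : IntermediateField ℚ K)) (p : ℚ[X]) (σ : K →+* ℝ) :
    prodEmb K (aeval w p) ^ 2 =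
      (aeval (σ w) p * aeval (1 - σ w) p) ^ Fintype.card (K →+* ℝ) := by
  rw [sq]
  nth_rewrite 2 [prodEmb_aeval_golden_conj hw hw']
  rw [← map_mul, prodEmb_apply, ← Finset.card_univ, ← Finset.prod_const]
  refine Finset.prod_congr rfl fun τ _ => ?_
  rw [map_mul, map_aeval_rat, map_aeval_rat, map_sub, map_one]
  rcases map_golden_eq_or hw σ τ with h | h
  · rw [h]
  · rw [h, sub_sub_cancel, mul_comm]

theorem exists_golden_conj [IsTotallyReal K] {w : K} (hw : w ^ 2 = w + 1)
    (hw' : w ∉ (⊥ : IntermediateField ℚ K)) (σ : K →+* ℝ) : ∃ τ : K →+* ℝ, τ w = 1 - σ w := by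
  by_contra! h
  have hσ (τ : K →+* ℝ) : τ w = σ w := (map_golden_eq_or hw σ τ).resolve_right (h τ)
  have h1 := prodEmb_aeval_golden_conj hw hw' X
  simp only [aeval_X, prodEmb_apply, map_sub, map_one, hσ, Finset.prod_const] at h1
  have h2 : |σ w| = |1 - σ w| := by
    rw [← pow_left_inj₀ (abs_nonneg _) (abs_nonneg _)
      (Finset.card_ne_zero_of_mem (Finset.mem_univ σ)), ← abs_pow, ← abs_pow, h1]
  have h3 := map_golden hw σ
  rcases abs_eq_abs.1 h2 with h | h
  · nlinarith
  · linarith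

theorem exists_eq_add_mul_of_mem_adjoin {w : K} (hw : w ^ 2 = w + 1) {x : K}
    (hx : x ∈ IntermediateField.adjoin ℚ {w}) : ∃ a b : ℚ, x = a + b * w := by
  rw [← IntermediateField.mem_toSubalgebra,
    IntermediateField.adjoin_simple_toSubalgebra_of_isAlgebraic
      (Algebra.IsAlgebraic.isAlgebraic w)] at hx
  induction hx using Algebra.adjoin_induction with
  | mem x hx => exact ⟨0, 1, by simp [Set.mem_singleton_iff.1 hx]⟩
  | algebraMap r => exact ⟨r, 0, by simp⟩
  | add x y _ _ hx hy =>
    obtain ⟨a, b, rfl⟩ := hx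
    obtain ⟨c, d, rfl⟩ := hy
    exact ⟨a + c, b + d, by push_cast; ring⟩
  | mul x y _ _ hx hy =>
    obtain ⟨a, b, rfl⟩ := hx
    obtain ⟨c, d, rfl⟩ := hy
    exact ⟨a * c + b * d, a * d + b * c + b * d, by push_cast; linear_combination b * d * hw⟩

theorem prodEmb_add_sq_conj [IsTotallyReal K] {F : IntermediateField ℚ K} {u η : K} (hu : u ∉ F)
    (hθ : u ^ 2 + u ∈ F) (hη : η ∈ F) :
    prodEmb K (η + u ^ 2) ^ 2 = prodEmb K ((u ^ 2 + u + η) ^ 2 + η) := by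
  have h := prodEmb_aeval_conj hu hθ (C ⟨η, hη⟩ + X ^ 2)
  simp only [map_add, map_pow, aeval_X, aeval_C] at h
  rw [sq]
  nth_rewrite 2 [show prodEmb K (η + u ^ 2) = prodEmb K (η + (-1 - u) ^ 2) from h]
  rw [← map_mul]
  congr 1
  ring

/-- The contradiction with minimality, in an embedding where both the golden ratio and the
quadratic value are the larger conjugates. -/
theorem IsMinUnit.false_of_golden [IsTotallyReal K] {F : IntermediateField ℚ K}
    {u w : (𝓞 K)ˣ} (hu : IsMinUnit F u) (hwF : (w : K) ∈ F) (hw : (w : K) ^ 2 = w + 1)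
    (hw' : (w : K) ∉ (⊥ : IntermediateField ℚ K)) {a b : ℚ}
    (hab : (u : K) ^ 2 + u = a + b * w) (σ : K →+* ℝ) (hσ : 0 < σ w) {s t : ℝ}
    (hs : s = a + b * σ w) (ht : t = a + b * (1 - σ w))
    (hst : (s * t = 1 ∧ t ≤ s ∧ 0 < t ∧ 3 ≤ s + t) ∨
      (s * t = -1 ∧ 4 ≤ s ∧ t < 0 ∧ -1 / 4 ≤ t)) : False := by
  have hθ : (u : K) ^ 2 + u ∈ F := by
    rw [hab]
    exact F.add_mem (SubfieldClass.ratCast_mem F a) (F.mul_mem (SubfieldClass.ratCast_mem F b) hwF)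
  have hle := hu.le_of_div_notMem (v := w) (w := u) fun h => hu.1 <| by
    have := F.div_mem hwF h
    rwa [div_div_cancel₀ (coe_unit_ne_zero w)] at this
  have hle2 : prodEmb K (1 + (u : K) ^ 2) ^ 2 ≤ prodEmb K ((w : K) ^ 2 + (u : K) ^ 2) ^ 2 :=
    pow_le_pow_left₀ (totPos_one_add_unit_sq u).prodEmb_pos.le hle 2
  rw [prodEmb_add_sq_conj hu.1 hθ F.one_mem, prodEmb_add_sq_conj hu.1 hθ (pow_mem hwF 2),
    hab] at hle2
  have hle4 : prodEmb K ((a + b * (w : K) + 1) ^ 2 + 1) ^ 2 ≤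
      prodEmb K ((a + b * (w : K) + (w : K) ^ 2) ^ 2 + (w : K) ^ 2) ^ 2 := by
    refine pow_le_pow_left₀ (TotPos.prodEmb_pos fun τ => ?_).le hle2 2
    simp only [map_add, map_pow, map_one]
    positivity
  have h1 := prodEmb_aeval_golden_sq hw hw' ((C a + C b * X + 1) ^ 2 + 1) σ
  have h2 := prodEmb_aeval_golden_sq hw hw' ((C a + C b * X + X ^ 2) ^ 2 + X ^ 2) σ
  simp only [map_add, map_pow, map_mul, aeval_X, aeval_C, map_one, eq_ratCast, ← hs, ← ht]
    at h1 h2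
  rw [h1, h2] at hle4
  have hlt := golden_ineq (map_golden hw σ) hσ hst
  rw [add_comm 1 s, add_comm 1 t] at hlt
  exact absurd hle4 (not_le.2 (pow_lt_pow_left₀ hlt (by positivity) Fintype.card_ne_zero))

theorem exists_int_of_isIntegral_ratCast {q : ℚ} {x : 𝓞 K}
    (h : algebraMap (𝓞 K) K x = q) : ∃ m : ℤ, q = m := by
  have hx : IsIntegral ℤ (algebraMap ℚ K q) := by
    rw [eq_ratCast, ← h]
    exact x.isIntegral_coe
  rw [isIntegral_algebraMap_iff (algebraMap ℚ K).injective,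
    IsIntegrallyClosed.isIntegral_iff] at hx
  obtain ⟨m, hm⟩ := hx
  exact ⟨m, by simpa using hm.symm⟩

theorem real_alternatives {s t : ℝ} (h : s * t = 1 ∨ s * t = -1) {m : ℤ} (hm : s + t = m)
    (hs : -1 / 4 ≤ s) (ht : -1 / 4 ≤ t) (h1 : s ≠ 1) (hts : t ≤ s) :
    (s * t = 1 ∧ t ≤ s ∧ 0 < t ∧ 3 ≤ s + t) ∨ (s * t = -1 ∧ 4 ≤ s ∧ t < 0 ∧ -1 / 4 ≤ t) := by
  rcases h with h | h
  · left
    have ht0 : 0 < t := by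
      by_contra! h'
      nlinarith
    refine ⟨h, hts, ht0, ?_⟩
    have hs1 : 0 < (s - 1) ^ 2 := sq_pos_of_ne_zero (sub_ne_zero.2 h1)
    have h2 : 2 < s + t := by
      have : s * (s + t - 2) = (s - 1) ^ 2 := by linear_combination h
      nlinarith
    rw [hm] at h2 ⊢
    exact_mod_cast h2
  · right
    have ht0 : t < 0 := by
      by_contra! h'
      nlinarith
    exact ⟨h, by nlinarith, ht0, ht⟩

theorem units_mem_adjoin_golden [IsTotallyReal K] (H : SumSq K) {w : (𝓞 K)ˣ}
    (hw : (w : K) ^ 2 = w + 1) (hw' : (w : K) ∉ (⊥ : IntermediateField ℚ K)) (v : (𝓞 K)ˣ) :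
    (v : K) ∈ IntermediateField.adjoin ℚ {(w : K)} := by
  by_contra hv
  obtain ⟨u, hu, hθ⟩ := exists_isMinUnit_mem H ⟨v, hv⟩
  set F := IntermediateField.adjoin ℚ {(w : K)}
  have hwF : (w : K) ∈ F := IntermediateField.mem_adjoin_simple_self ℚ (w : K)
  obtain ⟨a, b, hab⟩ := exists_eq_add_mul_of_mem_adjoin hw hθ
  have hone := abs_prodEmb_one_add_unit hu.1 hθ
  obtain ⟨z, hz⟩ : IsUnit (1 + (u : 𝓞 K)) := by
    rw [isUnit_iff_abs_prodEmb, map_add, map_one, hone]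
  have hθuz : ((u * z : (𝓞 K)ˣ) : K) = a + b * w := by
    rw [← hab, Units.val_mul, hz, map_mul, map_add, map_one]
    ring
  have hprod (σ : K →+* ℝ) : (a + b * σ w) * (a + b * (1 - σ w)) = 1 ∨
      (a + b * σ w) * (a + b * (1 - σ w)) = -1 := by
    have h1 := prodEmb_aeval_golden_sq hw hw' (C a + C b * X) σ
    simp only [map_add, map_mul, aeval_X, aeval_C, eq_ratCast] at h1
    rw [← hθuz, ← sq_abs, abs_prodEmb_unit, one_pow] at h1
    have h2 := congr_arg abs h1
    rw [abs_one, abs_pow, eq_comm,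
      pow_eq_one_iff_of_nonneg (abs_nonneg _) Fintype.card_ne_zero] at h2
    exact eq_or_eq_neg_of_abs_eq h2
  have hmap (σ : K →+* ℝ) : σ (u : K) ^ 2 + σ (u : K) = a + b * σ w := by
    simpa using congr_arg σ hab
  obtain ⟨m, hm⟩ : ∃ m : ℤ, 2 * a + b = m := by
    obtain ⟨σ⟩ := (inferInstance : Nonempty (K →+* ℝ))
    have hcast {x : 𝓞 K} (hx : σ (algebraMap (𝓞 K) K x) = 2 * a + b) : ∃ m : ℤ, 2 * a + b = m :=
      exists_int_of_isIntegral_ratCast (x := x) <| σ.injective <| by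
        rw [hx, map_ratCast]; push_cast; rfl
    have hσ : σ ((u * z : (𝓞 K)ˣ) : K) = a + b * σ w := by rw [hθuz]; simp
    have hσ' : σ (((u * z)⁻¹ : (𝓞 K)ˣ) : K) = (a + b * σ w)⁻¹ := by
      have := coe_mul_inv_unit 1 (u * z)
      rw [one_mul] at this
      rw [this, map_div₀, hσ]
      simp
    have hne : (a + b * σ w) ≠ 0 := by
      rw [← hσ]
      exact (map_ne_zero σ).2 (coe_unit_ne_zero _)
    rcases hprod σ with h | h
    · apply hcast (x := (u * z : (𝓞 K)ˣ) + ((u * z)⁻¹ : (𝓞 K)ˣ))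
      rw [map_add, map_add, hσ, hσ', ← eq_inv_of_mul_eq_one_right h]
      ring
    · apply hcast (x := (u * z : (𝓞 K)ˣ) - ((u * z)⁻¹ : (𝓞 K)ˣ))
      rw [map_sub, map_sub, hσ, hσ', inv_eq_of_mul_eq_one_right (b := -(a + b * (1 - σ w)))
        (by linear_combination -h)]
      ring
  have hge (σ : K →+* ℝ) : -1 / 4 ≤ a + b * σ w := by
    rw [← hmap]
    nlinarith [sq_nonneg (σ (u : K) + 1 / 2)]
  have hge' (σ : K →+* ℝ) : -1 / 4 ≤ a + b * (1 - σ w) := by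
    obtain ⟨τ, hτ⟩ := exists_golden_conj hw hw' σ
    rw [← hτ]
    exact hge τ
  have hne (σ : K →+* ℝ) : a + b * σ w ≠ 1 := by
    intro h
    rw [← hmap] at h
    have h1 : (u : K) ^ 2 + u = 1 := σ.injective (by simpa using h)
    have h2 : ((u : K) + w) * (u + 1 - w) = 0 := by linear_combination h1 - hw
    apply hu.1
    rcases mul_eq_zero.1 h2 with h | h
    · rw [show (u : K) = -w by linear_combination h]
      exact F.neg_mem hwF
    · rw [show (u : K) = w - 1 by linear_combination h]
      exact F.sub_mem hwF F.one_mem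
  obtain ⟨σ, hσ⟩ : ∃ σ : K →+* ℝ, a + b * (1 - σ w) ≤ a + b * σ w := by
    obtain ⟨σ⟩ := (inferInstance : Nonempty (K →+* ℝ))
    obtain ⟨τ, hτ⟩ := exists_golden_conj hw hw' σ
    rcases le_total (a + b * (1 - σ w) : ℝ) (a + b * σ w) with h | h
    · exact ⟨σ, h⟩
    · exact ⟨τ, by rw [hτ, sub_sub_cancel]; exact h⟩
  have halt := real_alternatives (hprod σ) (m := m)
    (by rw [← Rat.cast_intCast, ← hm]; push_cast; ring) (hge σ) (hge' σ) (hne σ) hσ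
  rcases lt_or_ge 0 (σ w) with hpos | hneg
  · exact hu.false_of_golden hwF hw hw' hab σ hpos rfl rfl halt
  · have hinv : ((-w⁻¹ : (𝓞 K)ˣ) : K) = 1 - w := by
      have h1 := coe_mul_inv_unit 1 w
      have h2 := coe_unit_ne_zero w
      rw [one_mul] at h1
      rw [Units.val_neg, map_neg, h1, Units.val_one, map_one]
      field_simp
      linear_combination hw
    refine hu.false_of_golden (w := -w⁻¹) (a := a + b) (b := -b) ?_ ?_ ?_ ?_ σ ?_ ?_ ?_ halt
    · rw [hinv]; exact F.sub_mem F.one_mem hwF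
    · rw [hinv]; linear_combination hw
    · rw [hinv]
      intro h
      exact hw' (by simpa using IntermediateField.sub_mem _ (IntermediateField.one_mem _) h)
    · rw [hinv, hab]; push_cast; ring
    · rw [hinv, map_sub, map_one]; linarith
    · rw [hinv, map_sub, map_one]; push_cast; ring
    · rw [hinv, map_sub, map_one]; push_cast; ring

theorem finrank_adjoin_golden {w : K} (hw : w ^ 2 = w + 1)
    (hw' : w ∉ (⊥ : IntermediateField ℚ K)) :
    finrank ℚ (IntermediateField.adjoin ℚ {w}) = 2 := by
  have hn : -w ∉ (algebraMap ℚ K).range := by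
    rintro ⟨q, hq⟩
    exact hw' (IntermediateField.mem_bot.2 ⟨-q, by rw [map_neg, hq, neg_neg]⟩)
  have h := minpoly_eq_of_sq_add_self (θ := (1 : ℚ)) hn (by simp [hw])
  have hadj : IntermediateField.adjoin ℚ {w} = IntermediateField.adjoin ℚ {-w} := by
    apply le_antisymm <;> rw [IntermediateField.adjoin_simple_le_iff]
    · simpa using IntermediateField.neg_mem _ (IntermediateField.mem_adjoin_simple_self ℚ (-w))
    · exact IntermediateField.neg_mem _ (IntermediateField.mem_adjoin_simple_self ℚ w)
  rw [hadj, IntermediateField.adjoin.finrank (Algebra.IsIntegral.isIntegral _), h]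
  compute_degree!
end

/-- **Siegel.**  Let `K` be a totally real number field in which every totally
positive element of `𝓞 K` is a sum of squares of elements of `𝓞 K`.  Then
`K = ℚ` (i.e. `K` has degree 1) or `K = ℚ(√5)` (i.e. `K` has degree 2 and
contains a square root of 5). -/
theorem siegel_sums_of_squares
    (K : Type) [Field K] [NumberField K]
    (htr : ∀ φ : K →+* ℂ, NumberField.ComplexEmbedding.IsReal φ)
    (hsq : ∀ α : 𝓞 K, (∀ σ : K →+* ℝ, 0 < σ (α : K)) →
      ∃ (n : ℕ) (f : Fin n → 𝓞 K), α = ∑ i, f i ^ 2) :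
    Module.finrank ℚ K = 1 ∨ (Module.finrank ℚ K = 2 ∧ ∃ x : K, x ^ 2 = 5) := by
  have : IsTotallyReal K := ⟨fun v => by
    rw [← v.mk_embedding]
    exact InfinitePlace.isReal_mk_iff.2 (htr _)⟩
  have H : SumSq K := hsq
  by_cases h : ∃ u : (𝓞 K)ˣ, algebraMap (𝓞 K) K u ∉ (⊥ : IntermediateField ℚ K)
  · right
    obtain ⟨w, hw', hw⟩ := exists_golden_unit H h
    refine ⟨?_, 2 * algebraMap (𝓞 K) K w - 1, by linear_combination 4 * hw⟩
    rw [← IntermediateField.finrank_top',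
      ← eq_top_of_units_mem H (units_mem_adjoin_golden H hw hw'),
      finrank_adjoin_golden hw hw']
  · left
    push Not at h
    rw [← IntermediateField.finrank_top', ← eq_top_of_units_mem H h, IntermediateField.finrank_bot]
end

section
/- Let K be a real quadratic field with K ≠ ℚ(√5). Then no positive definite quadratic form with coefficients in ℤ is universal over K: for every r and every quadratic form Q(x₁, …, x_r) = Σ_{1≤i≤j≤r} a_ij x_i x_j with a_ij ∈ ℤ that is positive definite, there exists α ∈ O_K^+ such that Q(v) ≠ α for all v ∈ O_K^r. -/
open NumberField

section TriangularForm

variable {R : Type*} [CommRing R] {ι : Type*} [Fintype ι] [LinearOrder ι]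

/-- The bilinear form `Σ_{i ≤ j} a i j · x i · y j`, whose diagonal is the quadratic form with
upper triangular coefficients `a`. -/
def triangularForm (a : ι → ι → ℤ) (x y : ι → R) : R :=
  ∑ i, ∑ j, if i ≤ j then (a i j : R) * x i * y j else 0

lemma triangularForm_combination (a : ι → ι → ℤ) (x y : ι → R) (s c : R) :
    triangularForm a (fun i => s * x i + c * y i) (fun i => s * x i + c * y i) =
      s ^ 2 * triangularForm a x x + s * c * (triangularForm a x y + triangularForm a y x) +
        c ^ 2 * triangularForm a y y := by
  simp only [triangularForm, Finset.mul_sum, ← Finset.sum_add_distrib]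
  refine Finset.sum_congr rfl fun i _ => Finset.sum_congr rfl fun j _ => ?_
  split_ifs <;> ring

lemma triangularForm_intCast (a : ι → ι → ℤ) (x y : ι → ℤ) :
    triangularForm a (fun i => (x i : R)) (fun i => (y i : R)) =
      ((triangularForm a x y : ℤ) : R) := by
  simp [triangularForm, Int.cast_ite]

@[simp]
lemma triangularForm_zero_left (a : ι → ι → ℤ) (y : ι → R) : triangularForm a 0 y = 0 := by
  simp [triangularForm]

@[simp]
lemma triangularForm_zero_right (a : ι → ι → ℤ) (x : ι → R) : triangularForm a x 0 = 0 := by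
  simp [triangularForm]

/-- If a positive definite form over `ℤ` takes a value with `ω`-coordinate `1` on `ℤ[ω]`, where
`ω ^ 2 = n + t * ω`, then twice the trace `2 * k + t` of this value is bounded below in terms of the
discriminant `t ^ 2 + 4 * n`. -/
lemma discrim_add_le_trace (a : ι → ι → ℤ) (ha : ∀ x : ι → ℤ, x ≠ 0 → 0 < triangularForm a x x)
    (x y : ι → ℤ) {n t k : ℤ} (hD : 0 ≤ t ^ 2 + 4 * n)
    (hk : triangularForm a x x + n * triangularForm a y y = k)
    (h_one : triangularForm a x y + triangularForm a y x + t * triangularForm a y y = 1) :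
    t ^ 2 + 4 * n + (if Even t then 4 else 1) ≤ 2 * (2 * k + t) := by
  have hy : y ≠ 0 := by
    rintro rfl
    simp at h_one
  have hz : (fun i => 2 * x i + t * y i) ≠ 0 := by
    intro hz
    have hB : 2 * (triangularForm a x y + triangularForm a y x) +
        2 * t * triangularForm a y y = 0 := by
      have key : triangularForm a (fun i => 2 * x i + t * y i) y +
          triangularForm a y (fun i => 2 * x i + t * y i) =
          2 * (triangularForm a x y + triangularForm a y x) +
            2 * t * triangularForm a y y := by
        simp only [triangularForm, Finset.mul_sum, ← Finset.sum_add_distrib]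
        refine Finset.sum_congr rfl fun i _ => Finset.sum_congr rfl fun j _ => ?_
        split_ifs <;> ring
      rw [← key, hz]
      simp
    linarith
  have hY := ha y hy
  have hZ := ha _ hz
  rw [triangularForm_combination] at hZ
  generalize triangularForm a x x = X at *
  generalize triangularForm a y y = Y at *
  generalize triangularForm a x y + triangularForm a y x = B at *
  have htr : 2 * (2 * k + t) =
      (2 ^ 2 * X + 2 * t * B + t ^ 2 * Y) + (t ^ 2 + 4 * n) * Y := by
    subst hk
    linear_combination (-2 * t) * h_one
  have hDY : t ^ 2 + 4 * n ≤ (t ^ 2 + 4 * n) * Y := le_mul_of_one_le_right hD hY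
  split_ifs with ht
  · obtain ⟨u, rfl⟩ := ht
    have h4 : 2 ^ 2 * X + 2 * (u + u) * B + (u + u) ^ 2 * Y = 4 * (X + u * B + u ^ 2 * Y) := by
      ring
    rw [h4] at hZ htr
    linarith [show 1 ≤ X + u * B + u ^ 2 * Y by linarith]
  · linarith

end TriangularForm

/-- The ring of integers of a quadratic field has an integral basis of the form `1, ω`. -/
lemma exists_integral_generator (K : Type*) [Field K] [NumberField K]
    (hdeg : Module.finrank ℚ K = 2) :
    ∃ ω : 𝓞 K, (∀ v : 𝓞 K, ∃ x y : ℤ, v = x + y * ω) ∧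
      ∀ x y : ℤ, (x + y * ω : 𝓞 K) = 0 → x = 0 ∧ y = 0 := by
  have hrank : Module.finrank ℤ (𝓞 K) = 2 := by rw [RingOfIntegers.rank, hdeg]
  let b : Module.Basis (Fin 2) ℤ (𝓞 K) := Module.finBasisOfFinrankEq ℤ (𝓞 K) hrank
  have hspan (v : 𝓞 K) : v = (b.repr v 0 : 𝓞 K) * b 0 + (b.repr v 1 : 𝓞 K) * b 1 := by
    conv_lhs => rw [← b.sum_repr v]
    simp [Fin.sum_univ_two]
  have hindep (x y : ℤ) (h : (x * b 0 + y * b 1 : 𝓞 K) = 0) : x = 0 ∧ y = 0 := by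
    have := Fintype.linearIndependent_iff.1 b.linearIndependent ![x, y]
      (by simpa [Fin.sum_univ_two] using h)
    exact ⟨this 0, this 1⟩
  obtain ⟨p, q, hpq⟩ : ∃ p q : ℤ, (1 : 𝓞 K) = p * b 0 + q * b 1 := ⟨_, _, hspan 1⟩
  have hcop : IsCoprime p q := by
    rw [Int.isCoprime_iff_gcd_eq_one]
    obtain ⟨p', hp⟩ := Int.gcd_dvd_left p q
    obtain ⟨q', hq⟩ := Int.gcd_dvd_right p q
    have h_mul : algebraMap ℤ (𝓞 K) (Int.gcd p q) * (p' * b 0 + q' * b 1) = 1 := by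
      have hp' : (p : 𝓞 K) = (Int.gcd p q : ℤ) * p' := by exact_mod_cast congrArg Int.cast hp
      have hq' : (q : 𝓞 K) = (Int.gcd p q : ℤ) * q' := by exact_mod_cast congrArg Int.cast hq
      rw [algebraMap_int_eq, eq_intCast]
      linear_combination -hpq - b 0 * hp' - b 1 * hq'
    have h_norm := congrArg (Algebra.norm ℤ) h_mul
    rw [map_mul, Algebra.norm_algebraMap, hrank, map_one (Algebra.norm ℤ)] at h_norm
    have h_unit : IsUnit ((Int.gcd p q : ℤ) ^ 2) := IsUnit.of_mul_eq_one _ h_norm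
    simpa [Int.isUnit_iff_natAbs_eq] using (isUnit_pow_iff two_ne_zero).1 h_unit
  obtain ⟨u, w, huw⟩ := hcop
  have huw' : (u * p + w * q : 𝓞 K) = 1 := by exact_mod_cast huw
  refine ⟨-w * b 0 + u * b 1, fun v => ?_, fun x y h => ?_⟩
  · refine ⟨b.repr v 0 * u + b.repr v 1 * w, -b.repr v 0 * q + b.repr v 1 * p, ?_⟩
    conv_lhs => rw [hspan v]
    push_cast
    generalize ((b.repr v 0 : ℤ) : 𝓞 K) = c
    generalize ((b.repr v 1 : ℤ) : 𝓞 K) = d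
    linear_combination -(c * u + d * w) * hpq - (c * b 0 + d * b 1) * huw'
  · obtain ⟨h0, h1⟩ := hindep (x * p - y * w) (x * q + y * u) (by
      push_cast
      linear_combination h - (x : 𝓞 K) * hpq)
    exact ⟨by linear_combination u * h0 + w * h1 - x * huw,
      by linear_combination -q * h0 + p * h1 - y * huw⟩

/-- If the discriminant `t ^ 2 + 4 * n` is nonnegative, not a square and not `5`, then an integer at
most `2` above its square root violates the lower bound of `discrim_add_le_trace`. -/
lemma discrim_bound {t n T : ℤ} (hD : 0 ≤ t ^ 2 + 4 * n) (h_sq : ∀ s : ℤ, t ^ 2 + 4 * n ≠ s ^ 2)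
    (h5 : t ^ 2 + 4 * n ≠ 5) (hT : (T - 2 : ℝ) ≤ √((t ^ 2 + 4 * n : ℤ) : ℝ)) :
    2 * T < t ^ 2 + 4 * n + (if Even t then 4 else 1) := by
  have h0 := h_sq 0
  have h1 := h_sq 1
  have h2 := h_sq 2
  have h3 := h_sq 3
  have hT' : T ≤ 2 ∨ (T - 2) ^ 2 ≤ t ^ 2 + 4 * n := by
    rcases le_or_gt T 2 with h | h
    · exact Or.inl h
    · right
      have h' : (0 : ℝ) ≤ T - 2 := by
        have : (2 : ℝ) < T := by exact_mod_cast h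
        linarith
      have := (Real.le_sqrt h' (by exact_mod_cast hD)).1 hT
      exact_mod_cast this
  split_ifs with ht
  · obtain ⟨u, rfl⟩ := ht
    have hm : (u + u) ^ 2 + 4 * n = 4 * (u ^ 2 + n) := by ring
    rw [hm] at hD h0 h1 h2 h3 h5 hT' ⊢
    generalize u ^ 2 + n = m at hD h0 h1 h2 h3 h5 hT' ⊢
    have hm2 : 2 ≤ m := by omega
    rcases hT' with h | h
    · linarith
    · nlinarith
  · obtain ⟨u, rfl⟩ := Int.not_even_iff_odd.1 ht
    have hm : (2 * u + 1) ^ 2 + 4 * n = 4 * (u ^ 2 + u + n) + 1 := by ring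
    rw [hm] at hD h0 h1 h2 h3 h5 hT' ⊢
    generalize u ^ 2 + u + n = m at hD h0 h1 h2 h3 h5 hT' ⊢
    have hm3 : 3 ≤ m := by omega
    rcases hT' with h | h
    · linarith
    · nlinarith

/-- Let `K` be a real quadratic field (degree 2, embeddable in `ℝ`) with
`K ≠ ℚ(√5)` (i.e. `√5 ∉ K`).  Then no positive definite quadratic form with
coefficients in `ℤ` is universal over `K`: for every form
`Q(x) = Σ_{i ≤ j} a i j · x i · x j` with `a i j ∈ ℤ` that is positive definite
over `ℤ`, some totally positive `α ∈ 𝓞 K` is not represented by `Q` over `𝓞 K`. -/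
theorem no_universal_Z_form_over_real_quadratic
    (K : Type) [Field K] [NumberField K]
    (hdeg : Module.finrank ℚ K = 2)
    (hreal : Nonempty (K →+* ℝ))
    (hne : ¬ ∃ x : K, x ^ 2 = 5) :
    ∀ (r : ℕ) (a : Fin r → Fin r → ℤ),
      (∀ x : Fin r → ℤ, x ≠ 0 →
        0 < ∑ i, ∑ j, if i ≤ j then a i j * x i * x j else 0) →
      ∃ α : 𝓞 K, (∀ σ : K →+* ℝ, 0 < σ (α : K)) ∧
        ∀ v : Fin r → 𝓞 K,
          (∑ i, ∑ j, if i ≤ j then (a i j : 𝓞 K) * v i * v j else 0) ≠ α := by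
  intro r a ha
  obtain ⟨ω, hspan, hindep⟩ := exists_integral_generator K hdeg
  obtain ⟨n, t, hω⟩ := hspan (ω ^ 2)
  have hθ : (2 * ω - t) ^ 2 = ((t ^ 2 + 4 * n : ℤ) : 𝓞 K) := by
    push_cast
    linear_combination 4 * hω
  have hθK : (2 * (ω : K) - t) ^ 2 = ((t ^ 2 + 4 * n : ℤ) : K) := by
    have h := congrArg (algebraMap (𝓞 K) K) hθ
    rwa [map_pow, map_sub, map_mul, map_intCast, map_intCast, map_ofNat] at h
  have hσ (σ : K →+* ℝ) : (2 * σ ω - t) ^ 2 = ((t ^ 2 + 4 * n : ℤ) : ℝ) := by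
    have h := congrArg σ hθK
    rwa [map_pow, map_sub, map_mul, map_intCast, map_intCast, map_ofNat] at h
  have hD : 0 ≤ t ^ 2 + 4 * n := by
    obtain ⟨σ⟩ := hreal
    exact_mod_cast (hσ σ) ▸ sq_nonneg (2 * σ ω - t)
  have h_sq (s : ℤ) : t ^ 2 + 4 * n ≠ s ^ 2 := by
    intro hs
    rw [hs, Int.cast_pow, sq_eq_sq_iff_eq_or_eq_neg] at hθ
    rcases hθ with h | h
    · have := hindep (-t - s) 2 (by push_cast; linear_combination h)
      omega
    · have := hindep (-t + s) 2 (by push_cast; linear_combination h)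
      omega
  have h5 : t ^ 2 + 4 * n ≠ 5 := fun h =>
    hne ⟨2 * (ω : K) - t, by rw [hθK, h, Int.cast_ofNat]⟩
  let k : ℤ := ⌊(√((t ^ 2 + 4 * n : ℤ) : ℝ) - t) / 2⌋ + 1
  have hk_gt : √((t ^ 2 + 4 * n : ℤ) : ℝ) < 2 * k + t := by
    have := Int.lt_floor_add_one ((√((t ^ 2 + 4 * n : ℤ) : ℝ) - t) / 2)
    simp only [k]
    push_cast at this ⊢
    linarith
  have hk_le : ((2 * k + t : ℤ) - 2 : ℝ) ≤ √((t ^ 2 + 4 * n : ℤ) : ℝ) := by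
    have := Int.floor_le ((√((t ^ 2 + 4 * n : ℤ) : ℝ) - t) / 2)
    simp only [k]
    push_cast at this ⊢
    linarith
  refine ⟨k + ω, fun σ => ?_, fun v hv => ?_⟩
  · have h := neg_abs_le (2 * σ ω - t)
    rw [← Real.sqrt_sq_eq_abs, hσ σ] at h
    have : σ ((k + ω : 𝓞 K) : K) = k + σ ω := by simp
    rw [this]
    linarith
  · choose x y hxy using fun i => hspan (v i)
    have hv' : triangularForm a v v = k + ω := hv
    have hvxy : v = fun i => 1 * (x i : 𝓞 K) + ω * (y i : 𝓞 K) := by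
      ext1 i
      rw [hxy i]
      ring
    rw [hvxy, triangularForm_combination] at hv'
    simp only [triangularForm_intCast] at hv'
    obtain ⟨h0, h1⟩ := hindep
      (triangularForm a x x + n * triangularForm a y y - k)
      (triangularForm a x y + triangularForm a y x + t * triangularForm a y y - 1) (by
        push_cast
        linear_combination hv' - ((triangularForm a y y : ℤ) : 𝓞 K) * hω)
    have hle := discrim_add_le_trace a (by simpa [triangularForm] using ha) x y hD
      (sub_eq_zero.1 h0) (sub_eq_zero.1 h1)
    exact (discrim_bound hD h_sq h5 hk_le).not_ge hle
end
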